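/- Let n ≥ 3 and m ≥ 2, and let f = (f^1,…,f^m) : ℝ^n → ℝ^m be a smooth map whose graph M = {(x, f(x)) : x ∈ ℝ^n} ⊂ ℝ^{n+m} has parallel mean curvature (in the sense defined in the context). Suppose there exist real numbers β₀ < +∞ and β₁ < 3 such that for all x ∈ ℝ^n: Δ_f(x) = [det(δ_{ij} + Σ_{α=1}^m ∂f^α/∂x^i (x) ∂f^α/∂x^j (x))]^{1/2} ≤ β₀, and Δ_f(x) ≤ β₁ (1 + (∂f^1/∂x^1 (x))²)^{1/2}. Then f^1,…,f^m are affine linear, i.e. there exist a real m×n matrix A and b ∈ ℝ^m with f(x) = Ax + b for all x (so that M is an affine n-plane). -/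

import Mathlib

noncomputable section

open scoped BigOperators

/-- Partial derivative of a scalar function on `ℝ^n` in the `i`-th coordinate direction. -/
def pderiv' {n : ℕ} (i : Fin n) (φ : (Fin n → ℝ) → ℝ) (x : Fin n → ℝ) : ℝ :=
  fderiv ℝ φ x (Pi.single i 1)

/-- The induced metric `g_{ij} = δ_{ij} + Σ_α ∂f^α/∂x^i ∂f^α/∂x^j` of the graph of `f`. -/
def graphMetric {n m : ℕ} (f : (Fin n → ℝ) → (Fin m → ℝ)) (x : Fin n → ℝ) :
    Matrix (Fin n) (Fin n) ℝ :=
  Matrix.of fun i j => (if i = j then (1 : ℝ) else 0) +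
    ∑ α : Fin m, pderiv' i (fun y => f y α) x * pderiv' j (fun y => f y α) x

/-- The slope function `Δ_f = (det g)^{1/2}`. -/
def slopeFunction {n m : ℕ} (f : (Fin n → ℝ) → (Fin m → ℝ)) (x : Fin n → ℝ) : ℝ :=
  Real.sqrt (graphMetric f x).det

/-- The graph map `F(x) = (x, f(x)) ∈ ℝ^{n+m}`, with `ℝ^{n+m}` realized as `Fin n ⊕ Fin m → ℝ`. -/
def graphMap {n m : ℕ} (f : (Fin n → ℝ) → (Fin m → ℝ)) (x : Fin n → ℝ) :
    Fin n ⊕ Fin m → ℝ :=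
  Sum.elim x (f x)

/-- The tangent vector `∂_i F(x)` of the graph. -/
def graphTangent {n m : ℕ} (f : (Fin n → ℝ) → (Fin m → ℝ)) (i : Fin n) (x : Fin n → ℝ) :
    Fin n ⊕ Fin m → ℝ :=
  fun k => pderiv' i (fun y => graphMap f y k) x

/-- The orthogonal projection onto the normal space of the graph at `F(x)`:
`P_N = I_{n+m} − Σ_{i,j} g^{ij} ∂_iF (∂_jF)ᵀ`. -/
def normalProjection {n m : ℕ} (f : (Fin n → ℝ) → (Fin m → ℝ)) (x : Fin n → ℝ) :
    Matrix (Fin n ⊕ Fin m) (Fin n ⊕ Fin m) ℝ :=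
  Matrix.of fun k l => (if k = l then (1 : ℝ) else 0) -
    ∑ i : Fin n, ∑ j : Fin n,
      (graphMetric f x)⁻¹ i j * graphTangent f i x k * graphTangent f j x l

/-- The mean curvature vector `H(x) = Σ_{i,j} g^{ij} P_N(∂_i∂_jF)` of the graph. -/
def meanCurvature {n m : ℕ} (f : (Fin n → ℝ) → (Fin m → ℝ)) (x : Fin n → ℝ) :
    Fin n ⊕ Fin m → ℝ :=
  fun k => ∑ i : Fin n, ∑ j : Fin n, (graphMetric f x)⁻¹ i j *
    ∑ l : Fin n ⊕ Fin m,
      normalProjection f x k l * pderiv' i (fun y => graphTangent f j y l) x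

/-- The graph of `f` has parallel mean curvature: the normal projection of every directional
derivative of the mean curvature vector field vanishes, `P_N(D_v H) = 0`. -/
def HasParallelMeanCurvature {n m : ℕ} (f : (Fin n → ℝ) → (Fin m → ℝ)) : Prop :=
  ∀ (x v : Fin n → ℝ) (k : Fin n ⊕ Fin m),
    ∑ l : Fin n ⊕ Fin m,
      normalProjection f x k l * fderiv ℝ (fun y => meanCurvature f y l) x v = 0

/-- Directional derivative of a real function. -/
def dirDeriv {E : Type*} [NormedAddCommGroup E] [NormedSpace ℝ E] (v : E) (φ : E → ℝ) (x : E) : ℝ :=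
  fderiv ℝ φ x v

/-- Infinitely differentiable real functions. -/
abbrev Smooth {E : Type*} [NormedAddCommGroup E] [NormedSpace ℝ E] (φ : E → ℝ) : Prop :=
  ContDiff ℝ (⊤ : ℕ∞) φ

section Calculus

variable {E : Type*} [NormedAddCommGroup E] [NormedSpace ℝ E]

lemma Smooth.differentiable {φ : E → ℝ} (h : Smooth φ) : Differentiable ℝ φ :=
  ContDiff.differentiable h (by simp)

lemma Smooth.differentiableAt {φ : E → ℝ} (h : Smooth φ) {x : E} : DifferentiableAt ℝ φ x :=
  h.differentiable x

lemma Smooth.dirDeriv {φ : E → ℝ} (h : Smooth φ) (v : E) : Smooth (dirDeriv v φ) := by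
  have : ContDiff ℝ (⊤ : ℕ∞) (fderiv ℝ φ) := ContDiff.fderiv_right h (by simp)
  exact this.clm_apply contDiff_const

lemma dirDeriv_add {φ ψ : E → ℝ} {x : E} (v : E) (hφ : DifferentiableAt ℝ φ x)
    (hψ : DifferentiableAt ℝ ψ x) :
    dirDeriv v (fun y => φ y + ψ y) x = dirDeriv v φ x + dirDeriv v ψ x := by
  simp [dirDeriv, fderiv_fun_add hφ hψ]

lemma dirDeriv_sub {φ ψ : E → ℝ} {x : E} (v : E) (hφ : DifferentiableAt ℝ φ x)
    (hψ : DifferentiableAt ℝ ψ x) :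
    dirDeriv v (fun y => φ y - ψ y) x = dirDeriv v φ x - dirDeriv v ψ x := by
  simp [dirDeriv, fderiv_fun_sub hφ hψ]

lemma dirDeriv_mul {φ ψ : E → ℝ} {x : E} (v : E) (hφ : DifferentiableAt ℝ φ x)
    (hψ : DifferentiableAt ℝ ψ x) :
    dirDeriv v (fun y => φ y * ψ y) x = dirDeriv v φ x * ψ x + φ x * dirDeriv v ψ x := by
  simp [dirDeriv, fderiv_fun_mul hφ hψ]; ring

lemma dirDeriv_const_mul {φ : E → ℝ} {x : E} (v : E) (hφ : DifferentiableAt ℝ φ x) (c : ℝ) :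
    dirDeriv v (fun y => c * φ y) x = c * dirDeriv v φ x := by
  simp [dirDeriv, fderiv_const_mul hφ]

@[simp] lemma dirDeriv_const (v : E) (c : ℝ) (x : E) : dirDeriv v (fun _ : E => c) x = 0 := by
  simp [dirDeriv]

lemma dirDeriv_sum {ι : Type*} {s : Finset ι} {φ : ι → E → ℝ} {x : E} (v : E)
    (h : ∀ i ∈ s, DifferentiableAt ℝ (φ i) x) :
    dirDeriv v (fun y => ∑ i ∈ s, φ i y) x = ∑ i ∈ s, dirDeriv v (φ i) x := by
  simp [dirDeriv, fderiv_fun_sum h]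

lemma dirDeriv_comp {φ : E → ℝ} {x : E} (v : E) {h : ℝ → ℝ} {h' : ℝ}
    (hh : HasDerivAt h h' (φ x)) (hφ : DifferentiableAt ℝ φ x) :
    dirDeriv v (fun y => h (φ y)) x = h' * dirDeriv v φ x := by
  have := (hh.comp_hasFDerivAt x hφ.hasFDerivAt).fderiv
  simp only [dirDeriv]
  change (fderiv ℝ (h ∘ φ) x) v = _
  rw [this]; simp

lemma dirDeriv_comm {φ : E → ℝ} (h : Smooth φ) (v w : E) (x : E) :
    dirDeriv v (dirDeriv w φ) x = dirDeriv w (dirDeriv v φ) x := by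
  have hd : DifferentiableAt ℝ (fderiv ℝ φ) x :=
    (ContDiff.fderiv_right (m := 1) (n := (⊤ : ℕ∞)) h (by norm_cast)).differentiable (by simp) x
  have key : ∀ a b : E, dirDeriv a (dirDeriv b φ) x = fderiv ℝ (fderiv ℝ φ) x a b := by
    intro a b
    change fderiv ℝ (fun y => fderiv ℝ φ y b) x a = _
    rw [fderiv_clm_apply hd (differentiableAt_const _)]
    simp
  rw [key, key]
  refine (h.contDiffAt.isSymmSndFDerivAt ?_) v w
  rw [minSmoothness_of_isRCLikeNormedField]
  exact WithTop.coe_le_coe.2 (le_top : (2 : ℕ∞) ≤ ⊤)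

lemma dirDeriv_sum_smul {ι : Type*} (s : Finset ι) (c : ι → ℝ) (e : ι → E) (φ : E → ℝ) (x : E) :
    dirDeriv (∑ i ∈ s, c i • e i) φ x = ∑ i ∈ s, c i * dirDeriv (e i) φ x := by
  simp [dirDeriv]

end Calculus

section DetCalculus

variable {E : Type*} [NormedAddCommGroup E] [NormedSpace ℝ E]
variable {ι : Type*} [Fintype ι] [DecidableEq ι]

/-- The entrywise directional derivative of a matrix function. -/
def matDeriv {κ : Type*} (v : E) (M : E → Matrix ι κ ℝ) (x : E) : Matrix ι κ ℝ :=
  Matrix.of fun i j => dirDeriv v (fun y => M y i j) x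

lemma smooth_det {M : E → Matrix ι ι ℝ} (hM : ∀ i j, Smooth fun y => M y i j) :
    Smooth fun y => (M y).det := by
  simp only [Matrix.det_apply']
  exact ContDiff.sum fun σ _ => contDiff_const.mul (contDiff_prod fun i _ => hM _ _)

lemma smooth_inv {M : E → Matrix ι ι ℝ} (hM : ∀ i j, Smooth fun y => M y i j)
    (hdet : ∀ y, (M y).det ≠ 0) (i j : ι) : Smooth fun y => (M y)⁻¹ i j := by
  have : (fun y => (M y)⁻¹ i j) = fun y => ((M y).det)⁻¹ * (M y).adjugate i j := by
    funext y
    simp [Matrix.inv_def, Ring.inverse_eq_inv']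
  rw [this]
  refine ((smooth_det hM).inv hdet).mul ?_
  simp only [Matrix.adjugate_apply]
  refine smooth_det fun a b => ?_
  by_cases h : a = j
  · subst h; simp [Matrix.updateRow_self, contDiff_const]
  · simp [Matrix.updateRow_ne h, hM]

/-- Jacobi's formula for the derivative of a determinant. -/
lemma dirDeriv_det {M : E → Matrix ι ι ℝ} {x : E}
    (hM : ∀ i j, DifferentiableAt ℝ (fun y => M y i j) x) (v : E) :
    dirDeriv v (fun y => (M y).det) x = ((M x).adjugate * matDeriv v M x).trace := by
  have h1 : HasFDerivAt (fun y => (M y).det)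
      (∑ σ : Equiv.Perm ι, ((Equiv.Perm.sign σ : ℤ) : ℝ) •
        ∑ i, (∏ j ∈ Finset.univ.erase i, M x (σ j) j) • fderiv ℝ (fun y => M y (σ i) i) x) x := by
    simp only [Matrix.det_apply']
    refine HasFDerivAt.fun_sum fun σ _ => ?_
    refine HasFDerivAt.const_mul ?_ _
    exact HasFDerivAt.finsetProd fun i _ => (hM (σ i) i).hasFDerivAt
  have h2 : ((M x).adjugate * matDeriv v M x).trace =
      ∑ i, ((M x).updateCol i fun a => matDeriv v M x a i).det := by
    simp only [Matrix.trace, Matrix.diag_apply]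
    refine Finset.sum_congr rfl fun i _ => ?_
    rw [← Matrix.cramer_apply, Matrix.cramer_eq_adjugate_mulVec]
    rfl
  rw [h2, dirDeriv, h1.fderiv]
  simp only [Matrix.det_apply', sum_apply, smul_apply,
    smul_eq_mul]
  rw [Finset.sum_comm]
  refine Finset.sum_congr rfl fun σ _ => ?_
  rw [Finset.mul_sum]
  refine Finset.sum_congr rfl fun i _ => ?_
  congr 1
  rw [← Finset.mul_prod_erase Finset.univ _ (Finset.mem_univ i)]
  rw [Matrix.updateCol_self, mul_comm]
  congr 1
  refine Finset.prod_congr rfl fun j hj => ?_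
  rw [Matrix.updateCol_ne (Finset.ne_of_mem_erase hj)]

lemma dirDeriv_matrix_mul {ι κ μ : Type*} [Fintype κ] {M : E → Matrix ι κ ℝ}
    {N : E → Matrix κ μ ℝ} {x : E} (hM : ∀ i j, DifferentiableAt ℝ (fun y => M y i j) x)
    (hN : ∀ i j, DifferentiableAt ℝ (fun y => N y i j) x) (v : E) (i : ι) (j : μ) :
    dirDeriv v (fun y => (M y * N y) i j) x =
      (matDeriv v M x * N x) i j + (M x * matDeriv v N x) i j := by
  simp only [Matrix.mul_apply]
  rw [dirDeriv_sum v fun k _ => (hM i k).fun_mul (hN k j), ← Finset.sum_add_distrib]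
  exact Finset.sum_congr rfl fun k _ => dirDeriv_mul v (hM i k) (hN k j)

lemma matDeriv_inv {M : E → Matrix ι ι ℝ} (hM : ∀ i j, Smooth fun y => M y i j)
    (hdet : ∀ y, (M y).det ≠ 0) (v x : E) :
    matDeriv v (fun y => (M y)⁻¹) x = -((M x)⁻¹ * matDeriv v M x * (M x)⁻¹) := by
  have hi := smooth_inv hM hdet
  have h1 : ∀ i j, (matDeriv v (fun y => (M y)⁻¹) x * M x) i j +
      ((M x)⁻¹ * matDeriv v M x) i j = 0 := by
    intro i j
    rw [← dirDeriv_matrix_mul (fun i j => (hi i j).differentiableAt)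
      (fun i j => (hM i j).differentiableAt)]
    have : (fun y => ((M y)⁻¹ * M y) i j) = fun _ => (1 : Matrix ι ι ℝ) i j := by
      funext y
      rw [Matrix.nonsing_inv_mul _ (isUnit_iff_ne_zero.2 (hdet y))]
    rw [this, dirDeriv_const]
  have h2 : matDeriv v (fun y => (M y)⁻¹) x * M x = -((M x)⁻¹ * matDeriv v M x) := by
    ext i j
    have := h1 i j
    simp only [Matrix.neg_apply]; linarith
  have h3 := congrArg (· * (M x)⁻¹) h2
  simpa [Matrix.mul_assoc, Matrix.mul_nonsing_inv _ (isUnit_iff_ne_zero.2 (hdet x))] using h3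

end DetCalculus

section AlgebraicInequality

lemma quadratic_two_nonneg {α γ β : ℝ} (hα : 0 ≤ α) (hγ : 0 ≤ γ) (h : β ^ 2 ≤ α * γ) (q r : ℝ) :
    0 ≤ α * q ^ 2 + γ * r ^ 2 + 2 * β * q * r := by
  rcases hα.eq_or_lt with h0 | h0
  · subst h0
    have : β = 0 := by nlinarith
    subst this
    simp only [mul_zero, zero_mul, add_zero, zero_add]
    positivity
  · have : 0 ≤ α * (α * q ^ 2 + γ * r ^ 2 + 2 * β * q * r) := by
      nlinarith [sq_nonneg (α * q + β * r), mul_nonneg (sub_nonneg.2 h) (sq_nonneg r)]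
    exact nonneg_of_mul_nonneg_right this h0

lemma symmetric_mean_ineq {x y z : ℝ} (hx : 0 ≤ x) (hy : 0 ≤ y) (hz : 0 ≤ z)
    (h : (1 + x) * (1 + y) * (1 + z) ≤ 9) : x * y + y * z + x * z ≤ 4 + x * y * z := by
  by_contra hcon
  push Not at hcon
  have hxyz : 0 ≤ x * y * z := by positivity
  have h1 : x + y + z < 4 - 2 * (x * y * z) := by nlinarith
  have hs : 3 ≤ x + y + z := by
    nlinarith [sq_nonneg (x - y), sq_nonneg (y - z), sq_nonneg (x - z)]
  have schur : 0 ≤ (x + y + z) ^ 3 - 4 * (x + y + z) * (x * y + y * z + x * z)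
      + 9 * (x * y * z) := by
    rcases le_total x y with a | a <;> rcases le_total y z with b | b <;>
      rcases le_total x z with c | c <;>
      nlinarith [mul_nonneg (sub_nonneg.2 a) (sub_nonneg.2 b), mul_nonneg (sub_nonneg.2 a)
        (sub_nonneg.2 c), mul_nonneg (sub_nonneg.2 b) (sub_nonneg.2 c),
        mul_nonneg hx (mul_nonneg (sub_nonneg.2 a) (sub_nonneg.2 c)),
        mul_nonneg hz (mul_nonneg (sub_nonneg.2 b) (sub_nonneg.2 c)),
        mul_nonneg hy (mul_nonneg (sub_nonneg.2 a) (sub_nonneg.2 b)),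
        mul_nonneg hz (sq_nonneg (x - y)), mul_nonneg hx (sq_nonneg (y - z)),
        mul_nonneg hy (sq_nonneg (x - z)), mul_nonneg (add_nonneg hx hy) (sq_nonneg (x - y)),
        mul_nonneg (add_nonneg hy hz) (sq_nonneg (y - z)),
        mul_nonneg (add_nonneg hx hz) (sq_nonneg (x - z))]
  set e1 := x + y + z
  set e2 := x * y + y * z + x * z
  set e3 := x * y * z
  have he : e1 ^ 2 - 4 * e2 < -16 * e3 := by nlinarith
  nlinarith

lemma quadratic_three_nonneg {a b c : ℝ}
    (h : (1 + a ^ 2) * (1 + b ^ 2) * (1 + c ^ 2) ≤ 9) (p q r : ℝ) :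
    0 ≤ p ^ 2 + q ^ 2 + r ^ 2 + a * b * p * q + b * c * q * r + a * c * p * r := by
  have hm := symmetric_mean_ineq (sq_nonneg a) (sq_nonneg b) (sq_nonneg c) h
  have hab : a ^ 2 * b ^ 2 ≤ 4 := by
    have : (1 + a ^ 2) * (1 + b ^ 2) ≤ 9 :=
      le_trans (le_mul_of_one_le_right (by positivity) (by nlinarith [sq_nonneg c])) h
    nlinarith [sq_nonneg (a ^ 2 - b ^ 2), sq_nonneg a, sq_nonneg b,
      mul_nonneg (sq_nonneg a) (sq_nonneg b)]
  have hac : a ^ 2 * c ^ 2 ≤ 4 := by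
    have : (1 + a ^ 2) * (1 + c ^ 2) ≤ 9 := by
      refine le_trans ?_ h
      have : 0 ≤ (1 + a ^ 2) * b ^ 2 * (1 + c ^ 2) := by positivity
      nlinarith
    nlinarith [sq_nonneg (a ^ 2 - c ^ 2), sq_nonneg a, sq_nonneg c,
      mul_nonneg (sq_nonneg a) (sq_nonneg c)]
  have := quadratic_two_nonneg (α := 1 - (a * b / 2) ^ 2) (γ := 1 - (a * c / 2) ^ 2)
    (β := b * c / 2 - (a * b / 2) * (a * c / 2)) (by nlinarith) (by nlinarith) (by nlinarith) q r
  nlinarith [sq_nonneg (p + a * b / 2 * q + a * c / 2 * r)]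

variable {ι : Type*} [DecidableEq ι]

lemma one_add_sum_le_prod_one_add (s : Finset ι) (x : ι → ℝ) (hx : ∀ i, 0 ≤ x i) :
    1 + ∑ i ∈ s, x i ≤ ∏ i ∈ s, (1 + x i) := by
  induction s using Finset.induction_on with
  | empty => simp
  | insert a s ha ih =>
    rw [Finset.sum_insert ha, Finset.prod_insert ha]
    have : 0 ≤ ∑ i ∈ s, x i := Finset.sum_nonneg fun i _ => hx i
    nlinarith [hx a, mul_nonneg (hx a) this]

lemma weighted_sum_sq_le {ι : Type*} (s : Finset ι) (l a D : ι → ℝ)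
    (hD : ∀ i ∈ s, 3 / 2 ≤ D i) (hl : ∑ i ∈ s, l i ^ 2 ≤ 1 / 8) :
    (∑ i ∈ s, l i * a i) ^ 2 ≤ 1 / 12 * ∑ i ∈ s, D i * a i ^ 2 := by
  have h1 := Finset.sum_mul_sq_le_sq_mul_sq s l a
  have h2 : 3 / 2 * ∑ i ∈ s, a i ^ 2 ≤ ∑ i ∈ s, D i * a i ^ 2 := by
    rw [Finset.mul_sum]
    exact Finset.sum_le_sum fun i hi => mul_le_mul_of_nonneg_right (hD i hi) (sq_nonneg _)
  have h3 : 0 ≤ ∑ i ∈ s, a i ^ 2 := Finset.sum_nonneg fun i _ => sq_nonneg _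
  nlinarith

lemma fixed_index_nonneg (s : Finset ι) (l : ι → ℝ) (m : ℝ)
    (h : (1 + m ^ 2) * ∏ i ∈ s, (1 + l i ^ 2) ≤ 9) (c : ℝ) (a b : ι → ℝ) :
    0 ≤ (1 + m ^ 2) * c ^ 2 + ∑ i ∈ s, ((2 + l i ^ 2) * a i ^ 2 + b i ^ 2
      + 2 * (l i * m * a i * b i)) + 12 * (m * c + ∑ i ∈ s, l i * a i) ^ 2 := by
  set D : ι → ℝ := fun i => 2 - l i ^ 2 * (m ^ 2 - 1) with hDdef
  have hb : ∑ i ∈ s, D i * a i ^ 2 ≤ ∑ i ∈ s, ((2 + l i ^ 2) * a i ^ 2 + b i ^ 2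
      + 2 * (l i * m * a i * b i)) := by
    refine Finset.sum_le_sum fun i _ => ?_
    simp only [hDdef]
    nlinarith [sq_nonneg (b i + l i * m * a i)]
  suffices 0 ≤ (1 + m ^ 2) * c ^ 2 + ∑ i ∈ s, D i * a i ^ 2
      + 12 * (m * c + ∑ i ∈ s, l i * a i) ^ 2 by linarith
  by_cases hall : ∀ i ∈ s, 0 ≤ D i
  · have : 0 ≤ ∑ i ∈ s, D i * a i ^ 2 :=
      Finset.sum_nonneg fun i hi => mul_nonneg (hall i hi) (sq_nonneg _)
    positivity
  push Not at hall
  obtain ⟨j, hj, hDj⟩ := hall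
  rw [← Finset.add_sum_erase s _ hj, ← Finset.add_sum_erase s (fun i => l i * a i) hj]
  rw [← Finset.mul_prod_erase s _ hj] at h
  have hp := one_add_sum_le_prod_one_add (s.erase j) (fun i => l i ^ 2) fun i => sq_nonneg _
  have hS : 0 ≤ ∑ i ∈ s.erase j, l i ^ 2 := Finset.sum_nonneg fun i _ => sq_nonneg _
  set S := ∑ i ∈ s.erase j, l i ^ 2 with hSdef
  set P := ∏ i ∈ s.erase j, (1 + l i ^ 2)
  set x := l j ^ 2 with hx
  have hx0 : 0 ≤ x := sq_nonneg _
  set y := m ^ 2 with hy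
  have hy0 : 0 ≤ y := sq_nonneg _
  have hxy : 2 < x * (y - 1) := by simp only [hDdef] at hDj; linarith
  have hy1 : 1 < y := by nlinarith
  have hxyP : (1 + x) * (1 + y) * P ≤ 9 := by nlinarith
  have h8 : 8 ≤ (1 + x) * (1 + y) := by
    have : 8 * (y - 1) ≤ (1 + x) * (1 + y) * (y - 1) := by nlinarith [sq_nonneg (y - 3)]
    exact le_of_mul_le_mul_right this (by linarith)
  have hS8 : S ≤ 1 / 8 := by
    have : 8 * (1 + S) ≤ 9 := le_trans (mul_le_mul h8 hp (by linarith) (by linarith)) hxyP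
    linarith
  have h9 : (1 + x) * (1 + y) ≤ 9 :=
    le_trans (le_mul_of_one_le_right (by positivity) (by linarith)) hxyP
  have hy5 : y ≤ 5 := by
    by_contra hc
    push Not at hc
    nlinarith
  have hy2 : x * (y - 2) ≤ 2 := by
    by_contra hc
    push Not at hc
    nlinarith [sq_nonneg (y - 4)]
  have hDs : ∀ i ∈ s.erase j, 3 / 2 ≤ D i := by
    intro i hi
    have : l i ^ 2 ≤ 1 / 8 :=
      le_trans (Finset.single_le_sum (f := fun i => l i ^ 2) (fun i _ => sq_nonneg _) hi) hS8
    simp only [hDdef]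
    nlinarith [sq_nonneg (l i)]
  have hw := weighted_sum_sq_le (s.erase j) l a D hDs hS8
  set W := ∑ i ∈ s.erase j, D i * a i ^ 2
  set V := ∑ i ∈ s.erase j, l i * a i
  have hDj' : -D j ≤ x := by simp only [hDdef]; linarith
  have hmain : x * a j ^ 2 ≤ 12 * (m * c + (l j * a j + V)) ^ 2 + (1 + y) * c ^ 2 + W := by
    have hmc : (m * c) ^ 2 ≤ 5 / 6 * ((1 + y) * c ^ 2) := by nlinarith [sq_nonneg c]
    set T := m * c + (l j * a j + V) with hT
    have hla : x * a j ^ 2 = (T - m * c - V) ^ 2 := by rw [hT, hx]; ring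
    rw [hla]
    have c1 : (T - m * c - V) ^ 2 ≤ 12 * T ^ 2 + 6 / 5 * (m * c) ^ 2 + 12 * V ^ 2 := by
      nlinarith [sq_nonneg (5 * (12 * T) + 6 * (m * c)), sq_nonneg (5 * (12 * V) - 6 * (m * c)),
        sq_nonneg (T + V)]
    linarith
  nlinarith [sq_nonneg (a j)]

lemma sum_triple_decomposition [Fintype ι] (f : ι → ι → ι → ℝ) :
    ∑ i, ∑ j, ∑ k, f i j k =
      (∑ i, ∑ j, ∑ k, if i ≠ j ∧ j ≠ k ∧ i ≠ k then f i j k else 0) +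
      ∑ k, (f k k k + ∑ i ∈ Finset.univ.erase k, (f i i k + f i k i + f k i i)) := by
  have herase : ∀ (k : ι) (φ : ι → ℝ), ∑ i ∈ Finset.univ.erase k, φ i =
      ∑ i, if i = k then 0 else φ i := by
    intro k φ
    rw [← Finset.filter_ne', Finset.sum_filter]
    exact Finset.sum_congr rfl fun i _ => by by_cases h : i = k <;> simp [h]
  have hsplit : ∀ i j k, f i j k = (if i ≠ j ∧ j ≠ k ∧ i ≠ k then f i j k else 0)
      + (if k = i then (if j = i then f i i i else 0) else 0)
      + (if j = i then (if i = k then 0 else f i i k) else 0)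
      + (if k = i then (if i = j then 0 else f i j i) else 0)
      + (if k = j then (if j = i then 0 else f i j j) else 0) := by
    intro i j k
    by_cases h1 : i = j <;> by_cases h2 : j = k <;> by_cases h3 : i = k <;>
      simp_all [eq_comm]
  have e1 : ∑ i, ∑ j, ∑ k, f i j k =
      (∑ i, ∑ j, ∑ k, if i ≠ j ∧ j ≠ k ∧ i ≠ k then f i j k else 0)
      + (∑ i, f i i i) + (∑ i, ∑ k, if i = k then 0 else f i i k)
      + (∑ i, ∑ j, if i = j then 0 else f i j i) + (∑ i, ∑ j, if j = i then 0 else f i j j) := by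
    conv_lhs =>
      enter [2, i, 2, j, 2, k]
      rw [hsplit i j k]
    simp only [Finset.sum_add_distrib]
    congr 1
    congr 1
    congr 1
    congr 1
    · simp
    · refine Finset.sum_congr rfl fun i _ => ?_
      rw [Finset.sum_comm]; simp
    · simp
    · simp
  rw [e1]
  simp only [herase, Finset.sum_add_distrib]
  have e2 : ∀ k i : ι, (if i = k then 0 else (f i i k + f i k i + f k i i)) =
      (if i = k then 0 else f i i k) + (if i = k then 0 else f i k i)
        + (if i = k then 0 else f k i i) := by
    intro k i; by_cases h : i = k <;> simp [h]
  simp only [e2, Finset.sum_add_distrib]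
  rw [Finset.sum_comm (f := fun k i => if i = k then 0 else f i i k),
    Finset.sum_comm (f := fun k i => if i = k then 0 else f i k i)]
  ring

lemma sum_cyclic {ι : Type*} [Fintype ι] (φ : ι → ι → ι → ℝ) :
    ∑ i, ∑ j, ∑ k, φ i j k = ∑ i, ∑ j, ∑ k, φ j k i := by
  rw [Finset.sum_comm (f := fun i j => ∑ k, φ j k i)]
  exact Finset.sum_congr rfl fun j _ => Finset.sum_comm

/-- The algebraic inequality behind the slope bound `3`. -/
lemma slope_algebraic_inequality [Fintype ι] (l : ι → ℝ) (hl : ∏ i, (1 + l i ^ 2) ≤ 9)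
    (h : ι → ι → ι → ℝ) (hsymm : ∀ i j k, h i j k = h i k j) :
    0 ≤ (∑ i, ∑ j, ∑ k, h i j k ^ 2) + (∑ i, ∑ j, ∑ k, l i * l j * h i j k * h j i k)
      + 12 * ∑ k, (∑ i, l i * h i i k) ^ 2 := by
  set f : ι → ι → ι → ℝ := fun i j k => h i j k ^ 2 + l i * l j * h i j k * h j i k with hf
  have e : (∑ i, ∑ j, ∑ k, h i j k ^ 2) + (∑ i, ∑ j, ∑ k, l i * l j * h i j k * h j i k)
      = ∑ i, ∑ j, ∑ k, f i j k := by
    simp only [hf, Finset.sum_add_distrib]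
  rw [e, sum_triple_decomposition]
  have hone : ∀ i ∈ Finset.univ, (1 : ℝ) ≤ 1 + l i ^ 2 := fun i _ => by nlinarith [sq_nonneg (l i)]
  have hdist : 0 ≤ ∑ i, ∑ j, ∑ k, if i ≠ j ∧ j ≠ k ∧ i ≠ k then f i j k else 0 := by
    set φ : ι → ι → ι → ℝ := fun i j k => if i ≠ j ∧ j ≠ k ∧ i ≠ k then f i j k else 0
    have c3 : 0 ≤ ∑ i, ∑ j, ∑ k, (φ i j k + φ j k i + φ k i j) := by
      refine Finset.sum_nonneg fun i _ => Finset.sum_nonneg fun j _ =>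
        Finset.sum_nonneg fun k _ => ?_
      by_cases hd : i ≠ j ∧ j ≠ k ∧ i ≠ k
      · obtain ⟨h1, h2, h3⟩ := hd
        have hp : (1 + l i ^ 2) * (1 + l j ^ 2) * (1 + l k ^ 2) ≤ 9 := by
          refine le_trans ?_ hl
          rw [← Finset.mul_prod_erase Finset.univ _ (Finset.mem_univ i),
            ← Finset.mul_prod_erase (Finset.univ.erase i) _
              (Finset.mem_erase.2 ⟨h1.symm, Finset.mem_univ j⟩),
            ← Finset.mul_prod_erase ((Finset.univ.erase i).erase j) _
              (Finset.mem_erase.2 ⟨h2.symm, Finset.mem_erase.2 ⟨h3.symm, Finset.mem_univ k⟩⟩),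
            mul_assoc]
          have hP : 1 ≤ ∏ i ∈ ((Finset.univ.erase i).erase j).erase k, (1 + l i ^ 2) := by
            have := one_add_sum_le_prod_one_add (((Finset.univ.erase i).erase j).erase k)
              (fun i => l i ^ 2) fun i => sq_nonneg _
            refine le_trans ?_ this
            have := Finset.sum_nonneg fun a (_ : a ∈ ((Finset.univ.erase i).erase j).erase k) =>
              sq_nonneg (l a)
            linarith
          gcongr
          exact le_mul_of_one_le_right (by positivity) hP
        have := quadratic_three_nonneg hp (h i j k) (h j k i) (h k i j)
        simp only [φ, hf, h1, h2, h3, h1.symm, h2.symm, h3.symm, ne_eq, not_false_eq_true,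
          and_self, if_true]
        rw [hsymm j i k, hsymm k j i, hsymm i k j]
        linarith
      · have hd2 : ¬ (j ≠ k ∧ k ≠ i ∧ j ≠ i) := fun ⟨a, b, c⟩ => hd ⟨c.symm, a, b.symm⟩
        have hd3 : ¬ (k ≠ i ∧ i ≠ j ∧ k ≠ j) := fun ⟨a, b, c⟩ => hd ⟨b, c.symm, a.symm⟩
        simp only [φ, hd, hd2, hd3, if_false]
        norm_num
    simp only [Finset.sum_add_distrib] at c3
    rw [← sum_cyclic φ, ← sum_cyclic (fun i j k => φ j k i), ← sum_cyclic φ] at c3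
    linarith
  have hfix : ∀ k, 0 ≤ (f k k k + ∑ i ∈ Finset.univ.erase k, (f i i k + f i k i + f k i i))
      + 12 * (∑ i, l i * h i i k) ^ 2 := by
    intro k
    have := fixed_index_nonneg (Finset.univ.erase k) l (l k)
      (by rwa [Finset.mul_prod_erase Finset.univ (fun i => 1 + l i ^ 2) (Finset.mem_univ k)])
      (h k k k) (fun i => h i i k) (fun i => h k i i)
    rw [Finset.add_sum_erase Finset.univ (fun i => l i * h i i k) (Finset.mem_univ k)] at this
    refine this.trans_eq ?_
    congr 1
    congr 1
    · simp only [hf]; ring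
    · refine Finset.sum_congr rfl fun i _ => ?_
      simp only [hf, hsymm i k i]; ring
  have := Finset.sum_nonneg fun k (_ : k ∈ Finset.univ) => hfix k
  rw [Finset.sum_add_distrib, ← Finset.mul_sum] at this
  linarith

end AlgebraicInequality

section SecondVariation

variable {E : Type*} [NormedAddCommGroup E] [NormedSpace ℝ E]
variable {ι κ : Type*} [Fintype ι] [DecidableEq ι] [Fintype κ]

lemma smooth_adjugate {M : E → Matrix ι ι ℝ} (hM : ∀ i j, Smooth fun y => M y i j) (i j : ι) :
    Smooth fun y => (M y).adjugate i j := by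
  simp only [Matrix.adjugate_apply]
  refine smooth_det fun a b => ?_
  by_cases h : a = j
  · subst h; simp [Matrix.updateRow_self, contDiff_const]
  · simp [Matrix.updateRow_ne h, hM]

lemma dirDeriv_det_at_one {M : E → Matrix ι ι ℝ} (hM : ∀ i j, Smooth fun y => M y i j) {x : E}
    (hx : M x = 1) (v : E) :
    dirDeriv v (fun y => (M y).det) x = ∑ i, dirDeriv v (fun y => M y i i) x := by
  rw [dirDeriv_det fun i j => (hM i j).differentiableAt, hx]
  simp [Matrix.trace, matDeriv]

lemma dirDeriv_dirDeriv_det_at_one {M : E → Matrix ι ι ℝ} (hM : ∀ i j, Smooth fun y => M y i j)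
    {x : E} (hx : M x = 1) (v : E) :
    dirDeriv v (dirDeriv v (fun y => (M y).det)) x =
      (∑ i, dirDeriv v (fun y => M y i i) x) ^ 2
      + (∑ i, dirDeriv v (dirDeriv v (fun y => M y i i)) x)
      - ∑ i, ∑ j, dirDeriv v (fun y => M y i j) x * dirDeriv v (fun y => M y j i) x := by
  have hadj := smooth_adjugate hM
  have hmd : ∀ i j, Smooth fun y => matDeriv v M y i j := fun i j => (hM i j).dirDeriv v
  have e1 : dirDeriv v (fun y => (M y).det) =
      fun y => ∑ i, ((M y).adjugate * matDeriv v M y) i i := by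
    funext y
    rw [dirDeriv_det fun i j => (hM i j).differentiableAt]; rfl
  have hadjd : ∀ i j, matDeriv v (fun y => (M y).adjugate) x i j =
      (if i = j then ∑ i, dirDeriv v (fun y => M y i i) x else 0)
        - dirDeriv v (fun y => M y i j) x := by
    intro i j
    have h1 := dirDeriv_matrix_mul (M := fun y => (M y).adjugate) (N := M) (x := x)
      (fun i j => (hadj i j).differentiableAt) (fun i j => (hM i j).differentiableAt) v i j
    have h2 : (fun y => ((M y).adjugate * M y) i j) =
        fun y => (1 : Matrix ι ι ℝ) i j * (M y).det := by
      funext y; rw [Matrix.adjugate_mul]; simp [mul_comm]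
    rw [h2, dirDeriv_const_mul v (smooth_det hM).differentiableAt, hx, dirDeriv_det_at_one hM hx]
      at h1
    simp only [Matrix.mul_one, Matrix.adjugate_one, Matrix.one_mul] at h1
    have h3 : matDeriv v M x i j = dirDeriv v (fun y => M y i j) x := rfl
    rw [h3, Matrix.one_apply] at h1
    split_ifs at h1 ⊢ <;> linarith
  rw [e1, dirDeriv_sum]
  swap
  · intro i _
    simp only [Matrix.mul_apply]
    exact (ContDiff.sum fun j _ => (hadj i j).mul (hmd j i)).differentiable (by simp) x
  have e2 : ∀ i, dirDeriv v (fun y => ((M y).adjugate * matDeriv v M y) i i) x =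
      (∑ i, dirDeriv v (fun y => M y i i) x) * dirDeriv v (fun y => M y i i) x
        - (∑ j, dirDeriv v (fun y => M y i j) x * dirDeriv v (fun y => M y j i) x)
        + dirDeriv v (dirDeriv v (fun y => M y i i)) x := by
    intro i
    rw [dirDeriv_matrix_mul (fun i j => (hadj i j).differentiableAt)
      (fun i j => (hmd i j).differentiableAt), hx]
    simp only [Matrix.mul_apply, hadjd, sub_mul, Finset.sum_sub_distrib, Matrix.adjugate_one,
      Matrix.one_apply, ite_mul, zero_mul, one_mul, Finset.sum_ite_eq, Finset.mem_univ, if_true]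
    rfl
  simp only [e2, Finset.sum_add_distrib, Finset.sum_sub_distrib, ← Finset.mul_sum]
  ring

/-- Algebraic form of the second variation identity, in terms of frame coefficients. -/
lemma frame_algebra {ι : Type*} [Fintype ι] (F : ι → κ → ℝ) (F2 : ι → ι → κ → ℝ)
    (hsymm : ∀ a b k, F2 a b k = F2 b a k) (P : ι → κ → ℝ) (F3 : ι → κ → ℝ)
    (hF3 : ∀ b k, F3 b k = ∑ i, ∑ j, (∑ l, (F2 i b l * F j l + F i l * F2 j b l)) * F2 i j k) :
    ((∑ i, ∑ k, P i k * F3 i k) -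
      ∑ i, ∑ j, ∑ a, (∑ k, P i k * F2 j a k) * (∑ k, P j k * F2 i a k))
    - 1 / 2 * ((∑ a, ∑ k, 2 * (F3 a k * F a k)) + (∑ a, ∑ b, ∑ k, 2 * F2 a b k ^ 2)
      - ∑ a, ∑ b, ∑ c, (∑ k, (F2 a c k * F b k + F a k * F2 b c k)) ^ 2) =
    - ((∑ a, ∑ b, ∑ k, F2 a b k ^ 2) - ∑ a, ∑ b, ∑ c, (∑ k, F c k * F2 a b k) ^ 2)
    - ∑ i, ∑ j, ∑ a, (∑ k, (P i k - F i k) * F2 j a k) * (∑ k, (P j k - F j k) * F2 i a k) := by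
  set Γ : ι → ι → ι → ℝ := fun a b c => ∑ k, F a k * F2 b c k with hΓ
  set B : ι → ι → ι → ℝ := fun a b c => ∑ k, (P a k - F a k) * F2 b c k with hB
  have hΓs : ∀ a b c, Γ a b c = Γ a c b := fun a b c => by simp only [hΓ, hsymm b c]
  have hBs : ∀ a b c, B a b c = B a c b := fun a b c => by simp only [hB, hsymm b c]
  have hP : ∀ a b c, ∑ k, P a k * F2 b c k = Γ a b c + B a b c := by
    intro a b c
    simp only [hΓ, hB, ← Finset.sum_add_distrib]
    exact Finset.sum_congr rfl fun k _ => by ring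
  have hcoef : ∀ a b c, ∑ k, (F2 a c k * F b k + F a k * F2 b c k) = Γ b a c + Γ a b c := by
    intro a b c
    simp only [hΓ, ← Finset.sum_add_distrib]
    exact Finset.sum_congr rfl fun k _ => by ring
  have hn : (∑ i, ∑ k, P i k * F3 i k) - (∑ a, ∑ k, F3 a k * F a k) =
      ∑ b, ∑ i, ∑ j, (Γ j i b + Γ i j b) * B b i j := by
    rw [← Finset.sum_sub_distrib]
    refine Finset.sum_congr rfl fun b _ => ?_
    rw [← Finset.sum_sub_distrib]
    have : ∀ k, P b k * F3 b k - F3 b k * F b k =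
        ∑ i, ∑ j, (Γ j i b + Γ i j b) * ((P b k - F b k) * F2 i j k) := by
      intro k
      have : P b k * F3 b k - F3 b k * F b k = (P b k - F b k) * F3 b k := by ring
      rw [this, hF3, Finset.mul_sum]
      refine Finset.sum_congr rfl fun i _ => ?_
      rw [Finset.mul_sum]
      refine Finset.sum_congr rfl fun j _ => ?_
      rw [hcoef]; ring
    simp only [this]
    rw [Finset.sum_comm]
    refine Finset.sum_congr rfl fun i _ => ?_
    rw [Finset.sum_comm]
    refine Finset.sum_congr rfl fun j _ => ?_
    rw [← Finset.mul_sum]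
  simp only [hP, hcoef]
  have h2a : (∑ a, ∑ k, 2 * (F3 a k * F a k)) = 2 * ∑ a, ∑ k, F3 a k * F a k := by
    simp only [Finset.mul_sum]
  have h2b : (∑ a, ∑ b, ∑ k, 2 * F2 a b k ^ 2) = 2 * ∑ a, ∑ b, ∑ k, F2 a b k ^ 2 := by
    simp only [Finset.mul_sum]
  have r1 : ∑ b, ∑ i, ∑ j, (Γ j i b + Γ i j b) * B b i j =
      2 * ∑ i, ∑ j, ∑ a, B i j a * Γ j i a := by
    have s1 : ∀ b, ∑ i, ∑ j, Γ j i b * B b i j = ∑ i, ∑ j, Γ i j b * B b i j := by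
      intro b
      rw [Finset.sum_comm]
      exact Finset.sum_congr rfl fun i _ => Finset.sum_congr rfl fun j _ => by rw [hBs]
    have s2 : ∀ b, ∑ i, ∑ j, Γ i j b * B b i j = ∑ j, ∑ a, B b j a * Γ j b a := by
      intro b
      exact Finset.sum_congr rfl fun i _ => Finset.sum_congr rfl fun j _ => by rw [hΓs, mul_comm]
    simp only [add_mul, Finset.sum_add_distrib, s1, s2]
    ring
  have r2 : ∑ i, ∑ j, ∑ a, (Γ i j a + B i j a) * (Γ j i a + B j i a) =
      (∑ i, ∑ j, ∑ a, Γ i j a * Γ j i a) + 2 * (∑ i, ∑ j, ∑ a, B i j a * Γ j i a)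
        + ∑ i, ∑ j, ∑ a, B i j a * B j i a := by
    have s1 : ∑ i, ∑ j, ∑ a, Γ i j a * B j i a = ∑ i, ∑ j, ∑ a, B i j a * Γ j i a := by
      rw [Finset.sum_comm]
      simp only [mul_comm]
    simp only [add_mul, mul_add, Finset.sum_add_distrib, s1]
    ring
  have r3 : ∑ a, ∑ b, ∑ c, (Γ b a c + Γ a b c) ^ 2 =
      2 * (∑ a, ∑ b, ∑ c, Γ c a b ^ 2) + 2 * ∑ i, ∑ j, ∑ a, Γ i j a * Γ j i a := by
    have s1 : ∑ a, ∑ b, ∑ c, Γ b a c ^ 2 = ∑ a, ∑ b, ∑ c, Γ c a b ^ 2 :=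
      Finset.sum_congr rfl fun a _ => Finset.sum_comm
    have s2 : ∑ a, ∑ b, ∑ c, Γ a b c ^ 2 = ∑ a, ∑ b, ∑ c, Γ c a b ^ 2 := by
      rw [Finset.sum_comm, s1]
    have s3 : ∀ a b c, (Γ b a c + Γ a b c) ^ 2 =
      Γ b a c ^ 2 + Γ a b c ^ 2 + 2 * (Γ a b c * Γ b a c) := fun a b c => by ring
    simp only [s3, Finset.sum_add_distrib, s1, s2, ← Finset.mul_sum]
    ring
  rw [h2a, h2b, r2, r3]
  have hn' := hn
  rw [r1] at hn'
  linarith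

end SecondVariation

section FrameInequality

variable {ι κ : Type*} [Fintype ι] [DecidableEq ι] [Fintype κ]

lemma slope_algebraic_strict (ι : Type*) [Fintype ι] [DecidableEq ι] {B : ℝ} (hB : B < 9) :
    ∃ δ : ℝ, 0 < δ ∧ δ ≤ 1 ∧ ∀ l : ι → ℝ, ∏ i, (1 + l i ^ 2) ≤ B →
      ∀ h : ι → ι → ι → ℝ, (∀ i j k, h i j k = h i k j) →
      δ * (∑ i, ∑ j, ∑ k, h i j k ^ 2) ≤
        (∑ i, ∑ j, ∑ k, h i j k ^ 2) + (∑ i, ∑ j, ∑ k, l i * l j * h i j k * h j i k)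
        + 12 * ∑ k, (∑ i, l i * h i i k) ^ 2 := by
  have hc : ∃ r : ℝ, 1 < r ∧ (r ^ 2) ^ Fintype.card ι * B ≤ 9 := by
    have hcont : Continuous fun r : ℝ => (r ^ 2) ^ Fintype.card ι * B := by fun_prop
    have hev : ∀ᶠ r in nhds (1 : ℝ), (r ^ 2) ^ Fintype.card ι * B < 9 :=
      hcont.continuousAt.eventually (gt_mem_nhds (by simpa using hB))
    obtain ⟨r, hr, hr1⟩ := ((hev.filter_mono nhdsWithin_le_nhds).and
      (self_mem_nhdsWithin : Set.Ioi (1 : ℝ) ∈ nhdsWithin 1 (Set.Ioi 1))).exists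
    exact ⟨r, hr1, hr.le⟩
  obtain ⟨r, hr1, hr⟩ := hc
  have hr2 : 1 < r ^ 2 := by nlinarith
  refine ⟨1 - (r ^ 2)⁻¹, ?_, ?_, ?_⟩
  · have := inv_lt_one_of_one_lt₀ hr2
    linarith
  · have : 0 < (r ^ 2)⁻¹ := by positivity
    linarith
  intro l hl h hs
  have hp : ∏ i, (1 + (r * l i) ^ 2) ≤ 9 := by
    refine le_trans ?_ hr
    calc ∏ i, (1 + (r * l i) ^ 2) ≤ ∏ i, (r ^ 2 * (1 + l i ^ 2)) :=
          Finset.prod_le_prod (fun i _ => by positivity) fun i _ => by nlinarith [sq_nonneg (l i)]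
      _ = (r ^ 2) ^ Fintype.card ι * ∏ i, (1 + l i ^ 2) := by
          rw [Finset.prod_mul_distrib]; simp
      _ ≤ _ := by gcongr
  have key := slope_algebraic_inequality (fun i => r * l i) hp h hs
  have e1 : (∑ i, ∑ j, ∑ k, r * l i * (r * l j) * h i j k * h j i k) =
      r ^ 2 * ∑ i, ∑ j, ∑ k, l i * l j * h i j k * h j i k := by
    simp only [Finset.mul_sum]
    exact Finset.sum_congr rfl fun i _ => Finset.sum_congr rfl fun j _ =>
      Finset.sum_congr rfl fun k _ => by ring
  have e2 : ∑ k, (∑ i, r * l i * h i i k) ^ 2 = r ^ 2 * ∑ k, (∑ i, l i * h i i k) ^ 2 := by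
    simp only [Finset.mul_sum, mul_assoc]
    refine Finset.sum_congr rfl fun k _ => ?_
    rw [← Finset.mul_sum]; ring
  rw [e1, e2] at key
  have hri : 0 < (r ^ 2)⁻¹ := by positivity
  have := mul_nonneg hri.le key
  have h1 : (r ^ 2)⁻¹ * r ^ 2 = 1 := inv_mul_cancel₀ (by positivity)
  set H := ∑ i, ∑ j, ∑ k, h i j k ^ 2
  set S := ∑ i, ∑ j, ∑ k, l i * l j * h i j k * h j i k
  set G := ∑ k, (∑ i, l i * h i i k) ^ 2
  have e3 : (r ^ 2)⁻¹ * (H + r ^ 2 * S + 12 * (r ^ 2 * G)) =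
      (r ^ 2)⁻¹ * H + ((r ^ 2)⁻¹ * r ^ 2) * (S + 12 * G) := by ring
  rw [e3, h1] at this
  linarith

lemma bessel_orthogonal {ι : Type*} [Fintype ι] (e : ι → κ → ℝ)
    (ho : ∀ i j, i ≠ j → ∑ k, e i k * e j k = 0)
    (hn : ∀ i, ∑ k, e i k * e i k ≤ 1) (v : κ → ℝ) :
    ∑ i, (∑ k, e i k * v k) ^ 2 ≤ ∑ k, v k ^ 2 := by
  set c : ι → ℝ := fun i => ∑ k, e i k * v k with hc
  have h0 : 0 ≤ ∑ k, (v k - ∑ i, c i * e i k) ^ 2 := Finset.sum_nonneg fun k _ => sq_nonneg _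
  have h1 : ∑ k, v k * ∑ i, c i * e i k = ∑ i, c i ^ 2 := by
    simp only [Finset.mul_sum]
    rw [Finset.sum_comm]
    refine Finset.sum_congr rfl fun i _ => ?_
    rw [sq]
    nth_rewrite 3 [hc]
    simp only [Finset.mul_sum]
    exact Finset.sum_congr rfl fun k _ => by ring
  have h2 : ∑ k, (∑ i, c i * e i k) ^ 2 ≤ ∑ i, c i ^ 2 := by
    have : ∑ k, (∑ i, c i * e i k) ^ 2 = ∑ i, ∑ j, c i * c j * ∑ k, e i k * e j k := by
      simp only [sq, Finset.sum_mul_sum]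
      simp only [Finset.mul_sum]
      rw [Finset.sum_comm]
      refine Finset.sum_congr rfl fun i _ => ?_
      rw [Finset.sum_comm]
      exact Finset.sum_congr rfl fun j _ => Finset.sum_congr rfl fun k _ => by ring
    rw [this]
    refine Finset.sum_le_sum fun i _ => ?_
    rw [Finset.sum_eq_single i (fun j _ hj => by rw [ho i j hj.symm, mul_zero]) (by simp)]
    nlinarith [hn i, sq_nonneg (c i)]
  have h3 : ∑ k, (v k - ∑ i, c i * e i k) ^ 2 = ∑ k, v k ^ 2 - 2 * (∑ k, v k * ∑ i, c i * e i k)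
      + ∑ k, (∑ i, c i * e i k) ^ 2 := by
    rw [Finset.mul_sum, ← Finset.sum_sub_distrib, ← Finset.sum_add_distrib]
    exact Finset.sum_congr rfl fun k _ => by ring
  rw [h3, h1] at h0
  linarith

/-- The curvature term in the second variation identity controls the normal part of the Hessian. -/
lemma frame_curvature_bound {B δ : ℝ} (hδ1 : δ ≤ 1)
    (hδ : ∀ l : ι → ℝ, ∏ i, (1 + l i ^ 2) ≤ B →
      ∀ h : ι → ι → ι → ℝ, (∀ i j k, h i j k = h i k j) →
      δ * (∑ i, ∑ j, ∑ k, h i j k ^ 2) ≤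
        (∑ i, ∑ j, ∑ k, h i j k ^ 2) + (∑ i, ∑ j, ∑ k, l i * l j * h i j k * h j i k)
        + 12 * ∑ k, (∑ i, l i * h i i k) ^ 2)
    (F N : ι → κ → ℝ) (F2 : ι → ι → κ → ℝ) (hsymm : ∀ a b k, F2 a b k = F2 b a k)
    (l : ι → ℝ) (hl : ∏ i, (1 + l i ^ 2) ≤ B)
    (hFF : ∀ i j, ∑ k, F i k * F j k = if i = j then 1 else 0)
    (hNF : ∀ i j, ∑ k, N i k * F j k = 0)
    (hNN : ∀ i j, ∑ k, N i k * N j k = if i = j then l i ^ 2 else 0) :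
    δ * ((∑ a, ∑ b, ∑ k, F2 a b k ^ 2) - ∑ a, ∑ b, ∑ c, (∑ k, F c k * F2 a b k) ^ 2) ≤
      ((∑ a, ∑ b, ∑ k, F2 a b k ^ 2) - ∑ a, ∑ b, ∑ c, (∑ k, F c k * F2 a b k) ^ 2)
      + (∑ i, ∑ j, ∑ a, (∑ k, N i k * F2 j a k) * (∑ k, N j k * F2 i a k))
      + 12 * ∑ k, (∑ i, ∑ c, N i c * F2 i k c) ^ 2 := by
  set h : ι → ι → ι → ℝ := fun i j a => (l i)⁻¹ * ∑ k, N i k * F2 j a k with hh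
  have hb : ∀ i j a, ∑ k, N i k * F2 j a k = l i * h i j a := by
    intro i j a
    by_cases h0 : l i = 0
    · have h1 := hNN i i
      rw [if_pos rfl, h0] at h1
      have h2 : ∀ k, N i k = 0 := by
        intro k
        have := (Finset.sum_eq_zero_iff_of_nonneg (fun k _ => mul_self_nonneg (N i k))).1
          (by simpa using h1) k (Finset.mem_univ k)
        exact mul_self_eq_zero.1 this
      simp [h0, h2]
    · simp only [hh]; rw [mul_inv_cancel_left₀ h0]
  have hbes : ∑ i, ∑ j, ∑ k, h i j k ^ 2 ≤
      (∑ a, ∑ b, ∑ k, F2 a b k ^ 2) - ∑ a, ∑ b, ∑ c, (∑ k, F c k * F2 a b k) ^ 2 := by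
    have e : ∑ i, ∑ j, ∑ k, h i j k ^ 2 = ∑ a, ∑ b, ∑ i, h i a b ^ 2 := by
      exact (sum_cyclic fun a b i => h i a b ^ 2).symm
    rw [e, ← Finset.sum_sub_distrib]
    refine Finset.sum_le_sum fun a _ => ?_
    rw [← Finset.sum_sub_distrib]
    refine Finset.sum_le_sum fun b _ => ?_
    have := bessel_orthogonal (ι := ι ⊕ ι) (Sum.elim F fun i k => (l i)⁻¹ * N i k) ?_ ?_ (F2 a b)
    · rw [Fintype.sum_sum_type] at this
      simp only [Sum.elim_inl, Sum.elim_inr] at this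
      have e2 : ∀ i, ∑ k, (l i)⁻¹ * N i k * F2 a b k = h i a b := fun i => by
        simp only [hh, Finset.mul_sum, mul_assoc]
      simp only [e2] at this
      linarith
    · have e3 : ∀ i j, ∑ k, (l i)⁻¹ * N i k * F j k = 0 := fun i j => by
        simp only [mul_assoc, ← Finset.mul_sum, hNF, mul_zero]
      rintro (i | i) (j | j) hij
      · have : i ≠ j := fun h => hij (by rw [h])
        simp [hFF, this]
      · have := e3 j i
        simp only [Sum.elim_inl, Sum.elim_inr]
        rw [← this]
        exact Finset.sum_congr rfl fun k _ => by ring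
      · exact e3 i j
      · have hne : i ≠ j := fun h => hij (by rw [h])
        have h1 := hNN i j
        rw [if_neg hne] at h1
        simp only [Sum.elim_inr]
        have : ∀ k, (l i)⁻¹ * N i k * ((l j)⁻¹ * N j k) = (l i)⁻¹ * (l j)⁻¹ * (N i k * N j k) :=
          fun k => by ring
        simp only [this, ← Finset.mul_sum, h1, mul_zero]
    · rintro (i | i)
      · simp [hFF]
      · simp only [Sum.elim_inr]
        have : ∀ k, (l i)⁻¹ * N i k * ((l i)⁻¹ * N i k) = (l i)⁻¹ ^ 2 * (N i k * N i k) :=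
          fun k => by ring
        simp only [this, ← Finset.mul_sum, hNN, if_true]
        by_cases h0 : l i = 0
        · simp [h0]
        · rw [← mul_pow, inv_mul_cancel₀ h0]; norm_num
  have key := hδ l hl h fun i j k => by simp only [hh, hsymm j k]
  have e1 : (∑ i, ∑ j, ∑ a, (∑ k, N i k * F2 j a k) * (∑ k, N j k * F2 i a k)) =
      ∑ i, ∑ j, ∑ k, l i * l j * h i j k * h j i k := by
    simp only [hb]
    exact Finset.sum_congr rfl fun i _ => Finset.sum_congr rfl fun j _ =>
      Finset.sum_congr rfl fun k _ => by ring
  have e2 : ∑ k, (∑ i, ∑ c, N i c * F2 i k c) ^ 2 = ∑ k, (∑ i, l i * h i i k) ^ 2 := by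
    simp only [hb]
  rw [e1, e2]
  nlinarith

end FrameInequality

section FrameCalculus

variable {E : Type*} [NormedAddCommGroup E] [NormedSpace ℝ E]
variable {ι κ : Type*} [Fintype ι] [DecidableEq ι] [Fintype κ]

lemma frame_second_variation (F : κ → E → ℝ) (hF : ∀ k, Smooth (F k)) (s : ι → E) (P : ι → κ → ℝ)
    (x : E)
    (hFF : ∀ i j, ∑ k, dirDeriv (s i) (F k) x * dirDeriv (s j) (F k) x = if i = j then 1 else 0)
    (hPF : ∀ i j, ∑ k, P i k * dirDeriv (s j) (F k) x = if i = j then 1 else 0)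
    (hL : ∀ b k, ∑ a, dirDeriv (s a) (dirDeriv (s a) (dirDeriv (s b) (F k))) x =
      ∑ i, ∑ j, (∑ l, (dirDeriv (s i) (dirDeriv (s b) (F l)) x * dirDeriv (s j) (F l) x
        + dirDeriv (s i) (F l) x * dirDeriv (s j) (dirDeriv (s b) (F l)) x))
        * dirDeriv (s i) (dirDeriv (s j) (F k)) x)
    (M₁ M₂ : E → Matrix ι ι ℝ)
    (hM₁ : ∀ y i j, M₁ y i j = ∑ k, P i k * dirDeriv (s j) (F k) y)
    (hM₂ : ∀ y i j, M₂ y i j = ∑ k, dirDeriv (s i) (F k) y * dirDeriv (s j) (F k) y) :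
    (∑ a, (dirDeriv (s a) (dirDeriv (s a) fun y => (M₁ y).det) x
        - (dirDeriv (s a) (fun y => (M₁ y).det) x) ^ 2))
      - 1 / 2 * (∑ a, (dirDeriv (s a) (dirDeriv (s a) fun y => (M₂ y).det) x
        - (dirDeriv (s a) (fun y => (M₂ y).det) x) ^ 2)) =
      - ((∑ a, ∑ b, ∑ k, dirDeriv (s a) (dirDeriv (s b) (F k)) x ^ 2)
        - ∑ a, ∑ b, ∑ c, (∑ k, dirDeriv (s c) (F k) x
          * dirDeriv (s a) (dirDeriv (s b) (F k)) x) ^ 2)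
      - ∑ i, ∑ j, ∑ a,
        (∑ k, (P i k - dirDeriv (s i) (F k) x) * dirDeriv (s j) (dirDeriv (s a) (F k)) x)
        * (∑ k, (P j k - dirDeriv (s j) (F k) x) * dirDeriv (s i) (dirDeriv (s a) (F k)) x) ∧
    ∀ a, dirDeriv (s a) (fun y => (M₁ y).det) x
      - 1 / 2 * dirDeriv (s a) (fun y => (M₂ y).det) x =
      ∑ i, ∑ k, (P i k - dirDeriv (s i) (F k) x) * dirDeriv (s i) (dirDeriv (s a) (F k)) x := by
  have hd : ∀ a k, Smooth (dirDeriv (s a) (F k)) := fun a k => (hF k).dirDeriv _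
  have e1 : ∀ i j, (fun y => M₁ y i j) = fun y => ∑ k, P i k * dirDeriv (s j) (F k) y :=
    fun i j => funext fun y => hM₁ y i j
  have e2 : ∀ i j, (fun y => M₂ y i j) =
      fun y => ∑ k, dirDeriv (s i) (F k) y * dirDeriv (s j) (F k) y :=
    fun i j => funext fun y => hM₂ y i j
  have s1 : ∀ i j, Smooth fun y => M₁ y i j := fun i j => by
    rw [e1]; exact ContDiff.sum fun k _ => contDiff_const.mul (hd j k)
  have s2 : ∀ i j, Smooth fun y => M₂ y i j := fun i j => by
    rw [e2]; exact ContDiff.sum fun k _ => (hd i k).mul (hd j k)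
  have x1 : M₁ x = 1 := by
    ext i j; rw [hM₁, hPF, Matrix.one_apply]
  have x2 : M₂ x = 1 := by
    ext i j; rw [hM₂, hFF, Matrix.one_apply]
  have d1 : ∀ a i j, dirDeriv (s a) (fun y => M₁ y i j) =
      fun y => ∑ k, P i k * dirDeriv (s a) (dirDeriv (s j) (F k)) y := by
    intro a i j
    funext y
    rw [e1, dirDeriv_sum _ fun k _ => ((hd j k).differentiableAt).const_mul _]
    exact Finset.sum_congr rfl fun k _ => dirDeriv_const_mul _ (hd j k).differentiableAt _
  have dd1 : ∀ a i j, dirDeriv (s a) (dirDeriv (s a) (fun y => M₁ y i j)) x =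
      ∑ k, P i k * dirDeriv (s a) (dirDeriv (s a) (dirDeriv (s j) (F k))) x := by
    intro a i j
    rw [d1, dirDeriv_sum _ fun k _ => (((hd j k).dirDeriv _).differentiableAt).const_mul _]
    exact Finset.sum_congr rfl fun k _ =>
      dirDeriv_const_mul _ ((hd j k).dirDeriv _).differentiableAt _
  have d2 : ∀ a i j, dirDeriv (s a) (fun y => M₂ y i j) =
      fun y => ∑ k, (dirDeriv (s a) (dirDeriv (s i) (F k)) y * dirDeriv (s j) (F k) y
        + dirDeriv (s i) (F k) y * dirDeriv (s a) (dirDeriv (s j) (F k)) y) := by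
    intro a i j
    funext y
    rw [e2, dirDeriv_sum _ fun k _ =>
      ((hd i k).differentiableAt).fun_mul (hd j k).differentiableAt]
    exact Finset.sum_congr rfl fun k _ =>
      dirDeriv_mul _ (hd i k).differentiableAt (hd j k).differentiableAt
  have dd2 : ∀ a i, dirDeriv (s a) (dirDeriv (s a) (fun y => M₂ y i i)) x =
      ∑ k, (2 * (dirDeriv (s a) (dirDeriv (s a) (dirDeriv (s i) (F k))) x
        * dirDeriv (s i) (F k) x) + 2 * dirDeriv (s a) (dirDeriv (s i) (F k)) x ^ 2) := by
    intro a i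
    have hA : ∀ k, DifferentiableAt ℝ (fun y => dirDeriv (s a) (dirDeriv (s i) (F k)) y
        * dirDeriv (s i) (F k) y) x := fun k =>
      (((hd i k).dirDeriv _).differentiableAt).fun_mul (hd i k).differentiableAt
    have hB : ∀ k, DifferentiableAt ℝ (fun y => dirDeriv (s i) (F k) y
        * dirDeriv (s a) (dirDeriv (s i) (F k)) y) x := fun k =>
      ((hd i k).differentiableAt).fun_mul ((hd i k).dirDeriv _).differentiableAt
    rw [d2, dirDeriv_sum _ fun k _ => (hA k).fun_add (hB k)]
    refine Finset.sum_congr rfl fun k _ => ?_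
    rw [dirDeriv_add _ (hA k) (hB k),
      dirDeriv_mul _ ((hd i k).dirDeriv _).differentiableAt (hd i k).differentiableAt,
      dirDeriv_mul _ (hd i k).differentiableAt ((hd i k).dirDeriv _).differentiableAt]
    ring
  have hcm : ∀ a b k, dirDeriv (s a) (dirDeriv (s b) (F k)) x =
      dirDeriv (s b) (dirDeriv (s a) (F k)) x := fun a b k => dirDeriv_comm (hF k) _ _ _
  constructor
  · have halg := frame_algebra (fun i k => dirDeriv (s i) (F k) x)
      (fun a b k => dirDeriv (s a) (dirDeriv (s b) (F k)) x) hcm P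
      (fun b k => ∑ a, dirDeriv (s a) (dirDeriv (s a) (dirDeriv (s b) (F k))) x) hL
    rw [← halg]
    have t1 : ∀ a, dirDeriv (s a) (dirDeriv (s a) fun y => (M₁ y).det) x
        - (dirDeriv (s a) (fun y => (M₁ y).det) x) ^ 2 =
        (∑ i, ∑ k, P i k * dirDeriv (s a) (dirDeriv (s a) (dirDeriv (s i) (F k))) x)
        - ∑ i, ∑ j, (∑ k, P i k * dirDeriv (s j) (dirDeriv (s a) (F k)) x)
          * (∑ k, P j k * dirDeriv (s i) (dirDeriv (s a) (F k)) x) := by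
      intro a
      rw [dirDeriv_dirDeriv_det_at_one s1 x1, dirDeriv_det_at_one s1 x1]
      simp only [dd1]
      simp only [d1, hcm a]
      ring
    have t2 : ∀ a, dirDeriv (s a) (dirDeriv (s a) fun y => (M₂ y).det) x
        - (dirDeriv (s a) (fun y => (M₂ y).det) x) ^ 2 =
        (∑ i, ∑ k, (2 * (dirDeriv (s a) (dirDeriv (s a) (dirDeriv (s i) (F k))) x
        * dirDeriv (s i) (F k) x) + 2 * dirDeriv (s a) (dirDeriv (s i) (F k)) x ^ 2))
        - ∑ i, ∑ j, (∑ k, (dirDeriv (s i) (dirDeriv (s a) (F k)) x * dirDeriv (s j) (F k) x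
        + dirDeriv (s i) (F k) x * dirDeriv (s j) (dirDeriv (s a) (F k)) x)) ^ 2 := by
      intro a
      rw [dirDeriv_dirDeriv_det_at_one s2 x2, dirDeriv_det_at_one s2 x2]
      simp only [dd2]
      simp only [d2, hcm a]
      have : ∀ i j, (∑ k, (dirDeriv (s j) (dirDeriv (s a) (F k)) x * dirDeriv (s i) (F k) x
        + dirDeriv (s j) (F k) x * dirDeriv (s i) (dirDeriv (s a) (F k)) x)) =
        ∑ k, (dirDeriv (s i) (dirDeriv (s a) (F k)) x * dirDeriv (s j) (F k) x
        + dirDeriv (s i) (F k) x * dirDeriv (s j) (dirDeriv (s a) (F k)) x) := fun i j =>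
        Finset.sum_congr rfl fun k _ => by ring
      simp only [this, ← sq]
      ring
    simp only [t1, t2, Finset.sum_sub_distrib]
    have c1 : ∑ a, ∑ i, ∑ k, P i k * dirDeriv (s a) (dirDeriv (s a) (dirDeriv (s i) (F k))) x =
        ∑ i, ∑ k, P i k * ∑ a, dirDeriv (s a) (dirDeriv (s a) (dirDeriv (s i) (F k))) x := by
      rw [Finset.sum_comm]
      refine Finset.sum_congr rfl fun i _ => ?_
      rw [Finset.sum_comm]
      exact Finset.sum_congr rfl fun k _ => by rw [Finset.mul_sum]
    have c2 : ∑ a, ∑ i, ∑ k, (2 * (dirDeriv (s a) (dirDeriv (s a) (dirDeriv (s i) (F k))) x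
        * dirDeriv (s i) (F k) x) + 2 * dirDeriv (s a) (dirDeriv (s i) (F k)) x ^ 2) =
        (∑ a, ∑ k, 2 * ((∑ b, dirDeriv (s b) (dirDeriv (s b) (dirDeriv (s a) (F k))) x)
          * dirDeriv (s a) (F k) x))
        + ∑ a, ∑ b, ∑ k, 2 * dirDeriv (s a) (dirDeriv (s b) (F k)) x ^ 2 := by
      simp only [Finset.sum_add_distrib]
      congr 1
      rw [Finset.sum_comm]
      refine Finset.sum_congr rfl fun i _ => ?_
      rw [Finset.sum_comm]
      exact Finset.sum_congr rfl fun k _ => by rw [Finset.sum_mul, Finset.mul_sum]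
    rw [c1, c2]
    rw [← sum_cyclic fun i j a => (∑ k, P i k * dirDeriv (s j) (dirDeriv (s a) (F k)) x)
          * (∑ k, P j k * dirDeriv (s i) (dirDeriv (s a) (F k)) x),
      ← sum_cyclic fun i j a =>
        (∑ k, (dirDeriv (s i) (dirDeriv (s a) (F k)) x * dirDeriv (s j) (F k) x
        + dirDeriv (s i) (F k) x * dirDeriv (s j) (dirDeriv (s a) (F k)) x)) ^ 2]
  · intro a
    rw [dirDeriv_det_at_one s1 x1, dirDeriv_det_at_one s2 x2]
    simp only [d1, d2, hcm a]
    rw [Finset.mul_sum, ← Finset.sum_sub_distrib]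
    refine Finset.sum_congr rfl fun i _ => ?_
    rw [Finset.mul_sum, ← Finset.sum_sub_distrib]
    exact Finset.sum_congr rfl fun k _ => by ring

end FrameCalculus

section MinimalGraphs

open scoped Matrix

section LinearAlgebra

variable {ι : Type*} [Fintype ι] [DecidableEq ι]

lemma exists_orthogonal_diagonalization (A : Matrix ι ι ℝ) (hA : Aᵀ = A) :
    ∃ (U : Matrix ι ι ℝ) (d : ι → ℝ), Uᵀ * U = 1 ∧ Uᵀ * A * U = Matrix.diagonal d := by
  have hH : A.IsHermitian := by
    rw [Matrix.IsHermitian, Matrix.conjTranspose_eq_transpose_of_trivial, hA]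
  refine ⟨hH.eigenvectorUnitary, hH.eigenvalues, ?_, ?_⟩
  · have := Unitary.coe_star_mul_self hH.eigenvectorUnitary
    rwa [Matrix.star_eq_conjTranspose, Matrix.conjTranspose_eq_transpose_of_trivial] at this
  · have h1 := hH.conjStarAlgAut_star_eigenvectorUnitary
    rw [Unitary.conjStarAlgAut_apply] at h1
    simp only [Unitary.coe_star, Matrix.star_eq_conjTranspose,
      Matrix.conjTranspose_eq_transpose_of_trivial] at h1
    exact h1

lemma quadForm_conj {ι : Type*} [Fintype ι] (A U : Matrix ι ι ℝ) (v : ι → ℝ) :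
    v ⬝ᵥ ((Uᵀ * A * U) *ᵥ v) = (U *ᵥ v) ⬝ᵥ (A *ᵥ (U *ᵥ v)) := by
  rw [← Matrix.mulVec_mulVec, ← Matrix.mulVec_mulVec, Matrix.dotProduct_mulVec,
    Matrix.vecMul_transpose]

lemma quadForm_single (A : Matrix ι ι ℝ) (i : ι) :
    (Pi.single i 1 : ι → ℝ) ⬝ᵥ (A *ᵥ Pi.single i 1) = A i i := by
  simp

lemma one_add_trace_le_det (A : Matrix ι ι ℝ) (hA : Aᵀ = A) (hpos : ∀ v, 0 ≤ v ⬝ᵥ (A *ᵥ v)) :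
    1 + A.trace ≤ (1 + A).det := by
  obtain ⟨U, d, hU, hd⟩ := exists_orthogonal_diagonalization A hA
  have hU' : U * Uᵀ = 1 := mul_eq_one_comm.1 hU
  have hd0 : ∀ i, 0 ≤ d i := by
    intro i
    have := quadForm_conj A U (Pi.single i 1)
    rw [hd, quadForm_single, Matrix.diagonal_apply_eq] at this
    rw [this]
    exact hpos _
  have h1 : (1 + A).det = ∏ i, (1 + d i) := by
    have e : Uᵀ * (1 + A) * U = Matrix.diagonal fun i => 1 + d i := by
      rw [Matrix.mul_add, Matrix.add_mul, Matrix.mul_one, hU, hd, ← Matrix.diagonal_one,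
        Matrix.diagonal_add]
    have := congrArg Matrix.det e
    rw [Matrix.det_mul, Matrix.det_mul, mul_right_comm, ← Matrix.det_mul, hU, Matrix.det_one,
      one_mul, Matrix.det_diagonal] at this
    exact this
  have h2 : A.trace = ∑ i, d i := by
    have := congrArg Matrix.trace hd
    rw [Matrix.mul_assoc, Matrix.trace_mul_comm, Matrix.mul_assoc, hU', Matrix.mul_one,
      Matrix.trace_diagonal] at this
    exact this
  rw [h1, h2]
  exact one_add_sum_le_prod_one_add _ _ hd0

lemma exists_simultaneous_diagonalization (g N : Matrix ι ι ℝ) (hg : gᵀ = g)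
    (hpos : ∀ v, v ⬝ᵥ v ≤ v ⬝ᵥ (g *ᵥ v))
    (hN : ∀ v, (N *ᵥ v) ⬝ᵥ (N *ᵥ v) ≤ v ⬝ᵥ (g *ᵥ v)) :
    ∃ (S : Matrix ι ι ℝ) (d : ι → ℝ), Sᵀ * g * S = 1 ∧
      (N * S)ᵀ * (N * S) = Matrix.diagonal d ∧ (∀ i, 0 ≤ d i) ∧ ∀ i, d i ≤ 1 := by
  obtain ⟨U, e, hU, he⟩ := exists_orthogonal_diagonalization g hg
  have he1 : ∀ i, 1 ≤ e i := by
    intro i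
    have h1 := quadForm_conj g U (Pi.single i 1)
    rw [he, quadForm_single, Matrix.diagonal_apply_eq] at h1
    have h2 := quadForm_conj 1 U (Pi.single i 1)
    rw [Matrix.mul_one, hU, quadForm_single, Matrix.one_mulVec, Matrix.one_apply_eq] at h2
    exact (h2.le.trans (hpos _)).trans_eq h1.symm
  set r : Matrix ι ι ℝ := Matrix.diagonal fun i => (Real.sqrt (e i))⁻¹ with hr
  have hrT : rᵀ = r := Matrix.diagonal_transpose _
  have hQ : (U * r)ᵀ * g * (U * r) = 1 := by
    have : (U * r)ᵀ * g * (U * r) = r * (Uᵀ * g * U) * r := by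
      rw [Matrix.transpose_mul, hrT]
      simp only [Matrix.mul_assoc]
    rw [this, he, hr, Matrix.diagonal_mul_diagonal, Matrix.diagonal_mul_diagonal,
      ← Matrix.diagonal_one]
    congr 1
    funext i
    have h0 : 0 < e i := lt_of_lt_of_le one_pos (he1 i)
    have h2 := Real.mul_self_sqrt h0.le
    have h3 : Real.sqrt (e i) ≠ 0 := (Real.sqrt_pos.2 h0).ne'
    field_simp
    linarith [h2]
  set Q := U * r
  obtain ⟨W, d, hW, hd⟩ := exists_orthogonal_diagonalization ((N * Q)ᵀ * (N * Q))
    (by rw [Matrix.transpose_mul, Matrix.transpose_transpose])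
  have hS1 : (Q * W)ᵀ * g * (Q * W) = 1 := by
    have : (Q * W)ᵀ * g * (Q * W) = Wᵀ * (Qᵀ * g * Q) * W := by
      rw [Matrix.transpose_mul]; simp only [Matrix.mul_assoc]
    rw [this, hQ, Matrix.mul_one, hW]
  have hS2 : (N * (Q * W))ᵀ * (N * (Q * W)) = Matrix.diagonal d := by
    rw [← hd]
    simp only [Matrix.transpose_mul, Matrix.mul_assoc]
  have hq : ∀ i, d i = (N *ᵥ ((Q * W) *ᵥ Pi.single i 1)) ⬝ᵥ
      (N *ᵥ ((Q * W) *ᵥ Pi.single i 1)) := by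
    intro i
    have h1 := quadForm_conj 1 (N * (Q * W)) (Pi.single i 1)
    rw [Matrix.mul_one, hS2, quadForm_single, Matrix.diagonal_apply_eq, Matrix.one_mulVec] at h1
    rw [h1, Matrix.mulVec_mulVec]
  refine ⟨Q * W, d, hS1, hS2, fun i => ?_, fun i => ?_⟩
  · rw [hq]
    exact Finset.sum_nonneg fun k _ => mul_self_nonneg _
  · rw [hq]
    refine (hN _).trans ?_
    rw [← quadForm_conj, hS1, quadForm_single, Matrix.one_apply_eq]

end LinearAlgebra

section GraphGeometry

variable {n m : ℕ}

/-- The `k`-th component of the graph map. -/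
def graphComp (f : (Fin n → ℝ) → (Fin m → ℝ)) (k : Fin n ⊕ Fin m) (y : Fin n → ℝ) : ℝ :=
  graphMap f y k

/-- The `i`-th coordinate vector. -/
abbrev basisVec (i : Fin n) : Fin n → ℝ := Pi.single i 1

lemma dirDeriv_eq_sum (v : Fin n → ℝ) (φ : (Fin n → ℝ) → ℝ) (x : Fin n → ℝ) :
    dirDeriv v φ x = ∑ i, v i * dirDeriv (basisVec i) φ x := by
  have hv : v = ∑ i, v i • basisVec i := by
    funext j
    simp [Finset.sum_apply, Pi.single_apply]
  conv_lhs => rw [hv]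
  exact dirDeriv_sum_smul _ _ _ _ _

lemma smooth_coord (i : Fin n) : Smooth fun y : Fin n → ℝ => y i :=
  contDiff_apply ℝ ℝ i

lemma dirDeriv_coord (v : Fin n → ℝ) (i : Fin n) (x : Fin n → ℝ) :
    dirDeriv v (fun y : Fin n → ℝ => y i) x = v i := by
  have : HasFDerivAt (fun y : Fin n → ℝ => y i) (ContinuousLinearMap.proj (R := ℝ) i) x :=
    (ContinuousLinearMap.proj (R := ℝ) (φ := fun _ : Fin n => ℝ) i).hasFDerivAt
  rw [dirDeriv, this.fderiv]; rfl

lemma graphComp_inl (f : (Fin n → ℝ) → (Fin m → ℝ)) (i : Fin n) :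
    graphComp f (Sum.inl i) = fun y => y i := rfl

lemma graphComp_inr (f : (Fin n → ℝ) → (Fin m → ℝ)) (α : Fin m) :
    graphComp f (Sum.inr α) = fun y => f y α := rfl

lemma dirDeriv_graphComp_inl (f : (Fin n → ℝ) → (Fin m → ℝ)) (v : Fin n → ℝ) (i : Fin n) :
    dirDeriv v (graphComp f (Sum.inl i)) = fun _ => v i := by
  funext x; exact dirDeriv_coord v i x

lemma graphTangent_eq (f : (Fin n → ℝ) → (Fin m → ℝ)) (i : Fin n) (x : Fin n → ℝ)
    (k : Fin n ⊕ Fin m) : graphTangent f i x k = dirDeriv (basisVec i) (graphComp f k) x := rfl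

lemma graphMetric_eq (f : (Fin n → ℝ) → (Fin m → ℝ)) (x : Fin n → ℝ) (i j : Fin n) :
    graphMetric f x i j = ∑ k, dirDeriv (basisVec i) (graphComp f k) x
      * dirDeriv (basisVec j) (graphComp f k) x := by
  rw [Fintype.sum_sum_type]
  simp only [dirDeriv_graphComp_inl]
  simp only [graphMetric, Matrix.of_apply, Pi.single_apply, ite_mul, one_mul, zero_mul]
  rw [Finset.sum_ite_eq' Finset.univ i]
  simp only [Finset.mem_univ, if_true]
  congr 1

lemma graphMetric_transpose (f : (Fin n → ℝ) → (Fin m → ℝ)) (x : Fin n → ℝ) :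
    (graphMetric f x)ᵀ = graphMetric f x := by
  ext i j
  rw [Matrix.transpose_apply, graphMetric_eq, graphMetric_eq]
  exact Finset.sum_congr rfl fun k _ => mul_comm _ _

lemma quadForm_graphMetric (f : (Fin n → ℝ) → (Fin m → ℝ)) (x v w : Fin n → ℝ) :
    v ⬝ᵥ (graphMetric f x *ᵥ w) = ∑ k, dirDeriv v (graphComp f k) x
      * dirDeriv w (graphComp f k) x := by
  have h1 : ∀ k, dirDeriv v (graphComp f k) x * dirDeriv w (graphComp f k) x =
      ∑ i, ∑ j, v i * (dirDeriv (basisVec i) (graphComp f k) x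
        * dirDeriv (basisVec j) (graphComp f k) x) * w j := by
    intro k
    rw [dirDeriv_eq_sum v, dirDeriv_eq_sum w, Finset.sum_mul_sum]
    exact Finset.sum_congr rfl fun i _ => Finset.sum_congr rfl fun j _ => by ring
  simp only [h1]
  rw [Finset.sum_comm]
  simp only [dotProduct, Matrix.mulVec, graphMetric_eq]
  refine Finset.sum_congr rfl fun i _ => ?_
  rw [Finset.sum_comm, Finset.mul_sum]
  refine Finset.sum_congr rfl fun j _ => ?_
  rw [Finset.sum_mul, Finset.mul_sum]
  exact Finset.sum_congr rfl fun k _ => by ring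

lemma le_quadForm_graphMetric (f : (Fin n → ℝ) → (Fin m → ℝ)) (x v : Fin n → ℝ) :
    v ⬝ᵥ v ≤ v ⬝ᵥ (graphMetric f x *ᵥ v) := by
  rw [quadForm_graphMetric, Fintype.sum_sum_type]
  simp only [dirDeriv_graphComp_inl]
  have : 0 ≤ ∑ α, dirDeriv v (graphComp f (Sum.inr α)) x * dirDeriv v (graphComp f (Sum.inr α)) x :=
    Finset.sum_nonneg fun _ _ => mul_self_nonneg _
  simp only [dotProduct]
  linarith

lemma one_add_sum_sq_le_det (f : (Fin n → ℝ) → (Fin m → ℝ)) (x : Fin n → ℝ) :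
    1 + ∑ i, ∑ α, dirDeriv (basisVec i) (graphComp f (Sum.inr α)) x ^ 2 ≤
      (graphMetric f x).det := by
  have h := one_add_trace_le_det (graphMetric f x - 1)
    (by rw [Matrix.transpose_sub, graphMetric_transpose, Matrix.transpose_one])
    (fun v => by
      rw [Matrix.sub_mulVec, dotProduct_sub, Matrix.one_mulVec]
      linarith [le_quadForm_graphMetric f x v])
  rw [add_sub_cancel] at h
  refine le_trans (le_of_eq ?_) h
  congr 1
  simp only [Matrix.trace, Matrix.diag_apply, Matrix.sub_apply, Matrix.one_apply_eq]
  refine Finset.sum_congr rfl fun i _ => ?_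
  rw [graphMetric_eq, Fintype.sum_sum_type]
  simp only [dirDeriv_graphComp_inl]
  simp [Pi.single_apply, sq]

lemma one_le_det (f : (Fin n → ℝ) → (Fin m → ℝ)) (x : Fin n → ℝ) :
    1 ≤ (graphMetric f x).det := by
  refine le_trans ?_ (one_add_sum_sq_le_det f x)
  have : 0 ≤ ∑ i, ∑ α, dirDeriv (basisVec i) (graphComp f (Sum.inr α)) x ^ 2 :=
    Finset.sum_nonneg fun _ _ => Finset.sum_nonneg fun _ _ => sq_nonneg _
  linarith

lemma det_ne_zero (f : (Fin n → ℝ) → (Fin m → ℝ)) (x : Fin n → ℝ) :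
    (graphMetric f x).det ≠ 0 := (lt_of_lt_of_le one_pos (one_le_det f x)).ne'

lemma isUnit_det_graphMetric (f : (Fin n → ℝ) → (Fin m → ℝ)) (x : Fin n → ℝ) :
    IsUnit (graphMetric f x).det := isUnit_iff_ne_zero.2 (det_ne_zero f x)

lemma slopeFunction_sq (f : (Fin n → ℝ) → (Fin m → ℝ)) (x : Fin n → ℝ) :
    slopeFunction f x ^ 2 = (graphMetric f x).det :=
  Real.sq_sqrt (zero_le_one.trans (one_le_det f x))

lemma one_le_slopeFunction (f : (Fin n → ℝ) → (Fin m → ℝ)) (x : Fin n → ℝ) :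
    1 ≤ slopeFunction f x := Real.one_le_sqrt.2 (one_le_det f x)

lemma sum_sq_le_of_slope {f : (Fin n → ℝ) → (Fin m → ℝ)} {β : ℝ} {x : Fin n → ℝ}
    (h : slopeFunction f x ≤ β) :
    ∑ i, ∑ α, dirDeriv (basisVec i) (graphComp f (Sum.inr α)) x ^ 2 ≤ β ^ 2 := by
  have h1 := one_add_sum_sq_le_det f x
  rw [← slopeFunction_sq] at h1
  nlinarith [one_le_slopeFunction f x]

lemma inverse_transpose (f : (Fin n → ℝ) → (Fin m → ℝ)) (x : Fin n → ℝ) (i j : Fin n) :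
    (graphMetric f x)⁻¹ i j = (graphMetric f x)⁻¹ j i := by
  have : ((graphMetric f x)⁻¹)ᵀ = (graphMetric f x)⁻¹ := by
    rw [Matrix.transpose_nonsing_inv, graphMetric_transpose]
  exact (congrFun (congrFun this i) j).symm

lemma sum_inverse_mul_metric (f : (Fin n → ℝ) → (Fin m → ℝ)) (x : Fin n → ℝ) (i k : Fin n) :
    ∑ j, (graphMetric f x)⁻¹ i j * graphMetric f x j k = if i = k then 1 else 0 := by
  rw [← Matrix.mul_apply, Matrix.nonsing_inv_mul _ (isUnit_det_graphMetric f x), Matrix.one_apply]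

lemma smooth_graphComp {f : (Fin n → ℝ) → (Fin m → ℝ)} (hf : ContDiff ℝ (⊤ : ℕ∞) f)
    (k : Fin n ⊕ Fin m) : Smooth (graphComp f k) := by
  rcases k with i | α
  · exact smooth_coord i
  · exact contDiff_pi.1 hf α

lemma smooth_graphMetric {f : (Fin n → ℝ) → (Fin m → ℝ)} (hf : ContDiff ℝ (⊤ : ℕ∞) f)
    (i j : Fin n) : Smooth fun y => graphMetric f y i j := by
  simp only [graphMetric_eq]
  exact ContDiff.sum fun k _ =>
    ((smooth_graphComp hf k).dirDeriv _).mul ((smooth_graphComp hf k).dirDeriv _)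

lemma smooth_inverse {f : (Fin n → ℝ) → (Fin m → ℝ)} (hf : ContDiff ℝ (⊤ : ℕ∞) f)
    (i j : Fin n) : Smooth fun y => (graphMetric f y)⁻¹ i j :=
  smooth_inv (smooth_graphMetric hf) (det_ne_zero f) i j

lemma smooth_slope {f : (Fin n → ℝ) → (Fin m → ℝ)} (hf : ContDiff ℝ (⊤ : ℕ∞) f) :
    Smooth (slopeFunction f) :=
  (smooth_det (smooth_graphMetric hf)).sqrt (det_ne_zero f)

/-- The trace of the Hessian with respect to the graph metric. -/
def metricLaplacian (f : (Fin n → ℝ) → (Fin m → ℝ)) (φ : (Fin n → ℝ) → ℝ) (x : Fin n → ℝ) : ℝ :=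
  ∑ i, ∑ j, (graphMetric f x)⁻¹ i j * dirDeriv (basisVec i) (dirDeriv (basisVec j) φ) x

/-- The nonparametric minimal surface system. -/
def MinimalSystem (f : (Fin n → ℝ) → (Fin m → ℝ)) : Prop :=
  ∀ α x, metricLaplacian f (fun y => f y α) x = 0

lemma metricLaplacian_coord (f : (Fin n → ℝ) → (Fin m → ℝ)) (i : Fin n) (x : Fin n → ℝ) :
    metricLaplacian f (graphComp f (Sum.inl i)) x = 0 := by
  simp only [metricLaplacian, dirDeriv_graphComp_inl]
  simp

lemma MinimalSystem.graphComp {f : (Fin n → ℝ) → (Fin m → ℝ)} (h : MinimalSystem f)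
    (k : Fin n ⊕ Fin m) (x : Fin n → ℝ) : metricLaplacian f (graphComp f k) x = 0 := by
  rcases k with i | α
  · exact metricLaplacian_coord f i x
  · exact h α x

end GraphGeometry

section GraphFrames

variable {n m : ℕ}

/-- The Jacobian matrix of the graph map. -/
def graphJacobian (f : (Fin n → ℝ) → (Fin m → ℝ)) (x : Fin n → ℝ) :
    Matrix (Fin n ⊕ Fin m) (Fin n) ℝ :=
  Matrix.of fun k j => dirDeriv (basisVec j) (graphComp f k) x

/-- The Hessian matrix of a function. -/
def hessian (φ : (Fin n → ℝ) → ℝ) (x : Fin n → ℝ) : Matrix (Fin n) (Fin n) ℝ :=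
  Matrix.of fun i j => dirDeriv (basisVec i) (dirDeriv (basisVec j) φ) x

lemma graphJacobian_mul_apply (f : (Fin n → ℝ) → (Fin m → ℝ)) (x : Fin n → ℝ)
    (S : Matrix (Fin n) (Fin n) ℝ) (k : Fin n ⊕ Fin m) (a : Fin n) :
    (graphJacobian f x * S) k a = dirDeriv (S.col a) (graphComp f k) x := by
  rw [dirDeriv_eq_sum, Matrix.mul_apply]
  exact Finset.sum_congr rfl fun j _ => mul_comm _ _

lemma graphMetric_eq_jacobian (f : (Fin n → ℝ) → (Fin m → ℝ)) (x : Fin n → ℝ) :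
    graphMetric f x = (graphJacobian f x)ᵀ * graphJacobian f x := by
  ext i j
  rw [graphMetric_eq, Matrix.mul_apply]
  rfl

lemma dirDeriv_dirDeriv_eq_hessian {φ : (Fin n → ℝ) → ℝ} (hφ : Smooth φ) (v w x : Fin n → ℝ) :
    dirDeriv v (dirDeriv w φ) x = ∑ i, ∑ j, v i * w j * hessian φ x i j := by
  have h1 : dirDeriv w φ = fun y => ∑ j, w j * dirDeriv (basisVec j) φ y := by
    funext y; exact dirDeriv_eq_sum w φ y
  rw [dirDeriv_eq_sum v]
  refine Finset.sum_congr rfl fun i _ => ?_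
  rw [h1, dirDeriv_sum _ fun j _ => (contDiff_const.mul (hφ.dirDeriv _)).differentiable
    (by simp) x, Finset.mul_sum]
  refine Finset.sum_congr rfl fun j _ => ?_
  rw [dirDeriv_const_mul _ (hφ.dirDeriv _).differentiableAt, mul_assoc]
  rfl

lemma conj_hessian_apply {φ : (Fin n → ℝ) → ℝ} (hφ : Smooth φ) (x : Fin n → ℝ)
    (S : Matrix (Fin n) (Fin n) ℝ) (a b : Fin n) :
    (Sᵀ * hessian φ x * S) a b = dirDeriv (S.col a) (dirDeriv (S.col b) φ) x := by
  rw [dirDeriv_dirDeriv_eq_hessian hφ, Matrix.mul_apply]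
  simp only [Matrix.mul_apply, Finset.sum_mul, Matrix.transpose_apply, Matrix.col_apply]
  rw [Finset.sum_comm]
  exact Finset.sum_congr rfl fun i _ => Finset.sum_congr rfl fun j _ => by ring

lemma sum_conj_mul {ι : Type*} [Fintype ι] (S A H : Matrix ι ι ℝ) :
    ∑ i, ∑ j, (S * A * Sᵀ) i j * H i j = ∑ a, ∑ b, A a b * (Sᵀ * H * S) a b := by
  have h : ∀ X Y : Matrix ι ι ℝ, ∑ i, ∑ j, X i j * Y i j = (X * Yᵀ).trace := by
    intro X Y
    simp [Matrix.trace, Matrix.mul_apply]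
  rw [h, h, Matrix.transpose_mul, Matrix.transpose_mul, Matrix.transpose_transpose,
    Matrix.mul_assoc S A, Matrix.mul_assoc S, Matrix.trace_mul_comm]
  simp only [Matrix.mul_assoc]

lemma inverse_eq_mul_transpose {ι : Type*} [Fintype ι] [DecidableEq ι] {S g : Matrix ι ι ℝ}
    (h : Sᵀ * g * S = 1) : g⁻¹ = S * Sᵀ := by
  apply Matrix.inv_eq_right_inv
  rw [← Matrix.mul_assoc]
  exact mul_eq_one_comm.1 ((Matrix.mul_assoc _ _ _).symm.trans h)

lemma metricLaplacian_eq_sum {f : (Fin n → ℝ) → (Fin m → ℝ)} {S : Matrix (Fin n) (Fin n) ℝ}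
    {x : Fin n → ℝ} (hS : Sᵀ * graphMetric f x * S = 1) {φ : (Fin n → ℝ) → ℝ} (hφ : Smooth φ) :
    metricLaplacian f φ x = ∑ a, dirDeriv (S.col a) (dirDeriv (S.col a) φ) x := by
  have h := sum_conj_mul S 1 (hessian φ x)
  rw [Matrix.mul_one, ← inverse_eq_mul_transpose hS] at h
  refine h.trans ?_
  simp [Matrix.one_apply, conj_hessian_apply hφ]

lemma conj_graphMetric_apply (f : (Fin n → ℝ) → (Fin m → ℝ)) (x : Fin n → ℝ)
    (S : Matrix (Fin n) (Fin n) ℝ) (a b : Fin n) :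
    (Sᵀ * graphMetric f x * S) a b = ∑ k, dirDeriv (S.col a) (graphComp f k) x
      * dirDeriv (S.col b) (graphComp f k) x := by
  rw [graphMetric_eq_jacobian, ← Matrix.mul_assoc, ← Matrix.transpose_mul, Matrix.mul_assoc,
    Matrix.mul_apply]
  simp only [Matrix.transpose_apply, graphJacobian_mul_apply]

lemma laplacian_dirDeriv_graphComp {f : (Fin n → ℝ) → (Fin m → ℝ)} (hf : ContDiff ℝ (⊤ : ℕ∞) f)
    (hmin : MinimalSystem f) {S : Matrix (Fin n) (Fin n) ℝ}
    {x : Fin n → ℝ} (hS : Sᵀ * graphMetric f x * S = 1) (v : Fin n → ℝ) (k : Fin n ⊕ Fin m) :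
    ∑ a, dirDeriv (S.col a) (dirDeriv (S.col a) (dirDeriv v (graphComp f k))) x =
      ∑ i, ∑ j, (∑ l, (dirDeriv (S.col i) (dirDeriv v (graphComp f l)) x
          * dirDeriv (S.col j) (graphComp f l) x
        + dirDeriv (S.col i) (graphComp f l) x
          * dirDeriv (S.col j) (dirDeriv v (graphComp f l)) x))
        * dirDeriv (S.col i) (dirDeriv (S.col j) (graphComp f k)) x := by
  have hF := fun l => smooth_graphComp hf l
  have hsg := smooth_graphMetric hf
  have hsq := smooth_inverse hf
  have hzero : dirDeriv v (fun y => ∑ i, ∑ j, (graphMetric f y)⁻¹ i j *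
      dirDeriv (basisVec i) (dirDeriv (basisVec j) (graphComp f k)) y) x = 0 := by
    have : (fun y => ∑ i, ∑ j, (graphMetric f y)⁻¹ i j *
      dirDeriv (basisVec i) (dirDeriv (basisVec j) (graphComp f k)) y) = fun _ => 0 := by
      funext y; exact hmin.graphComp k y
    rw [this, dirDeriv_const]
  have hexp : dirDeriv v (fun y => ∑ i, ∑ j, (graphMetric f y)⁻¹ i j *
      dirDeriv (basisVec i) (dirDeriv (basisVec j) (graphComp f k)) y) x =
      (∑ i, ∑ j, matDeriv v (fun y => (graphMetric f y)⁻¹) x i j * hessian (graphComp f k) x i j)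
      + metricLaplacian f (dirDeriv v (graphComp f k)) x := by
    rw [metricLaplacian, dirDeriv_sum _ fun i _ => ContDiff.differentiable (n := (⊤ : ℕ∞))
      (ContDiff.sum fun j _ => (hsq i j).mul (((hF k).dirDeriv _).dirDeriv _)) (by simp) x,
      ← Finset.sum_add_distrib]
    refine Finset.sum_congr rfl fun i _ => ?_
    rw [dirDeriv_sum _ fun j _ => ContDiff.differentiable (n := (⊤ : ℕ∞))
      ((hsq i j).mul (((hF k).dirDeriv _).dirDeriv _)) (by simp) x, ← Finset.sum_add_distrib]
    refine Finset.sum_congr rfl fun j _ => ?_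
    rw [dirDeriv_mul _ (hsq i j).differentiableAt
      (((hF k).dirDeriv _).dirDeriv _).differentiableAt]
    have h1 : dirDeriv v (dirDeriv (basisVec i) (dirDeriv (basisVec j) (graphComp f k))) x =
        dirDeriv (basisVec i) (dirDeriv (basisVec j) (dirDeriv v (graphComp f k))) x := by
      rw [dirDeriv_comm ((hF k).dirDeriv _)]
      congr 1
      funext y
      exact dirDeriv_comm (hF k) _ _ y
    rw [h1]
    rfl
  rw [hexp, matDeriv_inv hsg (det_ne_zero f), inverse_eq_mul_transpose hS,
    show -(S * Sᵀ * matDeriv v (graphMetric f) x * (S * Sᵀ)) =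
      S * (-(Sᵀ * matDeriv v (graphMetric f) x * S)) * Sᵀ by
        simp only [Matrix.mul_assoc, Matrix.mul_neg, Matrix.neg_mul],
    sum_conj_mul, metricLaplacian_eq_sum hS ((hF k).dirDeriv v)] at hzero
  rw [← neg_eq_iff_add_eq_zero] at hzero
  rw [← hzero]
  simp only [Matrix.neg_apply, neg_mul, Finset.sum_neg_distrib, neg_neg]
  refine Finset.sum_congr rfl fun a _ => Finset.sum_congr rfl fun b _ => ?_
  rw [conj_hessian_apply (hF k)]
  congr 1
  have h2 : (Sᵀ * matDeriv v (graphMetric f) x * S) a b =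
      dirDeriv v (fun y => (Sᵀ * graphMetric f y * S) a b) x := by
    have h3 : ∀ A : Matrix (Fin n) (Fin n) ℝ, (Sᵀ * A * S) a b =
        ∑ i, ∑ j, (S i a * S j b) * A i j := by
      intro A
      rw [Matrix.mul_apply]
      simp only [Matrix.mul_apply, Finset.sum_mul, Matrix.transpose_apply]
      rw [Finset.sum_comm]
      exact Finset.sum_congr rfl fun i _ => Finset.sum_congr rfl fun j _ => by ring
    simp only [h3]
    rw [dirDeriv_sum _ fun i _ => ContDiff.differentiable (n := (⊤ : ℕ∞))
      (ContDiff.sum fun j _ => contDiff_const.mul (hsg i j)) (by simp) x]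
    refine Finset.sum_congr rfl fun i _ => ?_
    rw [dirDeriv_sum _ fun j _ => ContDiff.differentiable (n := (⊤ : ℕ∞))
      (contDiff_const.mul (hsg i j)) (by simp) x]
    refine Finset.sum_congr rfl fun j _ => ?_
    rw [dirDeriv_const_mul _ (hsg i j).differentiableAt]
    rfl
  rw [h2]
  simp only [conj_graphMetric_apply]
  rw [dirDeriv_sum _ fun l _ => ContDiff.differentiable (n := (⊤ : ℕ∞))
    (((hF l).dirDeriv _).mul ((hF l).dirDeriv _)) (by simp) x]
  refine Finset.sum_congr rfl fun l _ => ?_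
  rw [dirDeriv_mul _ ((hF l).dirDeriv _).differentiableAt ((hF l).dirDeriv _).differentiableAt,
    dirDeriv_comm (hF l) v, dirDeriv_comm (hF l) v]

end GraphFrames

section LogEstimate

variable {n m : ℕ}

/-- The coordinate projection with the `i₀`-th row rotated by `(a, b)` towards the `α₀`-th
vertical direction. -/
def rotatedRows (i₀ : Fin n) (α₀ : Fin m) (a b : ℝ) : Matrix (Fin n) (Fin n ⊕ Fin m) ℝ :=
  Matrix.of fun i k => if i = i₀ then a * Pi.single (M := fun _ => ℝ) (Sum.inl i₀) 1 k
    + b * Pi.single (M := fun _ => ℝ) (Sum.inr α₀) 1 k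
    else Pi.single (M := fun _ => ℝ) (Sum.inl i) 1 k

lemma rotatedRows_mul_transpose (i₀ : Fin n) (α₀ : Fin m) {a b : ℝ} (hab : a ^ 2 + b ^ 2 = 1) :
    rotatedRows i₀ α₀ a b * (rotatedRows i₀ α₀ a b)ᵀ = 1 := by
  ext i j
  rw [Matrix.mul_apply, Fintype.sum_sum_type]
  simp only [rotatedRows, Matrix.transpose_apply, Matrix.of_apply, Matrix.one_apply]
  by_cases hi : i = i₀ <;> by_cases hj : j = i₀
  · subst hi; subst hj
    simp [Pi.single_apply]
    linear_combination hab
  · subst hi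
    simp [Pi.single_apply, hj, Ne.symm hj]
  · subst hj
    simp [Pi.single_apply, hi, Ne.symm hi]
  · simp [Pi.single_apply, hi, hj, eq_comm]

lemma det_rotatedRows_mul_jacobian (f : (Fin n → ℝ) → (Fin m → ℝ)) (i₀ : Fin n) (α₀ : Fin m)
    (a b : ℝ) (y : Fin n → ℝ) :
    (rotatedRows i₀ α₀ a b * graphJacobian f y).det =
      a + b * dirDeriv (basisVec i₀) (graphComp f (Sum.inr α₀)) y := by
  have h : rotatedRows i₀ α₀ a b * graphJacobian f y =
      (1 : Matrix (Fin n) (Fin n) ℝ).updateRow i₀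
        (fun j => (rotatedRows i₀ α₀ a b * graphJacobian f y) i₀ j) := by
    ext i j
    by_cases hi : i = i₀
    · subst hi; simp
    · rw [Matrix.updateRow_ne hi, Matrix.mul_apply, Fintype.sum_sum_type]
      simp only [rotatedRows, Matrix.of_apply, graphJacobian, dirDeriv_graphComp_inl]
      simp [hi, Pi.single_apply, Matrix.one_apply, eq_comm]
  rw [h, ← Matrix.cramer_transpose_apply, Matrix.transpose_one, Matrix.cramer_one]
  simp only [Module.End.one_apply]
  rw [Matrix.mul_apply, Fintype.sum_sum_type]
  simp only [rotatedRows, Matrix.of_apply, graphJacobian, dirDeriv_graphComp_inl]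
  simp [Pi.single_apply]

lemma dotProduct_mulVec_self_le {ι κ : Type*} [Fintype ι] [Fintype κ] [DecidableEq ι]
    {P : Matrix ι κ ℝ} (hP : P * Pᵀ = 1) (w : κ → ℝ) :
    (P *ᵥ w) ⬝ᵥ (P *ᵥ w) ≤ w ⬝ᵥ w := by
  have h0 : 0 ≤ (w - Pᵀ *ᵥ (P *ᵥ w)) ⬝ᵥ (w - Pᵀ *ᵥ (P *ᵥ w)) :=
    Finset.sum_nonneg fun _ _ => mul_self_nonneg _
  have h1 : w ⬝ᵥ (Pᵀ *ᵥ (P *ᵥ w)) = (P *ᵥ w) ⬝ᵥ (P *ᵥ w) := by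
    rw [Matrix.dotProduct_mulVec, Matrix.vecMul_transpose]
  have h2 : (Pᵀ *ᵥ (P *ᵥ w)) ⬝ᵥ (Pᵀ *ᵥ (P *ᵥ w)) = (P *ᵥ w) ⬝ᵥ (P *ᵥ w) := by
    rw [Matrix.dotProduct_mulVec, Matrix.vecMul_transpose, Matrix.mulVec_mulVec, hP,
      Matrix.one_mulVec]
  rw [sub_dotProduct, dotProduct_sub, dotProduct_sub, h2, dotProduct_comm (Pᵀ *ᵥ (P *ᵥ w)) w, h1]
    at h0
  linarith

lemma log_estimate {f : (Fin n → ℝ) → (Fin m → ℝ)} (hf : ContDiff ℝ (⊤ : ℕ∞) f)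
    (hmin : MinimalSystem f) (i₀ : Fin n) (α₀ : Fin m) {a b : ℝ} (hab : a ^ 2 + b ^ 2 = 1)
    {B δ : ℝ} (hδ1 : δ ≤ 1)
    (hδ : ∀ l : Fin n → ℝ, ∏ i, (1 + l i ^ 2) ≤ B →
      ∀ h : Fin n → Fin n → Fin n → ℝ, (∀ i j k, h i j k = h i k j) →
      δ * (∑ i, ∑ j, ∑ k, h i j k ^ 2) ≤
        (∑ i, ∑ j, ∑ k, h i j k ^ 2) + (∑ i, ∑ j, ∑ k, l i * l j * h i j k * h j i k)
        + 12 * ∑ k, (∑ i, l i * h i i k) ^ 2)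
    (x : Fin n → ℝ) {G D : (Fin n → ℝ) → ℝ}
    (hGdef : ∀ y, G y = a + b * dirDeriv (basisVec i₀) (graphComp f (Sum.inr α₀)) y)
    (hDdef : ∀ y, D y = (graphMetric f y).det)
    (hG : G x ≠ 0) (hB : D x ≤ B * G x ^ 2) :
    ∃ S : Matrix (Fin n) (Fin n) ℝ, Sᵀ * graphMetric f x * S = 1 ∧
      δ * ((∑ a, ∑ b, ∑ k, dirDeriv (S.col a) (dirDeriv (S.col b) (graphComp f k)) x ^ 2)
        - ∑ a, ∑ b, ∑ c, (∑ k, dirDeriv (S.col c) (graphComp f k) x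
          * dirDeriv (S.col a) (dirDeriv (S.col b) (graphComp f k)) x) ^ 2) ≤
      - (∑ a, (dirDeriv (S.col a) (dirDeriv (S.col a) G) x / G x
          - (dirDeriv (S.col a) G x / G x) ^ 2))
        + 1 / 2 * (∑ a, (dirDeriv (S.col a) (dirDeriv (S.col a) D) x / D x
          - (dirDeriv (S.col a) D x / D x) ^ 2))
        + 12 * ∑ a, (dirDeriv (S.col a) G x / G x
          - 1 / 2 * (dirDeriv (S.col a) D x / D x)) ^ 2 := by
  classical
  have hF := fun l => smooth_graphComp hf l
  set Pm := rotatedRows i₀ α₀ a b with hPm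
  have hPmT := rotatedRows_mul_transpose i₀ α₀ hab
  rw [← hPm] at hPmT
  have hdetN : ∀ y, (Pm * graphJacobian f y).det = G y := fun y => by
    rw [hGdef, det_rotatedRows_mul_jacobian]
  have hDx : D x ≠ 0 := by rw [hDdef]; exact det_ne_zero f x
  have hDpos : 0 < D x := by rw [hDdef]; exact lt_of_lt_of_le one_pos (one_le_det f x)
  obtain ⟨S, d, hS, hNS, hd0, hd1⟩ := exists_simultaneous_diagonalization (graphMetric f x)
    (Pm * graphJacobian f x) (graphMetric_transpose f x) (le_quadForm_graphMetric f x)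
    (fun v => by
      rw [← Matrix.mulVec_mulVec]
      refine (dotProduct_mulVec_self_le hPmT _).trans_eq ?_
      rw [graphMetric_eq_jacobian, ← Matrix.mulVec_mulVec, Matrix.dotProduct_mulVec,
        Matrix.dotProduct_mulVec, Matrix.vecMul_transpose, Matrix.dotProduct_mulVec])
  have hdetS : S.det ^ 2 * D x = 1 := by
    have := congrArg Matrix.det hS
    rw [Matrix.det_mul, Matrix.det_mul, Matrix.det_transpose, Matrix.det_one, ← hDdef] at this
    linarith
  have hS0 : S.det ≠ 0 := fun h => by rw [h] at hdetS; simp at hdetS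
  set N := Pm * graphJacobian f x * S with hN
  have hdN : N.det = G x * S.det := by rw [hN, Matrix.det_mul, hdetN]
  have hN0 : N.det ≠ 0 := by rw [hdN]; exact mul_ne_zero hG hS0
  have hprod : ∏ i, d i = G x ^ 2 * S.det ^ 2 := by
    have := congrArg Matrix.det hNS
    rw [Matrix.det_mul, Matrix.det_transpose, Matrix.det_diagonal, hdN] at this
    rw [← this]; ring
  have hdpos : ∀ i, 0 < d i := by
    intro i
    refine lt_of_le_of_ne (hd0 i) fun h => ?_
    have : ∏ i, d i = 0 := Finset.prod_eq_zero (Finset.mem_univ i) h.symm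
    rw [hprod] at this
    exact mul_ne_zero (pow_ne_zero 2 hG) (pow_ne_zero 2 hS0) this
  set P : Matrix (Fin n) (Fin n ⊕ Fin m) ℝ := N⁻¹ * Pm with hP
  have hPJS : P * (graphJacobian f x * S) = 1 := by
    rw [hP, Matrix.mul_assoc, ← Matrix.mul_assoc Pm, ← hN]
    exact Matrix.nonsing_inv_mul _ (isUnit_iff_ne_zero.2 hN0)
  have hPP : P * Pᵀ = Matrix.diagonal fun i => (d i)⁻¹ := by
    have h1 : P * Pᵀ = N⁻¹ * N⁻¹ᵀ := by
      rw [hP, Matrix.transpose_mul, Matrix.mul_assoc, ← Matrix.mul_assoc Pm, hPmT, Matrix.one_mul]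
    have h2 : N⁻¹ * N⁻¹ᵀ = (Nᵀ * N)⁻¹ := by
      rw [Matrix.mul_inv_rev Nᵀ N, Matrix.transpose_nonsing_inv]
    rw [h1, h2, hNS]
    apply Matrix.inv_eq_right_inv
    rw [Matrix.diagonal_mul_diagonal, ← Matrix.diagonal_one]
    congr 1
    funext i
    exact mul_inv_cancel₀ (hdpos i).ne'
  have hJSJS : (graphJacobian f x * S)ᵀ * (graphJacobian f x * S) = 1 := by
    rw [Matrix.transpose_mul, Matrix.mul_assoc, ← Matrix.mul_assoc _ _ S,
      ← graphMetric_eq_jacobian, ← Matrix.mul_assoc]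
    exact hS
  have hFF : ∀ i j, ∑ k, dirDeriv (S.col i) (graphComp f k) x
      * dirDeriv (S.col j) (graphComp f k) x = if i = j then 1 else 0 := by
    intro i j
    rw [← conj_graphMetric_apply, hS, Matrix.one_apply]
  have hPF : ∀ i j, ∑ k, P i k * dirDeriv (S.col j) (graphComp f k) x = if i = j then 1 else 0 := by
    intro i j
    have := congrFun (congrFun hPJS i) j
    rw [Matrix.mul_apply, Matrix.one_apply] at this
    simpa only [graphJacobian_mul_apply] using this
  have hPPs : ∀ i j, ∑ k, P i k * P j k = if i = j then (d i)⁻¹ else 0 := by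
    intro i j
    have := congrFun (congrFun hPP i) j
    rw [Matrix.mul_apply, Matrix.diagonal_apply] at this
    simpa only [Matrix.transpose_apply] using this
  obtain ⟨hsv, hfv⟩ := frame_second_variation (graphComp f) hF (fun a => S.col a) P x hFF hPF
    (fun v k => laplacian_dirDeriv_graphComp hf hmin hS _ k)
    (fun y => P * (graphJacobian f y * S)) (fun y => Sᵀ * graphMetric f y * S)
    (fun y i j => by simp only [Matrix.mul_apply (M := P), graphJacobian_mul_apply])
    (fun y i j => conj_graphMetric_apply f y S i j)
  have hNF : ∀ i j, ∑ k, (P i k - dirDeriv (S.col i) (graphComp f k) x)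
      * dirDeriv (S.col j) (graphComp f k) x = 0 := by
    intro i j
    simp only [sub_mul, Finset.sum_sub_distrib, hFF, hPF, sub_self]
  have hNN : ∀ i j, ∑ k, (P i k - dirDeriv (S.col i) (graphComp f k) x)
      * (P j k - dirDeriv (S.col j) (graphComp f k) x) =
      if i = j then Real.sqrt ((d i)⁻¹ - 1) ^ 2 else 0 := by
    intro i j
    have h1 : ∀ k, (P i k - dirDeriv (S.col i) (graphComp f k) x)
      * (P j k - dirDeriv (S.col j) (graphComp f k) x) = P i k * P j k
        - P j k * dirDeriv (S.col i) (graphComp f k) x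
        - (P i k - dirDeriv (S.col i) (graphComp f k) x)
      * dirDeriv (S.col j) (graphComp f k) x := fun k => by ring
    simp only [h1, Finset.sum_sub_distrib, hNF]
    rw [hPPs, hPF, Real.sq_sqrt (sub_nonneg.2 ((one_le_inv₀ (hdpos i)).2 (hd1 i)))]
    by_cases hij : i = j
    · simp [hij]
    · simp [hij, Ne.symm hij]
  have hl : ∏ i, (1 + Real.sqrt ((d i)⁻¹ - 1) ^ 2) ≤ B := by
    have h1 : ∀ i, 1 + Real.sqrt ((d i)⁻¹ - 1) ^ 2 = (d i)⁻¹ := fun i => by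
      rw [Real.sq_sqrt (sub_nonneg.2 ((one_le_inv₀ (hdpos i)).2 (hd1 i)))]; ring
    simp only [h1, Finset.prod_inv_distrib, hprod]
    have hG2 : 0 < G x ^ 2 := by positivity
    have hS2 : 0 < S.det ^ 2 := by positivity
    rw [inv_le_iff_one_le_mul₀ (by positivity)]
    nlinarith [mul_le_mul_of_nonneg_left hB hS2.le]
  have hcurv := frame_curvature_bound hδ1 hδ
    (fun i k => dirDeriv (S.col i) (graphComp f k) x)
    (fun i k => P i k - dirDeriv (S.col i) (graphComp f k) x)
    (fun i j k => dirDeriv (S.col i) (dirDeriv (S.col j) (graphComp f k)) x)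
    (fun i j k => dirDeriv_comm (hF k) _ _ _) _ hl hFF hNF hNN
  refine ⟨S, hS, ?_⟩
  have hGs : Smooth G := by
    have : G = fun y => a + b * dirDeriv (basisVec i₀) (graphComp f (Sum.inr α₀)) y :=
      funext hGdef
    rw [this]
    exact contDiff_const.add (contDiff_const.mul ((hF _).dirDeriv _))
  have hDs : Smooth D := by
    rw [show D = fun y => (graphMetric f y).det from funext hDdef]
    exact smooth_det (smooth_graphMetric hf)
  have hm1 : (fun y => (P * (graphJacobian f y * S)).det) = fun y => (G x)⁻¹ * G y := by
    funext y
    rw [hP, Matrix.mul_assoc, ← Matrix.mul_assoc Pm, Matrix.det_mul, Matrix.det_mul, hdetN,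
      Matrix.det_nonsing_inv, Ring.inverse_eq_inv', hdN]
    field_simp
  have hm2 : (fun y => (Sᵀ * graphMetric f y * S).det) = fun y => (D x)⁻¹ * D y := by
    funext y
    rw [Matrix.det_mul, Matrix.det_mul, Matrix.det_transpose, ← hDdef]
    field_simp
    linear_combination D y * hdetS
  have hd1' : ∀ (c : ℝ) {φ : (Fin n → ℝ) → ℝ}, Smooth φ → ∀ v y,
      dirDeriv v (fun y => c * φ y) y = c * dirDeriv v φ y :=
    fun c φ hφ v y => dirDeriv_const_mul v hφ.differentiableAt c
  have hd2' : ∀ (c : ℝ) {φ : (Fin n → ℝ) → ℝ}, Smooth φ → ∀ v,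
      dirDeriv v (dirDeriv v (fun y => c * φ y)) x = c * dirDeriv v (dirDeriv v φ) x := by
    intro c φ hφ v
    rw [show dirDeriv v (fun y => c * φ y) = fun y => c * dirDeriv v φ y from
      funext fun y => hd1' c hφ v y, hd1' c (hφ.dirDeriv v)]
  simp only [hm1, hm2] at hsv hfv
  simp only [hd2' _ hGs, hd2' _ hDs, hd1' _ hGs, hd1' _ hDs] at hsv hfv
  have hfv' : ∀ a, dirDeriv (S.col a) G x / G x - 1 / 2 * (dirDeriv (S.col a) D x / D x) =
      ∑ i, ∑ k, (P i k - dirDeriv (S.col i) (graphComp f k) x) *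
        dirDeriv (S.col i) (dirDeriv (S.col a) (graphComp f k)) x := by
    intro a
    rw [← hfv a]; ring
  simp only [hfv']
  simp only [div_eq_inv_mul]
  linarith

end LogEstimate

section NormalPart

lemma sum_sq_le_normal_part {ι μ : Type*} [Fintype ι] [Fintype μ] [DecidableEq ι]
    (e : ι → ι ⊕ μ → ℝ) (w : ι → μ → ℝ) {K : ℝ} (hK : ∑ i, ∑ α, w i α ^ 2 ≤ K)
    (he : ∀ i j, ∑ k, e i k * e j k = if i = j then 1 else 0)
    (hew : ∀ c α, e c (Sum.inr α) = ∑ i, e c (Sum.inl i) * w i α)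
    (h : ι ⊕ μ → ℝ) (h0 : ∀ i, h (Sum.inl i) = 0) :
    ∑ k, h k ^ 2 ≤ 2 * (1 + K) * ((∑ k, h k ^ 2) - ∑ c, (∑ k, e c k * h k) ^ 2) := by
  set y : ι → ℝ := fun c => ∑ k, e c k * h k with hy
  set z : ι → ℝ := fun i => ∑ c, y c * e c (Sum.inl i) with hz
  have h1 : (∑ k, h k ^ 2) - ∑ c, y c ^ 2 = ∑ k, (h k - ∑ c, y c * e c k) ^ 2 := by
    have e1 : ∑ k, h k * ∑ c, y c * e c k = ∑ c, y c ^ 2 := by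
      simp only [Finset.mul_sum]
      rw [Finset.sum_comm]
      refine Finset.sum_congr rfl fun c _ => ?_
      rw [sq]
      nth_rw 3 [hy]
      simp only [Finset.mul_sum]
      exact Finset.sum_congr rfl fun k _ => by ring
    have e2 : ∑ k, (∑ c, y c * e c k) ^ 2 = ∑ c, y c ^ 2 := by
      have : ∀ k, (∑ c, y c * e c k) ^ 2 = ∑ c, ∑ d, y c * y d * (e c k * e d k) := by
        intro k
        rw [sq, Finset.sum_mul_sum]
        exact Finset.sum_congr rfl fun c _ => Finset.sum_congr rfl fun d _ => by ring
      simp only [this]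
      rw [Finset.sum_comm]
      refine Finset.sum_congr rfl fun c _ => ?_
      rw [Finset.sum_comm]
      simp only [← Finset.mul_sum, he]
      simp [sq]
    have e3 : ∀ k, (h k - ∑ c, y c * e c k) ^ 2 =
        h k ^ 2 - 2 * (h k * ∑ c, y c * e c k) + (∑ c, y c * e c k) ^ 2 := fun k => by ring
    simp only [e3, Finset.sum_add_distrib, Finset.sum_sub_distrib, ← Finset.mul_sum, e1, e2]
    ring
  have hzα : ∀ α, ∑ c, y c * e c (Sum.inr α) = ∑ i, z i * w i α := by
    intro α
    simp only [hew, hz, Finset.mul_sum, Finset.sum_mul]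
    rw [Finset.sum_comm]
    exact Finset.sum_congr rfl fun c _ => Finset.sum_congr rfl fun d _ => by ring
  rw [h1, Fintype.sum_sum_type, Fintype.sum_sum_type]
  simp only [h0, hzα]
  have hz2 : ∑ i, (0 - ∑ c, y c * e c (Sum.inl i)) ^ 2 = ∑ i, z i ^ 2 :=
    Finset.sum_congr rfl fun i _ => by rw [zero_sub, neg_sq]
  rw [hz2]
  have hcs : ∑ α, (∑ i, z i * w i α) ^ 2 ≤ K * ∑ i, z i ^ 2 := by
    calc ∑ α, (∑ i, z i * w i α) ^ 2 ≤ ∑ α, (∑ i, z i ^ 2) * ∑ i, w i α ^ 2 :=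
          Finset.sum_le_sum fun α _ => Finset.sum_mul_sq_le_sq_mul_sq _ _ _
      _ = (∑ i, z i ^ 2) * ∑ i, ∑ α, w i α ^ 2 := by
          rw [← Finset.mul_sum, Finset.sum_comm]
      _ ≤ (∑ i, z i ^ 2) * K :=
          mul_le_mul_of_nonneg_left hK (Finset.sum_nonneg fun _ _ => sq_nonneg _)
      _ = _ := mul_comm _ _
  have hK0 : 0 ≤ K := le_trans (Finset.sum_nonneg fun _ _ => Finset.sum_nonneg fun _ _ =>
    sq_nonneg _) hK
  have hbd : ∑ α, h (Sum.inr α) ^ 2 ≤ ∑ α, (2 * (h (Sum.inr α) - ∑ i, z i * w i α) ^ 2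
      + 2 * (∑ i, z i * w i α) ^ 2) :=
    Finset.sum_le_sum fun α _ => by
      nlinarith [sq_nonneg (h (Sum.inr α) - 2 * ∑ i, z i * w i α)]
  rw [Finset.sum_add_distrib, ← Finset.mul_sum, ← Finset.mul_sum] at hbd
  have hv0 : 0 ≤ ∑ α, (h (Sum.inr α) - ∑ i, z i * w i α) ^ 2 :=
    Finset.sum_nonneg fun _ _ => sq_nonneg _
  have hz0 : 0 ≤ ∑ i, z i ^ 2 := Finset.sum_nonneg fun _ _ => sq_nonneg _
  have : ∑ i : ι, (0 : ℝ) ^ 2 = 0 := by simp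
  rw [this]
  nlinarith [mul_nonneg hK0 hv0, mul_nonneg hK0 hz0]

end NormalPart

section HessianBound

variable {n m : ℕ}

/-- The squared norm of the second derivative. -/
def hessSq (f : (Fin n → ℝ) → (Fin m → ℝ)) (x : Fin n → ℝ) : ℝ :=
  ∑ i, ∑ j, ∑ k, dirDeriv (basisVec i) (dirDeriv (basisVec j) (graphComp f k)) x ^ 2

variable {f : (Fin n → ℝ) → (Fin m → ℝ)} {S : Matrix (Fin n) (Fin n) ℝ} {x : Fin n → ℝ}

lemma dirDeriv_basisVec_eq_frame (hS : Sᵀ * graphMetric f x * S = 1) (i : Fin n) :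
    ∃ c : Fin n → ℝ, (∀ φ : (Fin n → ℝ) → ℝ, ∀ y, dirDeriv (basisVec i) φ y =
      ∑ a, c a * dirDeriv (S.col a) φ y) ∧ ∑ a, c a ^ 2 = graphMetric f x i i := by
  have hT : S * (Sᵀ * graphMetric f x) = 1 := mul_eq_one_comm.1 hS
  have hT2 : (Sᵀ * graphMetric f x)ᵀ * (Sᵀ * graphMetric f x) = graphMetric f x := by
    rw [Matrix.transpose_mul, Matrix.transpose_transpose, graphMetric_transpose, Matrix.mul_assoc,
      hT, Matrix.mul_one]
  refine ⟨fun a => (Sᵀ * graphMetric f x) a i, fun φ y => ?_, ?_⟩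
  · rw [← dirDeriv_sum_smul]
    congr 1
    funext j
    have := congrFun (congrFun hT j) i
    rw [Matrix.mul_apply, Matrix.one_apply] at this
    simp only [Finset.sum_apply, Pi.smul_apply, smul_eq_mul, Matrix.col_apply, Pi.single_apply]
    rw [← this]
    exact Finset.sum_congr rfl fun a _ => mul_comm _ _
  · have := congrFun (congrFun hT2 i) i
    rw [Matrix.mul_apply] at this
    rw [← this]
    exact Finset.sum_congr rfl fun a _ => by rw [Matrix.transpose_apply, sq]

lemma graphMetric_diag_le {β : ℝ} (h : slopeFunction f x ≤ β) (i : Fin n) :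
    graphMetric f x i i ≤ 1 + β ^ 2 := by
  rw [graphMetric_eq, Fintype.sum_sum_type]
  simp only [dirDeriv_graphComp_inl]
  have h1 := sum_sq_le_of_slope h
  have h2 := Finset.single_le_sum (f := fun i => ∑ α, dirDeriv (basisVec i)
    (graphComp f (Sum.inr α)) x ^ 2)
    (fun i _ => Finset.sum_nonneg fun _ _ => sq_nonneg _) (Finset.mem_univ i)
  have h3 : ∑ k, (basisVec i : Fin n → ℝ) k * (basisVec i : Fin n → ℝ) k = 1 := by
    simp [Pi.single_apply]
  simp only [← sq] at h3 ⊢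
  linarith

lemma sum_sq_mixed_le {β : ℝ} (h : slopeFunction f x ≤ β) (hS : Sᵀ * graphMetric f x * S = 1)
    (hf : ContDiff ℝ (⊤ : ℕ∞) f) (i : Fin n) (k : Fin n ⊕ Fin m) :
    ∑ a, dirDeriv (S.col a) (dirDeriv (basisVec i) (graphComp f k)) x ^ 2 ≤
      (1 + β ^ 2) * ∑ a, ∑ b, dirDeriv (S.col a) (dirDeriv (S.col b) (graphComp f k)) x ^ 2 := by
  obtain ⟨c, hc, hc2⟩ := dirDeriv_basisVec_eq_frame hS i
  rw [Finset.mul_sum]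
  refine Finset.sum_le_sum fun a _ => ?_
  have h1 : dirDeriv (S.col a) (dirDeriv (basisVec i) (graphComp f k)) x =
      ∑ b, c b * dirDeriv (S.col a) (dirDeriv (S.col b) (graphComp f k)) x := by
    rw [dirDeriv_comm (smooth_graphComp hf k), hc]
    exact Finset.sum_congr rfl fun b _ => by rw [dirDeriv_comm (smooth_graphComp hf k)]
  rw [h1]
  refine (Finset.sum_mul_sq_le_sq_mul_sq _ _ _).trans ?_
  rw [hc2]
  exact mul_le_mul_of_nonneg_right (graphMetric_diag_le h i)
    (Finset.sum_nonneg fun _ _ => sq_nonneg _)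

lemma hessSq_le_frame {β : ℝ} (h : slopeFunction f x ≤ β) (hS : Sᵀ * graphMetric f x * S = 1)
    (hf : ContDiff ℝ (⊤ : ℕ∞) f) :
    hessSq f x ≤ (n * (1 + β ^ 2)) ^ 2 * ∑ a, ∑ b, ∑ k,
      dirDeriv (S.col a) (dirDeriv (S.col b) (graphComp f k)) x ^ 2 := by
  have h1 : ∀ i j k, dirDeriv (basisVec i) (dirDeriv (basisVec j) (graphComp f k)) x ^ 2 ≤
      (1 + β ^ 2) * ∑ a, dirDeriv (S.col a) (dirDeriv (basisVec j) (graphComp f k)) x ^ 2 := by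
    intro i j k
    obtain ⟨c, hc, hc2⟩ := dirDeriv_basisVec_eq_frame hS i
    rw [hc]
    refine (Finset.sum_mul_sq_le_sq_mul_sq _ _ _).trans ?_
    rw [hc2]
    exact mul_le_mul_of_nonneg_right (graphMetric_diag_le h i)
      (Finset.sum_nonneg fun _ _ => sq_nonneg _)
  have h2 : ∀ i j k, dirDeriv (basisVec i) (dirDeriv (basisVec j) (graphComp f k)) x ^ 2 ≤
      (1 + β ^ 2) ^ 2 * ∑ a, ∑ b,
        dirDeriv (S.col a) (dirDeriv (S.col b) (graphComp f k)) x ^ 2 := by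
    intro i j k
    refine (h1 i j k).trans ?_
    rw [sq (1 + β ^ 2), mul_assoc]
    exact mul_le_mul_of_nonneg_left (sum_sq_mixed_le h hS hf j k) (by positivity)
  calc hessSq f x ≤ ∑ i : Fin n, ∑ j : Fin n, ∑ k, (1 + β ^ 2) ^ 2 * ∑ a, ∑ b,
        dirDeriv (S.col a) (dirDeriv (S.col b) (graphComp f k)) x ^ 2 :=
        Finset.sum_le_sum fun i _ => Finset.sum_le_sum fun j _ => Finset.sum_le_sum fun k _ =>
          h2 i j k
    _ = _ := by
        simp only [Finset.sum_const, Finset.card_univ, Fintype.card_fin, nsmul_eq_mul]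
        rw [← Finset.mul_sum, Finset.sum_comm]
        have : ∀ a, ∑ k, ∑ b, dirDeriv (S.col a) (dirDeriv (S.col b) (graphComp f k)) x ^ 2 =
          ∑ b, ∑ k, dirDeriv (S.col a) (dirDeriv (S.col b) (graphComp f k)) x ^ 2 :=
          fun a => Finset.sum_comm
        simp only [this]
        ring

lemma frame_le_second_fundamental_form {β : ℝ} (h : slopeFunction f x ≤ β)
    (hS : Sᵀ * graphMetric f x * S = 1) :
    ∑ a, ∑ b, ∑ k, dirDeriv (S.col a) (dirDeriv (S.col b) (graphComp f k)) x ^ 2 ≤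
      2 * (1 + β ^ 2) * ((∑ a, ∑ b, ∑ k,
          dirDeriv (S.col a) (dirDeriv (S.col b) (graphComp f k)) x ^ 2)
        - ∑ a, ∑ b, ∑ c, (∑ k, dirDeriv (S.col c) (graphComp f k) x
          * dirDeriv (S.col a) (dirDeriv (S.col b) (graphComp f k)) x) ^ 2) := by
  rw [← Finset.sum_sub_distrib, Finset.mul_sum]
  refine Finset.sum_le_sum fun a _ => ?_
  rw [← Finset.sum_sub_distrib, Finset.mul_sum]
  refine Finset.sum_le_sum fun b _ => ?_
  refine sum_sq_le_normal_part (fun c k => dirDeriv (S.col c) (graphComp f k) x)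
    (fun i α => dirDeriv (basisVec i) (graphComp f (Sum.inr α)) x) (sum_sq_le_of_slope h)
    (fun i j => by rw [← conj_graphMetric_apply, hS, Matrix.one_apply])
    (fun c α => ?_) _ (fun i => ?_)
  · simp only [dirDeriv_graphComp_inl]
    exact dirDeriv_eq_sum _ _ _
  · simp only [dirDeriv_graphComp_inl]
    simp

end HessianBound

section AngleFunction

/-- The angle `t` solving `cos t + p sin t = c s`. -/
def slopeAngle (c p s : ℝ) : ℝ := Real.arctan p - Real.arccos (c * s / Real.sqrt (1 + p ^ 2))

variable {c p s q : ℝ}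

lemma slopeAngle_ratio_bounds (hc : 0 < c) (hs : 1 ≤ s) (hq : c * s ≤ q * Real.sqrt (1 + p ^ 2)) :
    0 < c * s / Real.sqrt (1 + p ^ 2) ∧ c * s / Real.sqrt (1 + p ^ 2) ≤ q := by
  have h : 0 < Real.sqrt (1 + p ^ 2) := Real.sqrt_pos.2 (by positivity)
  exact ⟨div_pos (mul_pos hc (by linarith)) h, (div_le_iff₀ h).2 hq⟩

lemma slopeAngle_identities (hc : 0 < c) (hs : 1 ≤ s)
    (hq : c * s ≤ q * Real.sqrt (1 + p ^ 2)) (hq1 : q < 1) :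
    Real.cos (slopeAngle c p s) + p * Real.sin (slopeAngle c p s) = c * s ∧
    -Real.sin (slopeAngle c p s) + p * Real.cos (slopeAngle c p s) =
      Real.sqrt (1 + p ^ 2 - (c * s) ^ 2) := by
  obtain ⟨h1, h2⟩ := slopeAngle_ratio_bounds hc hs hq
  have hr : 0 < Real.sqrt (1 + p ^ 2) := Real.sqrt_pos.2 (by positivity)
  have hr2 : Real.sqrt (1 + p ^ 2) ^ 2 = 1 + p ^ 2 := Real.sq_sqrt (by positivity)
  set r := Real.sqrt (1 + p ^ 2) with hrdef
  have hcos : Real.cos (Real.arctan p) = 1 / r := Real.cos_arctan p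
  have hsin : Real.sin (Real.arctan p) = p / r := Real.sin_arctan p
  have hc2 : Real.cos (Real.arccos (c * s / r)) = c * s / r :=
    Real.cos_arccos (by linarith) (by linarith)
  have hs2 : Real.sin (Real.arccos (c * s / r)) = Real.sqrt (1 + p ^ 2 - (c * s) ^ 2) / r := by
    rw [Real.sin_arccos, ← Real.sqrt_sq hr.le, ← Real.sqrt_div' _ (by positivity),
      Real.sqrt_sq hr.le]
    congr 1
    field_simp
    rw [hr2]
  constructor
  · rw [slopeAngle, Real.cos_sub, Real.sin_sub, ← hrdef, hcos, hsin, hc2, hs2]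
    field_simp
    rw [hr2]; ring
  · rw [slopeAngle, Real.cos_sub, Real.sin_sub, ← hrdef, hcos, hsin, hc2, hs2]
    field_simp
    rw [hr2]; ring

lemma abs_slopeAngle_le : |slopeAngle c p s| ≤ 5 := by
  rw [slopeAngle, abs_le]
  have h1 := Real.arctan_lt_pi_div_two p
  have h2 := Real.neg_pi_div_two_lt_arctan p
  have h3 := Real.arccos_nonneg (c * s / Real.sqrt (1 + p ^ 2))
  have h4 := Real.arccos_le_pi (c * s / Real.sqrt (1 + p ^ 2))
  have h5 := Real.pi_lt_d2
  constructor <;> linarith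

lemma smooth_slopeAngle {E : Type*} [NormedAddCommGroup E] [NormedSpace ℝ E] {P D : E → ℝ}
    (hP : Smooth P) (hD : Smooth D) (hc : 0 < c) (hs : ∀ y, 1 ≤ D y)
    (hq : ∀ y, c * D y ≤ q * Real.sqrt (1 + P y ^ 2)) (hq1 : q < 1) :
    Smooth fun y => slopeAngle c (P y) (D y) := by
  have hpos : ∀ y, 1 + P y ^ 2 ≠ 0 := fun y => by positivity
  have hsq : Smooth fun y => Real.sqrt (1 + P y ^ 2) := (contDiff_const.add (hP.pow 2)).sqrt hpos
  have hdiv : Smooth fun y => c * D y / Real.sqrt (1 + P y ^ 2) :=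
    (contDiff_const.mul hD).div hsq fun y => (Real.sqrt_pos.2 (by positivity)).ne'
  refine (Real.contDiff_arctan.comp hP).sub (contDiff_iff_contDiffAt.2 fun y => ?_)
  obtain ⟨h1, h2⟩ := slopeAngle_ratio_bounds hc (hs y) (hq y)
  exact (Real.contDiffAt_arccos (by linarith) (by linarith)).comp y hdiv.contDiffAt

end AngleFunction

section ImplicitAngle

variable {E : Type*} [NormedAddCommGroup E] [NormedSpace ℝ E]

lemma angle_first_derivative {T p D : E → ℝ} {c : ℝ} (hT : Smooth T) (hp : Smooth p)
    (hD : Smooth D) (h : ∀ y, Real.cos (T y) + p y * Real.sin (T y) = c * D y) (v y : E) :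
    (-Real.sin (T y) + p y * Real.cos (T y)) * dirDeriv v T y + Real.sin (T y) * dirDeriv v p y =
      c * dirDeriv v D y := by
  have h1 : dirDeriv v (fun y => Real.cos (T y) + p y * Real.sin (T y)) y = c * dirDeriv v D y := by
    rw [show (fun y => Real.cos (T y) + p y * Real.sin (T y)) = fun y => c * D y from funext h]
    exact dirDeriv_const_mul v hD.differentiableAt c
  have hc : Smooth fun y => Real.cos (T y) := Real.contDiff_cos.comp hT
  have hs : Smooth fun y => Real.sin (T y) := Real.contDiff_sin.comp hT
  rw [dirDeriv_add v hc.differentiableAt (ContDiff.differentiable (hp.mul hs) (by simp) y),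
    dirDeriv_mul v hp.differentiableAt hs.differentiableAt,
    dirDeriv_comp v (Real.hasDerivAt_cos _) hT.differentiableAt,
    dirDeriv_comp v (Real.hasDerivAt_sin _) hT.differentiableAt] at h1
  rw [← h1]; ring

lemma angle_second_derivative {T p D : E → ℝ} {c : ℝ} (hT : Smooth T) (hp : Smooth p)
    (hD : Smooth D) (h : ∀ y, Real.cos (T y) + p y * Real.sin (T y) = c * D y) (v y : E) :
    (-Real.sin (T y) + p y * Real.cos (T y)) * dirDeriv v (dirDeriv v T) y
      + 2 * Real.cos (T y) * dirDeriv v p y * dirDeriv v T y - c * D y * dirDeriv v T y ^ 2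
      + Real.sin (T y) * dirDeriv v (dirDeriv v p) y = c * dirDeriv v (dirDeriv v D) y := by
  have hc : Smooth fun y => Real.cos (T y) := Real.contDiff_cos.comp hT
  have hs : Smooth fun y => Real.sin (T y) := Real.contDiff_sin.comp hT
  have hpc : Smooth fun y => p y * Real.cos (T y) := hp.mul hc
  have hns : Smooth fun y => -1 * Real.sin (T y) := contDiff_const.mul hs
  have hk : Smooth fun y => -1 * Real.sin (T y) + p y * Real.cos (T y) := hns.add hpc
  have h1 : dirDeriv v (fun y => (-1 * Real.sin (T y) + p y * Real.cos (T y)) * dirDeriv v T y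
      + Real.sin (T y) * dirDeriv v p y) y = c * dirDeriv v (dirDeriv v D) y := by
    have := fun y => angle_first_derivative hT hp hD h v y
    rw [show (fun y => (-1 * Real.sin (T y) + p y * Real.cos (T y)) * dirDeriv v T y
      + Real.sin (T y) * dirDeriv v p y) = fun y => c * dirDeriv v D y from
      funext fun y => by rw [← this y]; ring]
    exact dirDeriv_const_mul v (hD.dirDeriv v).differentiableAt c
  rw [dirDeriv_add v (ContDiff.differentiable (hk.mul (hT.dirDeriv v)) (by simp) y)
      (ContDiff.differentiable (hs.mul (hp.dirDeriv v)) (by simp) y),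
    dirDeriv_mul v hk.differentiableAt (hT.dirDeriv v).differentiableAt,
    dirDeriv_mul v hs.differentiableAt (hp.dirDeriv v).differentiableAt,
    dirDeriv_add v hns.differentiableAt hpc.differentiableAt,
    dirDeriv_const_mul v hs.differentiableAt,
    dirDeriv_mul v hp.differentiableAt hc.differentiableAt,
    dirDeriv_comp v (Real.hasDerivAt_cos _) hT.differentiableAt,
    dirDeriv_comp v (Real.hasDerivAt_sin _) hT.differentiableAt] at h1
  rw [← h1, ← h y]; ring

lemma dirDeriv_dirDeriv_exp {T : E → ℝ} (hT : Smooth T) (a : ℝ) (v y : E) :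
    dirDeriv v (dirDeriv v fun z => Real.exp (a * T z)) y =
      a * Real.exp (a * T y) * (dirDeriv v (dirDeriv v T) y + a * dirDeriv v T y ^ 2) := by
  have haT : Smooth fun z => a * T z := contDiff_const.mul hT
  have he : Smooth fun z => Real.exp (a * T z) := Real.contDiff_exp.comp haT
  have h1 : ∀ z, dirDeriv v (fun z => Real.exp (a * T z)) z =
      Real.exp (a * T z) * (a * dirDeriv v T z) := by
    intro z
    rw [dirDeriv_comp v (Real.hasDerivAt_exp _) haT.differentiableAt,
      dirDeriv_const_mul v hT.differentiableAt]
  have haT' : Smooth fun z => a * dirDeriv v T z := contDiff_const.mul (hT.dirDeriv v)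
  rw [show dirDeriv v (fun z => Real.exp (a * T z)) = fun z =>
    Real.exp (a * T z) * (a * dirDeriv v T z) from funext h1,
    dirDeriv_mul v he.differentiableAt haT'.differentiableAt, h1,
    dirDeriv_const_mul v (hT.dirDeriv v).differentiableAt]
  ring

lemma log_second_derivative_sq {D : E → ℝ} (hD : Smooth D) (v y : E) (h0 : D y ≠ 0) :
    dirDeriv v (fun z => D z ^ 2) y / D y ^ 2 = 2 * (dirDeriv v D y / D y) ∧
    dirDeriv v (dirDeriv v fun z => D z ^ 2) y / D y ^ 2
        - (dirDeriv v (fun z => D z ^ 2) y / D y ^ 2) ^ 2 =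
      2 * (dirDeriv v (dirDeriv v D) y / D y - (dirDeriv v D y / D y) ^ 2) := by
  have h1 : ∀ z, dirDeriv v (fun z => D z ^ 2) z = 2 * (D z * dirDeriv v D z) := by
    intro z
    simp only [sq]
    rw [dirDeriv_mul v hD.differentiableAt hD.differentiableAt]; ring
  have h2 : dirDeriv v (dirDeriv v fun z => D z ^ 2) y =
      2 * (dirDeriv v D y * dirDeriv v D y + D y * dirDeriv v (dirDeriv v D) y) := by
    rw [show dirDeriv v (fun z => D z ^ 2) = fun z => 2 * (D z * dirDeriv v D z) from funext h1,
      dirDeriv_const_mul v (ContDiff.differentiable (hD.mul (hD.dirDeriv v)) (by simp) y),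
      dirDeriv_mul v hD.differentiableAt (hD.dirDeriv v).differentiableAt]
  rw [h1, h2]
  constructor
  · field_simp
  · field_simp; ring

end ImplicitAngle

section AngleInequality

lemma angle_laplacian_lower_bound {ι : Type*} [Fintype ι] (T₁ T₂ p₁ p₂ s₁ s₂ : ι → ℝ)
    {κ K ct st s c δ A C : ℝ} (hc : 0 < c) (hs : 1 ≤ s) (hκ : 0 ≤ κ) (hκK : κ ≤ K)
    (hct : |ct| ≤ 1) (hst : |st| ≤ 1) (hδ : 0 < δ) (hC : 0 < C) (hA : 0 ≤ A)
    (h1 : ∀ a, κ * T₁ a + st * p₁ a = c * s₁ a)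
    (h2 : ∀ a, κ * T₂ a + 2 * ct * p₁ a * T₁ a - c * s * T₁ a ^ 2 + st * p₂ a = c * s₂ a)
    (hQ : δ * A ≤ -(∑ a, (st * p₂ a / (c * s) - (st * p₁ a / (c * s)) ^ 2))
      + (∑ a, (s₂ a / s - (s₁ a / s) ^ 2)) + 12 * ∑ a, (st * p₁ a / (c * s) - s₁ a / s) ^ 2)
    (hp : ∑ a, p₁ a ^ 2 ≤ C * A) :
    δ * c / 2 * A ≤ κ * ∑ a, T₂ a
      + (11 * K ^ 2 / c + (2 + 2 * K / c) ^ 2 * C / (2 * δ * c)) * ∑ a, T₁ a ^ 2 := by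
  have hs0 : 0 < s := by linarith
  set ε := δ * c / (2 * C) with hε
  have hε0 : 0 < ε := by positivity
  have hK : 0 ≤ K := hκ.trans hκK
  set E := 2 + 2 * K / c with hE
  have hM : E ^ 2 * C / (2 * δ * c) = E ^ 2 / (4 * ε) := by rw [hε]; field_simp; ring
  rw [hM]
  have key : ∀ a, c * s * (-(st * p₂ a / (c * s) - (st * p₁ a / (c * s)) ^ 2)
      + (s₂ a / s - (s₁ a / s) ^ 2) + 12 * (st * p₁ a / (c * s) - s₁ a / s) ^ 2) ≤
      κ * T₂ a + (11 * K ^ 2 / c + E ^ 2 / (4 * ε)) * T₁ a ^ 2 + ε * p₁ a ^ 2 := by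
    intro a
    have e1 : s₁ a = (κ * T₁ a + st * p₁ a) / c := by rw [h1 a]; field_simp
    have e2 : κ * T₂ a = c * s * T₁ a ^ 2 - 2 * ct * p₁ a * T₁ a
        + c * s * (-(st * p₂ a / (c * s) - (st * p₁ a / (c * s)) ^ 2)
      + (s₂ a / s - (s₁ a / s) ^ 2) + 12 * (st * p₁ a / (c * s) - s₁ a / s) ^ 2)
        - 11 * κ ^ 2 * T₁ a ^ 2 / (c * s) + 2 * κ * st * T₁ a * p₁ a / (c * s) := by
      have : s₂ a = (κ * T₂ a + 2 * ct * p₁ a * T₁ a - c * s * T₁ a ^ 2 + st * p₂ a) / c := by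
        rw [h2 a]; field_simp
      rw [this, e1]
      field_simp
      ring
    have hcs : c ≤ c * s := by nlinarith
    have b1 : 11 * κ ^ 2 * T₁ a ^ 2 / (c * s) ≤ 11 * K ^ 2 / c * T₁ a ^ 2 := by
      rw [div_mul_eq_mul_div]
      exact div_le_div₀ (by positivity)
        (mul_le_mul_of_nonneg_right (by nlinarith) (sq_nonneg _)) hc hcs
    have b2 : |2 * ct * p₁ a * T₁ a - 2 * κ * st * T₁ a * p₁ a / (c * s)| ≤
        E * |p₁ a * T₁ a| := by
      have e3 : 2 * ct * p₁ a * T₁ a - 2 * κ * st * T₁ a * p₁ a / (c * s) =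
          (2 * ct - 2 * κ * st / (c * s)) * (p₁ a * T₁ a) := by ring
      rw [e3, abs_mul]
      refine mul_le_mul_of_nonneg_right ((abs_sub _ _).trans ?_) (abs_nonneg _)
      rw [abs_mul, abs_div, abs_mul, abs_mul, abs_two, abs_of_nonneg hκ,
        abs_of_pos (show 0 < c * s by positivity), hE]
      have : 2 * κ * |st| / (c * s) ≤ 2 * K / c := by
        refine div_le_div₀ (by positivity) ?_ hc hcs
        nlinarith [abs_nonneg st]
      linarith
    have b3 : E * |p₁ a * T₁ a| ≤ E ^ 2 / (4 * ε) * T₁ a ^ 2 + ε * p₁ a ^ 2 := by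
      rw [abs_mul, ← sq_abs (T₁ a), ← sq_abs (p₁ a)]
      have : E ^ 2 / (4 * ε) * |T₁ a| ^ 2 + ε * |p₁ a| ^ 2 - E * (|p₁ a| * |T₁ a|) =
        (E * |T₁ a| - 2 * ε * |p₁ a|) ^ 2 / (4 * ε) := by field_simp; ring
      have : 0 ≤ (E * |T₁ a| - 2 * ε * |p₁ a|) ^ 2 / (4 * ε) := by positivity
      linarith
    have b4 := (abs_le.1 b2).2
    have b5 : 0 ≤ c * s * T₁ a ^ 2 := by positivity
    rw [add_mul]
    linarith
  have hsum := Finset.sum_le_sum fun a (_ : a ∈ Finset.univ) => key a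
  rw [← Finset.mul_sum] at hsum
  simp only [Finset.sum_add_distrib, Finset.sum_neg_distrib, ← Finset.mul_sum] at hsum
  have hl : c * (δ * A) ≤ c * s * (δ * A) := by
    have : 0 ≤ δ * A := by positivity
    nlinarith [mul_nonneg (mul_nonneg hc.le (sub_nonneg.2 hs)) this]
  have hl2 := mul_le_mul_of_nonneg_left hQ (show 0 ≤ c * s by positivity)
  have hl3 : ε * ∑ a, p₁ a ^ 2 ≤ δ * c / 2 * A := by
    refine (mul_le_mul_of_nonneg_left hp hε0.le).trans (le_of_eq ?_)
    rw [hε]; field_simp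
  linarith

end AngleInequality

section Subharmonic

lemma exp_weighted_bound {μ κ κ₀ K M L N A H C δ t : ℝ} (hμ : μ = M / κ₀) (hM : 0 < M)
    (hκ₀ : 0 < κ₀) (h1 : κ₀ ≤ κ) (h2 : κ ≤ K) (hN : 0 ≤ N) (hA : 0 ≤ A) (hC : 0 < C)
    (hδ : 0 < δ) (hH : H ≤ C * A) (ht : |t| ≤ 5) (h : δ * A ≤ κ * L + M * N) :
    μ * Real.exp (-(μ * 5)) * (δ / K / C) * H ≤ μ * Real.exp (μ * t) * (L + μ * N) := by
  have hκ : 0 < κ := hκ₀.trans_le h1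
  have hK : 0 < K := hκ.trans_le h2
  have hμ0 : 0 < μ := by rw [hμ]; positivity
  have hLN : δ / K * A ≤ L + μ * N := by
    have h3 : δ / K * A ≤ δ / κ * A :=
      mul_le_mul_of_nonneg_right (div_le_div_of_nonneg_left hδ.le hκ h2) hA
    have h4 : δ / κ * A ≤ L + M / κ * N := by
      have : L + M / κ * N = (κ * L + M * N) / κ := by field_simp
      rw [this, div_mul_eq_mul_div]
      exact div_le_div_of_nonneg_right h hκ.le
    have h5 : M / κ * N ≤ μ * N := by
      rw [hμ]
      exact mul_le_mul_of_nonneg_right (div_le_div_of_nonneg_left hM.le hκ₀ h1) hN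
    linarith
  have hLN0 : 0 ≤ L + μ * N := le_trans (by positivity) hLN
  have hexp : Real.exp (-(μ * 5)) ≤ Real.exp (μ * t) := by
    refine Real.exp_le_exp.2 ?_
    nlinarith [(abs_le.1 ht).1]
  calc μ * Real.exp (-(μ * 5)) * (δ / K / C) * H
      ≤ μ * Real.exp (-(μ * 5)) * (δ / K / C) * (C * A) :=
        mul_le_mul_of_nonneg_left hH (by positivity)
    _ = μ * Real.exp (-(μ * 5)) * (δ / K * A) := by field_simp
    _ ≤ μ * Real.exp (-(μ * 5)) * (L + μ * N) := mul_le_mul_of_nonneg_left hLN (by positivity)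
    _ ≤ μ * Real.exp (μ * t) * (L + μ * N) :=
        mul_le_mul_of_nonneg_right (mul_le_mul_of_nonneg_left hexp hμ0.le) hLN0

lemma exists_smooth_slopeAngle {E : Type*} [NormedAddCommGroup E] [NormedSpace ℝ E]
    {p s : E → ℝ} (hp : Smooth p) (hs : Smooth s) (hs1 : ∀ y, 1 ≤ s y) {β₀ β₁ : ℝ}
    (hβ₀ : 0 ≤ β₀) (hp2 : ∀ y, p y ^ 2 ≤ β₀ ^ 2) (hβ₁ : β₁ < 3)
    (h₁ : ∀ y, s y ≤ β₁ * Real.sqrt (1 + p y ^ 2)) :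
    ∃ (c κ₀ : ℝ) (T : E → ℝ), 1 / 3 < c ∧ 0 < κ₀ ∧ Smooth T ∧ (∀ y, |T y| ≤ 5) ∧
      (∀ y, Real.cos (T y) + p y * Real.sin (T y) = c * s y) ∧
      (∀ y, κ₀ ≤ -Real.sin (T y) + p y * Real.cos (T y)) ∧
      ∀ y, -Real.sin (T y) + p y * Real.cos (T y) ≤ 1 + β₀ := by
  have hβ₁0 : 0 < β₁ := by
    by_contra h
    have := (hs1 0).trans (h₁ 0)
    nlinarith [Real.sqrt_nonneg (1 + p 0 ^ 2)]
  obtain ⟨c, hc1, hc2⟩ : ∃ c : ℝ, 1 / 3 < c ∧ c < 1 / β₁ :=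
    exists_between (one_div_lt_one_div_of_lt hβ₁0 hβ₁)
  have hc : 0 < c := by linarith
  have hq1 : c * β₁ < 1 := by rwa [lt_div_iff₀ hβ₁0] at hc2
  have hq0 : 0 < c * β₁ := by positivity
  have hq : ∀ y, c * s y ≤ c * β₁ * Real.sqrt (1 + p y ^ 2) := fun y => by
    rw [mul_assoc]; exact mul_le_mul_of_nonneg_left (h₁ y) hc.le
  have hκ : ∀ y, -Real.sin (slopeAngle c (p y) (s y)) + p y * Real.cos (slopeAngle c (p y) (s y)) =
      Real.sqrt (1 + p y ^ 2 - (c * s y) ^ 2) := fun y =>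
    (slopeAngle_identities hc (hs1 y) (hq y) hq1).2
  refine ⟨c, Real.sqrt (1 - (c * β₁) ^ 2), fun y => slopeAngle c (p y) (s y), hc1,
    Real.sqrt_pos.2 (by nlinarith), smooth_slopeAngle hp hs hc hs1 hq hq1,
    fun y => abs_slopeAngle_le, fun y => (slopeAngle_identities hc (hs1 y) (hq y) hq1).1,
    fun y => ?_, fun y => ?_⟩
  · simp only [hκ]
    refine Real.sqrt_le_sqrt ?_
    have h1 : (c * s y) ^ 2 ≤ (c * β₁) ^ 2 * (1 + p y ^ 2) := by
      have := pow_le_pow_left₀ (by nlinarith [hs1 y]) (hq y) 2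
      rwa [mul_pow (c * β₁), Real.sq_sqrt (by positivity)] at this
    nlinarith [mul_nonneg (show 0 ≤ 1 - (c * β₁) ^ 2 by nlinarith) (sq_nonneg (p y))]
  · simp only [hκ]
    rw [Real.sqrt_le_left (by linarith)]
    nlinarith [hp2 y, sq_nonneg (c * s y)]

variable {n m : ℕ} {f : (Fin n → ℝ) → (Fin m → ℝ)}

lemma slope_log_estimate
    (hf : ContDiff ℝ (⊤ : ℕ∞) f) (hmin : MinimalSystem f) (i₀ : Fin n) (α₀ : Fin m) {c : ℝ}
    (hc : 1 / 3 < c) : ∃ δ : ℝ, 0 < δ ∧ ∀ (x : Fin n → ℝ) (t : ℝ) (p : (Fin n → ℝ) → ℝ),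
      p = dirDeriv (basisVec i₀) (graphComp f (Sum.inr α₀)) →
      Real.cos t + p x * Real.sin t = c * slopeFunction f x →
      ∃ S : Matrix (Fin n) (Fin n) ℝ, Sᵀ * graphMetric f x * S = 1 ∧
      δ * ((∑ a, ∑ b, ∑ k, dirDeriv (S.col a) (dirDeriv (S.col b) (graphComp f k)) x ^ 2)
        - ∑ a, ∑ b, ∑ c, (∑ k, dirDeriv (S.col c) (graphComp f k) x
          * dirDeriv (S.col a) (dirDeriv (S.col b) (graphComp f k)) x) ^ 2) ≤
      -(∑ a, (Real.sin t * dirDeriv (S.col a) (dirDeriv (S.col a) p) x / (c * slopeFunction f x)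
          - (Real.sin t * dirDeriv (S.col a) p x / (c * slopeFunction f x)) ^ 2))
        + (∑ a, (dirDeriv (S.col a) (dirDeriv (S.col a) (slopeFunction f)) x / slopeFunction f x
          - (dirDeriv (S.col a) (slopeFunction f) x / slopeFunction f x) ^ 2))
        + 12 * ∑ a, (Real.sin t * dirDeriv (S.col a) p x / (c * slopeFunction f x)
          - dirDeriv (S.col a) (slopeFunction f) x / slopeFunction f x) ^ 2 := by
  have hc0 : 0 < c := by linarith
  obtain ⟨δ, hδ0, hδ1, hδ⟩ := slope_algebraic_strict (Fin n) (B := 1 / c ^ 2)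
    (by rw [div_lt_iff₀ (by positivity)]; nlinarith)
  refine ⟨δ, hδ0, fun x t p hpdef hid => ?_⟩
  have hp : Smooth p := by rw [hpdef]; exact (smooth_graphComp hf _).dirDeriv _
  have hsx : 0 < slopeFunction f x := by linarith [one_le_slopeFunction f x]
  have hGx : Real.cos t + Real.sin t * p x = c * slopeFunction f x := by rw [← hid]; ring
  obtain ⟨S, hS, hlog⟩ := log_estimate hf hmin i₀ α₀ (Real.cos_sq_add_sin_sq t) hδ1 hδ x
    (G := fun y => Real.cos t + Real.sin t * p y) (D := fun y => slopeFunction f y ^ 2)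
    (fun y => by rw [hpdef]) (fun y => slopeFunction_sq f y)
    (by simp only [hGx]; positivity)
    (by simp only [hGx]; rw [mul_pow]; field_simp; rfl)
  refine ⟨S, hS, hlog.trans (le_of_eq ?_)⟩
  clear hlog
  have hG1 : ∀ v y, dirDeriv v (fun y => Real.cos t + Real.sin t * p y) y =
      Real.sin t * dirDeriv v p y := by
    intro v y
    have h2 : Smooth fun y => Real.sin t * p y := contDiff_const.mul hp
    rw [dirDeriv_add v (by fun_prop) h2.differentiableAt, dirDeriv_const,
      dirDeriv_const_mul v hp.differentiableAt, zero_add]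
  have hG2 : ∀ v, dirDeriv v (dirDeriv v (fun y => Real.cos t + Real.sin t * p y)) x =
      Real.sin t * dirDeriv v (dirDeriv v p) x := by
    intro v
    rw [show dirDeriv v (fun y => Real.cos t + Real.sin t * p y) =
      fun y => Real.sin t * dirDeriv v p y from funext (hG1 v),
      dirDeriv_const_mul v (hp.dirDeriv v).differentiableAt]
  have hD1 := fun v => (log_second_derivative_sq (smooth_slope hf) v x hsx.ne').1
  have hD2 := fun v => (log_second_derivative_sq (smooth_slope hf) v x hsx.ne').2
  simp only [hG1, hG2, hGx, hD2]
  simp only [hD1]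
  rw [← Finset.mul_sum, ← mul_assoc]
  congr 1
  · congr 1
    ring
  · congr 1
    refine Finset.sum_congr rfl fun a _ => ?_
    ring

theorem exists_bounded_subharmonic
    (hf : ContDiff ℝ (⊤ : ℕ∞) f) (hmin : MinimalSystem f) (i₀ : Fin n) (α₀ : Fin m) {β₀ β₁ : ℝ}
    (hβ₁ : β₁ < 3) (h₀ : ∀ x, slopeFunction f x ≤ β₀)
    (h₁ : ∀ x, slopeFunction f x ≤ β₁ * Real.sqrt (1 +
      dirDeriv (basisVec i₀) (graphComp f (Sum.inr α₀)) x ^ 2)) :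
    ∃ (u : (Fin n → ℝ) → ℝ) (ε B : ℝ), Smooth u ∧ 0 < ε ∧ (∀ x, 0 ≤ u x ∧ u x ≤ B) ∧
      ∀ x, ε * hessSq f x ≤ metricLaplacian f u x := by
  obtain ⟨p, hpdef⟩ : ∃ p, p = dirDeriv (basisVec i₀) (graphComp f (Sum.inr α₀)) := ⟨_, rfl⟩
  have hp : Smooth p := by rw [hpdef]; exact (smooth_graphComp hf _).dirDeriv _
  have hss := smooth_slope hf
  have hs1 := one_le_slopeFunction f
  have hβ₀ : 1 ≤ β₀ := (hs1 0).trans (h₀ 0)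
  have hp2 : ∀ y, p y ^ 2 ≤ β₀ ^ 2 := by
    intro y
    refine le_trans ?_ (sum_sq_le_of_slope (h₀ y))
    refine le_trans ?_ (Finset.single_le_sum (f := fun i => ∑ α, dirDeriv (basisVec i)
      (graphComp f (Sum.inr α)) y ^ 2) (fun i _ => Finset.sum_nonneg fun _ _ => sq_nonneg _)
      (Finset.mem_univ i₀))
    rw [hpdef]
    exact Finset.single_le_sum (f := fun α => dirDeriv (basisVec i₀)
      (graphComp f (Sum.inr α)) y ^ 2) (fun i _ => sq_nonneg _) (Finset.mem_univ α₀)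
  obtain ⟨c, κ₀, T, hc1, hκ₀, hT, hT5, hid, hκlow, hκup⟩ :=
    exists_smooth_slopeAngle hp hss hs1 (by linarith) hp2 hβ₁ (by rw [hpdef]; exact h₁)
  have hc : 0 < c := by linarith
  obtain ⟨δ, hδ0, hlog⟩ := slope_log_estimate hf hmin i₀ α₀ hc1
  obtain ⟨K, hK⟩ : ∃ K, K = 1 + β₀ := ⟨_, rfl⟩
  have hK0 : 0 < K := by linarith
  obtain ⟨C, hC⟩ : ∃ C, C = (1 + β₀ ^ 2) * (2 * (1 + β₀ ^ 2)) := ⟨_, rfl⟩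
  have hC0 : 0 < C := by rw [hC]; positivity
  obtain ⟨M, hM⟩ : ∃ M, M = 11 * K ^ 2 / c + (2 + 2 * K / c) ^ 2 * C / (2 * δ * c) := ⟨_, rfl⟩
  have hM0 : 0 < M := by rw [hM]; positivity
  obtain ⟨μ, hμ⟩ : ∃ μ, μ = M / κ₀ := ⟨_, rfl⟩
  have hμ0 : 0 < μ := by rw [hμ]; positivity
  obtain ⟨C₁, hC₁⟩ : ∃ C₁, C₁ = ((n : ℝ) * (1 + β₀ ^ 2)) ^ 2 * (2 * (1 + β₀ ^ 2)) + 1 := ⟨_, rfl⟩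
  have hC₁0 : 0 < C₁ := by rw [hC₁]; positivity
  have hu : Smooth fun y => Real.exp (μ * T y) :=
    Real.contDiff_exp.comp (contDiff_const.mul hT)
  refine ⟨fun y => Real.exp (μ * T y), μ * Real.exp (-(μ * 5)) * (δ * c / 2 / K / C₁),
    Real.exp (μ * 5), hu, by positivity, fun x => ⟨(Real.exp_pos _).le,
      Real.exp_le_exp.2 (mul_le_mul_of_nonneg_left (abs_le.1 (hT5 x)).2 hμ0.le)⟩, fun x => ?_⟩
  obtain ⟨S, hS, hQ⟩ := hlog x (T x) p hpdef (hid x)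
  have hWA := frame_le_second_fundamental_form (h₀ x) hS
  have hH := hessSq_le_frame (h₀ x) hS hf
  have hpW : ∑ a, dirDeriv (S.col a) p x ^ 2 ≤ (1 + β₀ ^ 2) * ∑ a, ∑ b, ∑ k,
      dirDeriv (S.col a) (dirDeriv (S.col b) (graphComp f k)) x ^ 2 := by
    rw [hpdef]
    refine (sum_sq_mixed_le (h₀ x) hS hf i₀ (Sum.inr α₀)).trans
      (mul_le_mul_of_nonneg_left ?_ (by positivity))
    exact Finset.sum_le_sum fun a _ => Finset.sum_le_sum fun b _ =>
      Finset.single_le_sum (f := fun k =>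
        dirDeriv (S.col a) (dirDeriv (S.col b) (graphComp f k)) x ^ 2)
        (fun i _ => sq_nonneg _) (Finset.mem_univ _)
  have hW0 : 0 ≤ ∑ a, ∑ b, ∑ k, dirDeriv (S.col a) (dirDeriv (S.col b) (graphComp f k)) x ^ 2 :=
    Finset.sum_nonneg fun _ _ => Finset.sum_nonneg fun _ _ =>
    Finset.sum_nonneg fun _ _ => sq_nonneg _
  generalize (∑ a, ∑ b, ∑ k, dirDeriv (S.col a) (dirDeriv (S.col b) (graphComp f k)) x ^ 2)
        - ∑ a, ∑ b, ∑ c, (∑ k, dirDeriv (S.col c) (graphComp f k) x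
          * dirDeriv (S.col a) (dirDeriv (S.col b) (graphComp f k)) x) ^ 2 = A at hQ hWA
  generalize ∑ a, ∑ b, ∑ k, dirDeriv (S.col a) (dirDeriv (S.col b) (graphComp f k)) x ^ 2 = W
    at hWA hH hpW hW0
  have hA0 : 0 ≤ A := by
    by_contra h
    have : 2 * (1 + β₀ ^ 2) * A < 0 := mul_neg_of_pos_of_neg (by positivity) (by linarith)
    linarith
  have hpC : ∑ a, dirDeriv (S.col a) p x ^ 2 ≤ C * A := by
    refine hpW.trans ?_
    rw [hC, mul_assoc]
    exact mul_le_mul_of_nonneg_left hWA (by positivity)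
  have hHA : hessSq f x ≤ C₁ * A := by
    refine hH.trans ?_
    rw [hC₁, add_mul, one_mul, mul_assoc]
    have := mul_le_mul_of_nonneg_left hWA (show 0 ≤ ((n : ℝ) * (1 + β₀ ^ 2)) ^ 2 by positivity)
    linarith
  have hfin := angle_laplacian_lower_bound (fun a => dirDeriv (S.col a) T x)
    (fun a => dirDeriv (S.col a) (dirDeriv (S.col a) T) x)
    (fun a => dirDeriv (S.col a) p x) (fun a => dirDeriv (S.col a) (dirDeriv (S.col a) p) x)
    (fun a => dirDeriv (S.col a) (slopeFunction f) x)
    (fun a => dirDeriv (S.col a) (dirDeriv (S.col a) (slopeFunction f)) x)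
    hc (hs1 x) (hκ₀.le.trans (hκlow x)) ((hκup x).trans_eq hK.symm) (Real.abs_cos_le_one (T x))
    (Real.abs_sin_le_one (T x)) hδ0 hC0 hA0
    (fun a => angle_first_derivative hT hp hss hid _ x)
    (fun a => angle_second_derivative hT hp hss hid _ x) hQ hpC
  rw [← hM] at hfin
  rw [metricLaplacian_eq_sum hS hu]
  simp only [dirDeriv_dirDeriv_exp hT]
  rw [← Finset.mul_sum, Finset.sum_add_distrib, ← Finset.mul_sum]
  exact exp_weighted_bound hμ hM0 hκ₀ (hκlow x) ((hκup x).trans_eq hK.symm)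
    (Finset.sum_nonneg fun _ _ => sq_nonneg _) hA0 hC₁0 (by positivity) hHA (hT5 x) hfin

end Subharmonic

open MeasureTheory

section IntegrationByParts

variable {n m : ℕ}

lemma Smooth.continuous {E : Type*} [NormedAddCommGroup E] [NormedSpace ℝ E] {φ : E → ℝ}
    (h : Smooth φ) : Continuous φ := ContDiff.continuous h

lemma hasCompactSupport_dirDeriv {E : Type*} [NormedAddCommGroup E] [NormedSpace ℝ E] {φ : E → ℝ}
    (h : HasCompactSupport φ) (v : E) : HasCompactSupport (dirDeriv v φ) :=
  (h.fderiv (𝕜 := ℝ)).comp_left (g := fun A : E →L[ℝ] ℝ => A v) (by simp)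

lemma integral_mul_dirDeriv {f g : (Fin n → ℝ) → ℝ} (hf : Smooth f) (hg : Smooth g)
    (hc : HasCompactSupport g) (v : Fin n → ℝ) :
    ∫ x, f x * dirDeriv v g x = - ∫ x, dirDeriv v f x * g x := by
  refine integral_mul_fderiv_eq_neg_fderiv_mul_of_integrable ?_ ?_ ?_
    (fun x _ => hf.differentiableAt) (fun x _ => hg.differentiableAt)
  · exact ((hf.dirDeriv v).continuous.mul hg.continuous).integrable_of_hasCompactSupport
      (hc.mul_left)
  · exact (hf.continuous.mul (hg.dirDeriv v).continuous).integrable_of_hasCompactSupport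
      ((hasCompactSupport_dirDeriv hc v).mul_left)
  · exact (hf.continuous.mul hg.continuous).integrable_of_hasCompactSupport hc.mul_left

/-- A bounded smooth vector field on Euclidean space with constant divergence is divergence free. -/
lemma divergence_eq_zero_of_bounded {h : Fin n → (Fin n → ℝ) → ℝ} (hh : ∀ a, Smooth (h a))
    {B c : ℝ} (hB : ∀ a x, |h a x| ≤ B) (hc : ∀ x, ∑ a, dirDeriv (basisVec a) (h a) x = c) :
    c = 0 := by
  let φ : ContDiffBump (0 : Fin n → ℝ) := default
  have hφ : Smooth (φ : (Fin n → ℝ) → ℝ) := φ.contDiff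
  have hφc : HasCompactSupport (φ : (Fin n → ℝ) → ℝ) := φ.hasCompactSupport
  have hI : 0 < ∫ x, φ x := φ.integral_pos
  obtain ⟨C, hC⟩ : ∃ C, C = ∑ a, ∫ x, B * |dirDeriv (basisVec a) φ x| := ⟨_, rfl⟩
  have key : ∀ R : ℝ, |R * c| * ∫ x, φ x ≤ C := by
    intro R
    have hs : ∀ a, Smooth fun x => h a (R • x) := fun a =>
      ContDiff.comp (hh a) (contDiff_const_smul R)
    have hd : ∀ a x, dirDeriv (basisVec a) (fun x => h a (R • x)) x =
        R * dirDeriv (basisVec a) (h a) (R • x) := by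
      intro a x
      have h1 : HasFDerivAt (fun x : Fin n → ℝ => R • x)
          (R • ContinuousLinearMap.id ℝ (Fin n → ℝ)) x := (hasFDerivAt_id x).const_smul R
      have h2 := ((hh a).differentiableAt (x := R • x)).hasFDerivAt.comp x h1
      have h3 : fderiv ℝ (fun x => h a (R • x)) x = _ := h2.fderiv
      rw [dirDeriv, h3]
      simp [dirDeriv]
    have h1 : R * c * ∫ x, φ x = - ∑ a, ∫ x, h a (R • x) * dirDeriv (basisVec a) φ x := by
      have h2 : ∀ a, ∫ x, h a (R • x) * dirDeriv (basisVec a) φ x =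
          - ∫ x, R * dirDeriv (basisVec a) (h a) (R • x) * φ x := by
        intro a
        rw [integral_mul_dirDeriv (hs a) hφ hφc]
        simp only [hd]
      simp only [h2, Finset.sum_neg_distrib, neg_neg]
      rw [← integral_finsetSum]
      · rw [← integral_const_mul]
        refine integral_congr_ae (Filter.Eventually.of_forall fun x => ?_)
        simp only
        rw [← hc (R • x), Finset.mul_sum, Finset.sum_mul]
      · intro a _
        have := (((hs a).dirDeriv (basisVec a)).continuous.mul
          hφ.continuous).integrable_of_hasCompactSupport (hφc.mul_left) (μ := volume)
        simpa only [Pi.mul_def, hd] using this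
    have h3 : |R * c| * ∫ x, φ x = |R * c * ∫ x, φ x| := by
      rw [abs_mul (R * c), abs_of_pos hI]
    rw [h3, h1, abs_neg, hC]
    refine (Finset.abs_sum_le_sum_abs _ _).trans (Finset.sum_le_sum fun a _ => ?_)
    refine abs_integral_le_integral_abs.trans ?_
    have hi : Integrable (fun x => dirDeriv (basisVec a) φ x) :=
      (hφ.dirDeriv _).continuous.integrable_of_hasCompactSupport (hasCompactSupport_dirDeriv hφc _)
    refine integral_mono_of_nonneg (Filter.Eventually.of_forall fun x => abs_nonneg _)
      (hi.abs.const_mul B) (Filter.Eventually.of_forall fun x => ?_)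
    simp only [abs_mul]
    exact mul_le_mul_of_nonneg_right (hB _ _) (abs_nonneg _)
  by_contra hne
  have h1 := key ((|C| + 1) / (|c| * ∫ x, φ x))
  have h2 : 0 < |c| := abs_pos.2 hne
  rw [abs_mul, abs_of_pos (by positivity)] at h1
  have h3 : (|C| + 1) / (|c| * ∫ x, φ x) * |c| * ∫ x, φ x = |C| + 1 := by field_simp
  rw [h3] at h1
  linarith [le_abs_self C]

end IntegrationByParts

section MeanCurvature

variable {n m : ℕ}

lemma normalProjection_eq (f : (Fin n → ℝ) → (Fin m → ℝ)) (x : Fin n → ℝ) :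
    normalProjection f x = 1 - graphJacobian f x * (graphMetric f x)⁻¹ * (graphJacobian f x)ᵀ := by
  ext k l
  simp only [normalProjection, Matrix.of_apply, Matrix.sub_apply, Matrix.one_apply,
    Matrix.mul_apply, Matrix.transpose_apply, Finset.sum_mul, graphTangent_eq]
  congr 1
  rw [Finset.sum_comm]
  refine Finset.sum_congr rfl fun i _ => Finset.sum_congr rfl fun j _ => ?_
  simp only [graphJacobian, Matrix.of_apply]
  ring

lemma meanCurvature_eq (f : (Fin n → ℝ) → (Fin m → ℝ)) (x : Fin n → ℝ) :
    meanCurvature f x = normalProjection f x *ᵥ fun k => metricLaplacian f (graphComp f k) x := by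
  funext k
  simp only [meanCurvature, Matrix.mulVec, dotProduct, metricLaplacian, Finset.mul_sum]
  conv_rhs => rw [Finset.sum_comm]
  refine Finset.sum_congr rfl fun i _ => ?_
  rw [Finset.sum_comm]
  refine Finset.sum_congr rfl fun l _ => Finset.sum_congr rfl fun j _ => ?_
  change _ * (_ * dirDeriv (basisVec i) (dirDeriv (basisVec j) (graphComp f l)) x) = _
  ring

lemma transpose_mul_normalProjection (f : (Fin n → ℝ) → (Fin m → ℝ)) (x : Fin n → ℝ) :
    (graphJacobian f x)ᵀ * normalProjection f x = 0 := by
  rw [normalProjection_eq, Matrix.mul_sub, Matrix.mul_one, ← Matrix.mul_assoc, ← Matrix.mul_assoc,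
    ← graphMetric_eq_jacobian, Matrix.mul_nonsing_inv _ (isUnit_det_graphMetric f x),
    Matrix.one_mul, sub_self]

lemma transpose_mulVec_meanCurvature (f : (Fin n → ℝ) → (Fin m → ℝ)) (x : Fin n → ℝ) :
    (graphJacobian f x)ᵀ *ᵥ meanCurvature f x = 0 := by
  rw [meanCurvature_eq, Matrix.mulVec_mulVec, transpose_mul_normalProjection, Matrix.zero_mulVec]

lemma eq_of_normalProjection_eq_zero {f : (Fin n → ℝ) → (Fin m → ℝ)} {x : Fin n → ℝ}
    {W : Fin n ⊕ Fin m → ℝ} (h : normalProjection f x *ᵥ W = 0) :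
    W = graphJacobian f x *ᵥ ((graphMetric f x)⁻¹ *ᵥ ((graphJacobian f x)ᵀ *ᵥ W)) := by
  rw [normalProjection_eq, Matrix.sub_mulVec, Matrix.one_mulVec, sub_eq_zero] at h
  rw [Matrix.mulVec_mulVec, Matrix.mulVec_mulVec]
  exact h

lemma meanCurvature_dotProduct_jacobian (f : (Fin n → ℝ) → (Fin m → ℝ)) (x w : Fin n → ℝ) :
    meanCurvature f x ⬝ᵥ (graphJacobian f x *ᵥ w) = 0 := by
  rw [Matrix.dotProduct_mulVec, ← Matrix.mulVec_transpose, transpose_mulVec_meanCurvature,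
    zero_dotProduct]

lemma meanCurvature_dotProduct_self (f : (Fin n → ℝ) → (Fin m → ℝ)) (x : Fin n → ℝ) :
    meanCurvature f x ⬝ᵥ meanCurvature f x =
      meanCurvature f x ⬝ᵥ fun k => metricLaplacian f (graphComp f k) x := by
  obtain ⟨V, hV⟩ : ∃ V, V = fun k => metricLaplacian f (graphComp f k) x := ⟨_, rfl⟩
  have h : meanCurvature f x = V - graphJacobian f x *ᵥ ((graphMetric f x)⁻¹ *ᵥ
      ((graphJacobian f x)ᵀ *ᵥ V)) := by
    rw [meanCurvature_eq, normalProjection_eq, Matrix.sub_mulVec, Matrix.one_mulVec, ← hV,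
      Matrix.mulVec_mulVec, Matrix.mulVec_mulVec]
  rw [← hV]
  conv_lhs => enter [2]; rw [h]
  rw [dotProduct_sub, meanCurvature_dotProduct_jacobian, sub_zero]

lemma smooth_metricLaplacian {f : (Fin n → ℝ) → (Fin m → ℝ)} (hf : ContDiff ℝ (⊤ : ℕ∞) f)
    {φ : (Fin n → ℝ) → ℝ} (hφ : Smooth φ) : Smooth (metricLaplacian f φ) :=
  ContDiff.sum fun i _ => ContDiff.sum fun j _ =>
    (smooth_inverse hf i j).mul ((hφ.dirDeriv _).dirDeriv _)

lemma smooth_normalProjection {f : (Fin n → ℝ) → (Fin m → ℝ)} (hf : ContDiff ℝ (⊤ : ℕ∞) f)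
    (k l : Fin n ⊕ Fin m) : Smooth fun y => normalProjection f y k l :=
  contDiff_const.sub (ContDiff.sum fun i _ => ContDiff.sum fun j _ =>
    ((smooth_inverse hf i j).mul ((smooth_graphComp hf k).dirDeriv _)).mul
      ((smooth_graphComp hf l).dirDeriv _))

lemma smooth_meanCurvature {f : (Fin n → ℝ) → (Fin m → ℝ)} (hf : ContDiff ℝ (⊤ : ℕ∞) f)
    (k : Fin n ⊕ Fin m) : Smooth fun y => meanCurvature f y k := by
  simp only [meanCurvature_eq, Matrix.mulVec, dotProduct]
  exact ContDiff.sum fun l _ => (smooth_normalProjection hf k l).mul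
    (smooth_metricLaplacian hf (smooth_graphComp hf l))

/-- The directional derivative of the mean curvature vector. -/
def meanCurvatureDeriv (f : (Fin n → ℝ) → (Fin m → ℝ)) (v x : Fin n → ℝ) : Fin n ⊕ Fin m → ℝ :=
  fun l => dirDeriv v (fun y => meanCurvature f y l) x

lemma HasParallelMeanCurvature.eq_tangential {f : (Fin n → ℝ) → (Fin m → ℝ)}
    (hp : HasParallelMeanCurvature f) (v x : Fin n → ℝ) :
    meanCurvatureDeriv f v x = graphJacobian f x *ᵥ ((graphMetric f x)⁻¹ *ᵥ
      ((graphJacobian f x)ᵀ *ᵥ meanCurvatureDeriv f v x)) :=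
  eq_of_normalProjection_eq_zero (funext fun k => hp x v k)

lemma HasParallelMeanCurvature.exists_norm_sq_eq {f : (Fin n → ℝ) → (Fin m → ℝ)}
    (hf : ContDiff ℝ (⊤ : ℕ∞) f) (hp : HasParallelMeanCurvature f) :
    ∃ c, ∀ x, meanCurvature f x ⬝ᵥ meanCurvature f x = c := by
  have hs : Smooth fun y => meanCurvature f y ⬝ᵥ meanCurvature f y :=
    ContDiff.sum fun k _ => (smooth_meanCurvature hf k).mul (smooth_meanCurvature hf k)
  refine ⟨meanCurvature f 0 ⬝ᵥ meanCurvature f 0, fun x => ?_⟩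
  refine is_const_of_fderiv_eq_zero hs.differentiable (fun y => ?_) x 0
  ext v
  change dirDeriv v (fun y => ∑ k, meanCurvature f y k * meanCurvature f y k) y = 0
  rw [dirDeriv_sum _ fun k _ => (smooth_meanCurvature hf k).differentiableAt.fun_mul
    (smooth_meanCurvature hf k).differentiableAt]
  have h1 : meanCurvature f y ⬝ᵥ meanCurvatureDeriv f v y = 0 := by
    rw [hp.eq_tangential]
    exact meanCurvature_dotProduct_jacobian f y _
  calc _ = 2 * (meanCurvature f y ⬝ᵥ meanCurvatureDeriv f v y) := by
        rw [dotProduct, Finset.mul_sum]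
        refine Finset.sum_congr rfl fun k _ => ?_
        rw [dirDeriv_mul _ (smooth_meanCurvature hf k).differentiableAt
          (smooth_meanCurvature hf k).differentiableAt]
        simp only [meanCurvatureDeriv]; ring
    _ = 0 := by rw [h1, mul_zero]

lemma jacobian_transpose_mulVec_meanCurvatureDeriv {f : (Fin n → ℝ) → (Fin m → ℝ)}
    (hf : ContDiff ℝ (⊤ : ℕ∞) f) (v x : Fin n → ℝ) (j : Fin n) :
    ((graphJacobian f x)ᵀ *ᵥ meanCurvatureDeriv f v x) j =
      - ∑ k, dirDeriv v (dirDeriv (basisVec j) (graphComp f k)) x * meanCurvature f x k := by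
  have h0 : dirDeriv v (fun y => ∑ k, dirDeriv (basisVec j) (graphComp f k) y *
      meanCurvature f y k) x = 0 := by
    have : (fun y => ∑ k, dirDeriv (basisVec j) (graphComp f k) y * meanCurvature f y k) =
        fun _ => 0 := by
      funext y; exact congrFun (transpose_mulVec_meanCurvature f y) j
    rw [this, dirDeriv_const]
  rw [dirDeriv_sum _ fun k _ => ((smooth_graphComp hf k).dirDeriv _).differentiableAt.fun_mul
    (smooth_meanCurvature hf k).differentiableAt] at h0
  rw [eq_neg_iff_add_eq_zero, ← h0, Matrix.mulVec, dotProduct, ← Finset.sum_add_distrib]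
  refine Finset.sum_congr rfl fun k _ => ?_
  rw [dirDeriv_mul _ ((smooth_graphComp hf k).dirDeriv _).differentiableAt
    (smooth_meanCurvature hf k).differentiableAt]
  simp only [Matrix.transpose_apply, graphJacobian, Matrix.of_apply, meanCurvatureDeriv]
  ring

lemma jacobian_mulVec_inl (f : (Fin n → ℝ) → (Fin m → ℝ)) (x w : Fin n → ℝ) (a : Fin n) :
    (graphJacobian f x *ᵥ w) (Sum.inl a) = w a := by
  simp [Matrix.mulVec, dotProduct, graphJacobian, dirDeriv_graphComp_inl, Pi.single_apply]

lemma HasParallelMeanCurvature.divergence {f : (Fin n → ℝ) → (Fin m → ℝ)}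
    (hf : ContDiff ℝ (⊤ : ℕ∞) f) (hp : HasParallelMeanCurvature f) (x : Fin n → ℝ) :
    ∑ a, dirDeriv (basisVec a) (fun y => meanCurvature f y (Sum.inl a)) x =
      - (meanCurvature f x ⬝ᵥ meanCurvature f x) := by
  have h1 : ∀ a, dirDeriv (basisVec a) (fun y => meanCurvature f y (Sum.inl a)) x =
      - ∑ j, ∑ k, (graphMetric f x)⁻¹ a j *
        (dirDeriv (basisVec a) (dirDeriv (basisVec j) (graphComp f k)) x
          * meanCurvature f x k) := by
    intro a
    have := congrFun (hp.eq_tangential (basisVec a) x) (Sum.inl a)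
    rw [jacobian_mulVec_inl] at this
    refine this.trans ?_
    rw [Matrix.mulVec, dotProduct, ← Finset.sum_neg_distrib]
    refine Finset.sum_congr rfl fun j _ => ?_
    rw [jacobian_transpose_mulVec_meanCurvatureDeriv hf, ← Finset.mul_sum]
    ring
  simp only [h1]
  rw [meanCurvature_dotProduct_self, dotProduct, Finset.sum_neg_distrib, neg_inj]
  simp only [metricLaplacian, Finset.mul_sum]
  conv_rhs => rw [Finset.sum_comm]
  refine Finset.sum_congr rfl fun a _ => ?_
  rw [Finset.sum_comm]
  refine Finset.sum_congr rfl fun k _ => Finset.sum_congr rfl fun j _ => by ring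

/-- An entire graph with parallel mean curvature is minimal. -/
theorem HasParallelMeanCurvature.meanCurvature_eq_zero {f : (Fin n → ℝ) → (Fin m → ℝ)}
    (hf : ContDiff ℝ (⊤ : ℕ∞) f) (hp : HasParallelMeanCurvature f) (x : Fin n → ℝ) :
    meanCurvature f x = 0 := by
  obtain ⟨c, hc⟩ := hp.exists_norm_sq_eq hf
  have hb : ∀ a y, |meanCurvature f y (Sum.inl a)| ≤ √c := by
    intro a y
    refine Real.le_sqrt_of_sq_le ?_
    rw [sq_abs, ← hc y, dotProduct, sq]
    exact Finset.single_le_sum (f := fun k => meanCurvature f y k * meanCurvature f y k)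
      (fun k _ => mul_self_nonneg _) (Finset.mem_univ _)
  have h := divergence_eq_zero_of_bounded (fun a => smooth_meanCurvature hf (Sum.inl a)) hb
    (c := -c) (fun y => by rw [hp.divergence hf, hc])
  refine dotProduct_self_eq_zero.1 ?_
  rw [hc]; linarith

lemma minimalSystem_of_meanCurvature_eq_zero {f : (Fin n → ℝ) → (Fin m → ℝ)}
    (h : ∀ x, meanCurvature f x = 0) : MinimalSystem f := by
  intro α x
  have h1 := eq_of_normalProjection_eq_zero (f := f) (x := x)
    (W := fun k => metricLaplacian f (graphComp f k) x) (by rw [← meanCurvature_eq, h])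
  obtain ⟨w, hw⟩ : ∃ w, w = (graphMetric f x)⁻¹ *ᵥ ((graphJacobian f x)ᵀ *ᵥ
    fun k => metricLaplacian f (graphComp f k) x) := ⟨_, rfl⟩
  rw [← hw] at h1
  have h2 : w = 0 := by
    funext a
    have := congrFun h1 (Sum.inl a)
    rw [jacobian_mulVec_inl, metricLaplacian_coord] at this
    exact this.symm
  have := congrFun h1 (Sum.inr α)
  rw [h2, Matrix.mulVec_zero] at this
  exact this

end MeanCurvature

section DivergenceForm

variable {n m : ℕ}

/-- Christoffel symbols of the first kind of the graph metric. -/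
def christoffel (f : (Fin n → ℝ) → (Fin m → ℝ)) (x : Fin n → ℝ) (i k l : Fin n) : ℝ :=
  ∑ c, dirDeriv (basisVec i) (dirDeriv (basisVec k) (graphComp f c)) x *
    dirDeriv (basisVec l) (graphComp f c) x

lemma christoffel_comm {f : (Fin n → ℝ) → (Fin m → ℝ)} (hf : ContDiff ℝ (⊤ : ℕ∞) f)
    (x : Fin n → ℝ) (i k l : Fin n) : christoffel f x i k l = christoffel f x k i l := by
  simp only [christoffel, dirDeriv_comm (smooth_graphComp hf _) (basisVec i) (basisVec k)]

lemma matDeriv_graphMetric {f : (Fin n → ℝ) → (Fin m → ℝ)} (hf : ContDiff ℝ (⊤ : ℕ∞) f)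
    (x : Fin n → ℝ) (i k l : Fin n) : matDeriv (basisVec i) (graphMetric f) x k l =
      christoffel f x i k l + christoffel f x i l k := by
  have hs := fun c j => (smooth_graphComp hf c).dirDeriv (basisVec j)
  simp only [matDeriv, Matrix.of_apply, graphMetric_eq, christoffel]
  rw [dirDeriv_sum _ fun c _ => (hs c k).differentiableAt.fun_mul (hs c l).differentiableAt,
    ← Finset.sum_add_distrib]
  refine Finset.sum_congr rfl fun c _ => ?_
  rw [dirDeriv_mul _ (hs c k).differentiableAt (hs c l).differentiableAt]
  ring

/-- The traced Christoffel symbol, i.e. the logarithmic derivative of the slope function. -/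
def christoffelTrace (f : (Fin n → ℝ) → (Fin m → ℝ)) (x : Fin n → ℝ) (i : Fin n) : ℝ :=
  ∑ k, ∑ l, (graphMetric f x)⁻¹ k l * christoffel f x i k l

lemma dirDeriv_slopeFunction {f : (Fin n → ℝ) → (Fin m → ℝ)} (hf : ContDiff ℝ (⊤ : ℕ∞) f)
    (x : Fin n → ℝ) (i : Fin n) : dirDeriv (basisVec i) (slopeFunction f) x =
      slopeFunction f x * christoffelTrace f x i := by
  have hd := det_ne_zero f x
  have h1 : dirDeriv (basisVec i) (slopeFunction f) x = 1 / (2 * √(graphMetric f x).det) *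
      dirDeriv (basisVec i) (fun y => (graphMetric f y).det) x :=
    dirDeriv_comp _ (Real.hasDerivAt_sqrt hd) (smooth_det (smooth_graphMetric hf)).differentiableAt
  have h2 : (graphMetric f x).adjugate = (graphMetric f x).det • (graphMetric f x)⁻¹ := by
    rw [Matrix.inv_def, Ring.inverse_eq_inv', smul_smul, mul_inv_cancel₀ hd, one_smul]
  have h3 : ((graphMetric f x)⁻¹ * matDeriv (basisVec i) (graphMetric f) x).trace =
      2 * christoffelTrace f x i := by
    simp only [Matrix.trace, Matrix.diag_apply, Matrix.mul_apply, matDeriv_graphMetric hf,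
      mul_add, Finset.sum_add_distrib]
    have : ∑ k, ∑ l, (graphMetric f x)⁻¹ k l * christoffel f x i l k = christoffelTrace f x i := by
      rw [Finset.sum_comm]
      exact Finset.sum_congr rfl fun k _ => Finset.sum_congr rfl fun l _ => by
        rw [inverse_transpose]
    rw [this, christoffelTrace]
    ring
  rw [h1, dirDeriv_det (fun i j => (smooth_graphMetric hf i j).differentiableAt), h2,
    Matrix.smul_mul, Matrix.trace_smul, h3, ← slopeFunction_sq, smul_eq_mul]
  have : √(graphMetric f x).det = slopeFunction f x := rfl
  rw [slopeFunction_sq, this, ← slopeFunction_sq]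
  have := one_le_slopeFunction f x
  field_simp

lemma sum_dirDeriv_slope_mul_inverse {f : (Fin n → ℝ) → (Fin m → ℝ)} (hf : ContDiff ℝ (⊤ : ℕ∞) f)
    (hmin : MinimalSystem f) (x : Fin n → ℝ) (j : Fin n) :
    ∑ i, dirDeriv (basisVec i) (fun y => slopeFunction f y * (graphMetric f y)⁻¹ i j) x = 0 := by
  have h1 : ∀ i, dirDeriv (basisVec i) (fun y => slopeFunction f y * (graphMetric f y)⁻¹ i j) x =
      slopeFunction f x * (christoffelTrace f x i * (graphMetric f x)⁻¹ i j) -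
      slopeFunction f x * (∑ l, (∑ k, (graphMetric f x)⁻¹ i k *
        (christoffel f x i k l)) * (graphMetric f x)⁻¹ l j) -
      slopeFunction f x * (∑ l, (∑ k, (graphMetric f x)⁻¹ i k *
        (christoffel f x i l k)) * (graphMetric f x)⁻¹ l j) := by
    intro i
    have h2 := congrFun (congrFun (matDeriv_inv (smooth_graphMetric hf) (det_ne_zero f)
      (basisVec i) x) i) j
    rw [dirDeriv_mul _ (smooth_slope hf).differentiableAt (smooth_inverse hf i j).differentiableAt,
      dirDeriv_slopeFunction hf]
    change _ + _ * matDeriv (basisVec i) (fun y => (graphMetric f y)⁻¹) x i j = _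
    rw [h2]
    simp only [Matrix.neg_apply, Matrix.mul_apply, matDeriv_graphMetric hf, mul_add,
      Finset.sum_add_distrib, add_mul]
    ring
  simp only [h1]
  rw [Finset.sum_sub_distrib, Finset.sum_sub_distrib, ← Finset.mul_sum, ← Finset.mul_sum,
    ← Finset.mul_sum]
  have h3 : ∑ i, ∑ l, (∑ k, (graphMetric f x)⁻¹ i k * (christoffel f x i k l)) *
      (graphMetric f x)⁻¹ l j = 0 := by
    rw [Finset.sum_comm]
    refine Finset.sum_eq_zero fun l _ => ?_
    rw [← Finset.sum_mul]
    refine mul_eq_zero_of_left ?_ _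
    simp only [christoffel, Finset.mul_sum]
    have : ∀ i, ∑ k, ∑ c, (graphMetric f x)⁻¹ i k *
        (dirDeriv (basisVec i) (dirDeriv (basisVec k) (graphComp f c)) x *
          dirDeriv (basisVec l) (graphComp f c) x) = ∑ c, ∑ k, (graphMetric f x)⁻¹ i k *
        (dirDeriv (basisVec i) (dirDeriv (basisVec k) (graphComp f c)) x *
          dirDeriv (basisVec l) (graphComp f c) x) := fun i => Finset.sum_comm
    simp only [this]
    rw [Finset.sum_comm]
    refine Finset.sum_eq_zero fun c _ => ?_
    have h4 := hmin.graphComp c x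
    simp only [← mul_assoc, ← Finset.sum_mul]
    exact mul_eq_zero_of_left h4 _
  have h5 : ∑ i, ∑ l, (∑ k, (graphMetric f x)⁻¹ i k * (christoffel f x i l k)) *
      (graphMetric f x)⁻¹ l j = ∑ i, christoffelTrace f x i * (graphMetric f x)⁻¹ i j := by
    rw [Finset.sum_comm]
    refine Finset.sum_congr rfl fun l _ => ?_
    rw [← Finset.sum_mul, christoffelTrace]
    congr 1
    exact Finset.sum_congr rfl fun i _ => Finset.sum_congr rfl fun k _ => by
      rw [christoffel_comm hf x i l k]
  rw [h3, h5]
  ring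

/-- The inner product of gradients with respect to the graph metric. -/
def gradInner (f : (Fin n → ℝ) → (Fin m → ℝ)) (a b : (Fin n → ℝ) → ℝ) (x : Fin n → ℝ) : ℝ :=
  ∑ i, ∑ j, (graphMetric f x)⁻¹ i j * (dirDeriv (basisVec i) a x * dirDeriv (basisVec j) b x)

lemma gradInner_comm (f : (Fin n → ℝ) → (Fin m → ℝ)) (a b : (Fin n → ℝ) → ℝ) (x : Fin n → ℝ) :
    gradInner f a b x = gradInner f b a x := by
  rw [gradInner, Finset.sum_comm]
  exact Finset.sum_congr rfl fun i _ => Finset.sum_congr rfl fun j _ => by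
    rw [inverse_transpose]; ring

/-- The flux of `b` in the `i`-th coordinate direction. -/
def graphFlux (f : (Fin n → ℝ) → (Fin m → ℝ)) (b : (Fin n → ℝ) → ℝ) (i : Fin n)
    (x : Fin n → ℝ) : ℝ :=
  ∑ j, slopeFunction f x * (graphMetric f x)⁻¹ i j * dirDeriv (basisVec j) b x

lemma smooth_graphFlux {f : (Fin n → ℝ) → (Fin m → ℝ)} (hf : ContDiff ℝ (⊤ : ℕ∞) f)
    {b : (Fin n → ℝ) → ℝ} (hb : Smooth b) (i : Fin n) : Smooth (graphFlux f b i) :=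
  ContDiff.sum fun j _ => ((smooth_slope hf).mul (smooth_inverse hf i j)).mul (hb.dirDeriv _)

lemma sum_dirDeriv_graphFlux {f : (Fin n → ℝ) → (Fin m → ℝ)} (hf : ContDiff ℝ (⊤ : ℕ∞) f)
    (hmin : MinimalSystem f) {b : (Fin n → ℝ) → ℝ} (hb : Smooth b) (x : Fin n → ℝ) :
    ∑ i, dirDeriv (basisVec i) (graphFlux f b i) x =
      slopeFunction f x * metricLaplacian f b x := by
  have hsq : ∀ i j, Smooth fun y => slopeFunction f y * (graphMetric f y)⁻¹ i j :=
    fun i j => (smooth_slope hf).mul (smooth_inverse hf i j)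
  have h1 : ∀ i, dirDeriv (basisVec i) (graphFlux f b i) x =
      ∑ j, (dirDeriv (basisVec i) (fun y => slopeFunction f y * (graphMetric f y)⁻¹ i j) x *
        dirDeriv (basisVec j) b x + slopeFunction f x * ((graphMetric f x)⁻¹ i j *
        dirDeriv (basisVec i) (dirDeriv (basisVec j) b) x)) := by
    intro i
    unfold graphFlux
    rw [dirDeriv_sum _ fun j _ => ((hsq i j).differentiableAt.fun_mul
      (hb.dirDeriv _).differentiableAt)]
    refine Finset.sum_congr rfl fun j _ => ?_
    rw [dirDeriv_mul _ (hsq i j).differentiableAt (hb.dirDeriv _).differentiableAt]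
    simp only [mul_assoc]
  simp only [h1, Finset.sum_add_distrib]
  rw [Finset.sum_comm]
  simp only [← Finset.sum_mul, sum_dirDeriv_slope_mul_inverse hf hmin, zero_mul,
    Finset.sum_const_zero, zero_add]
  simp only [metricLaplacian, ← Finset.mul_sum]

lemma integral_slope_mul_laplacian {f : (Fin n → ℝ) → (Fin m → ℝ)} (hf : ContDiff ℝ (⊤ : ℕ∞) f)
    (hmin : MinimalSystem f) {a b : (Fin n → ℝ) → ℝ} (ha : Smooth a) (hb : Smooth b)
    (hc : HasCompactSupport a) :
    ∫ x, slopeFunction f x * (a x * metricLaplacian f b x) =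
      - ∫ x, slopeFunction f x * gradInner f a b x := by
  have h1 : ∀ x, slopeFunction f x * gradInner f a b x =
      ∑ i, graphFlux f b i x * dirDeriv (basisVec i) a x := by
    intro x
    simp only [gradInner, graphFlux, Finset.mul_sum, Finset.sum_mul]
    exact Finset.sum_congr rfl fun i _ => Finset.sum_congr rfl fun j _ => by ring
  have h2 : ∀ x, slopeFunction f x * (a x * metricLaplacian f b x) =
      ∑ i, dirDeriv (basisVec i) (graphFlux f b i) x * a x := by
    intro x
    rw [← Finset.sum_mul, sum_dirDeriv_graphFlux hf hmin hb]; ring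
  simp only [h1, h2]
  rw [integral_finsetSum, integral_finsetSum, ← Finset.sum_neg_distrib]
  · refine Finset.sum_congr rfl fun i _ => ?_
    rw [integral_mul_dirDeriv (smooth_graphFlux hf hb i) ha hc, neg_neg]
  · exact fun i _ => ((smooth_graphFlux hf hb i).continuous.mul
      (ha.dirDeriv _).continuous).integrable_of_hasCompactSupport
      (hasCompactSupport_dirDeriv hc _).mul_left
  · exact fun i _ => (((smooth_graphFlux hf hb i).dirDeriv _).continuous.mul
      ha.continuous).integrable_of_hasCompactSupport hc.mul_left

lemma integral_slope_mul_laplacian' {f : (Fin n → ℝ) → (Fin m → ℝ)} (hf : ContDiff ℝ (⊤ : ℕ∞) f)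
    (hmin : MinimalSystem f) {a b : (Fin n → ℝ) → ℝ} (ha : Smooth a) (hb : Smooth b)
    (hc : HasCompactSupport b) :
    ∫ x, slopeFunction f x * (a x * metricLaplacian f b x) =
      - ∫ x, slopeFunction f x * gradInner f a b x := by
  have h1 : ∀ x, slopeFunction f x * gradInner f a b x =
      ∑ i, graphFlux f b i x * dirDeriv (basisVec i) a x := by
    intro x
    simp only [gradInner, graphFlux, Finset.mul_sum, Finset.sum_mul]
    exact Finset.sum_congr rfl fun i _ => Finset.sum_congr rfl fun j _ => by ring
  have h2 : ∀ x, slopeFunction f x * (a x * metricLaplacian f b x) =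
      ∑ i, a x * dirDeriv (basisVec i) (graphFlux f b i) x := by
    intro x
    rw [← Finset.mul_sum, sum_dirDeriv_graphFlux hf hmin hb]; ring
  have hfc : ∀ i, HasCompactSupport (graphFlux f b i) := by
    intro i
    refine HasCompactSupport.intro hc.isCompact (fun x hx => ?_)
    refine Finset.sum_eq_zero fun j _ => ?_
    have : dirDeriv (basisVec j) b x = 0 := by
      have h0 : fderiv ℝ b x = 0 := image_eq_zero_of_notMem_tsupport
        (fun h => hx (tsupport_fderiv_subset ℝ h))
      simp [dirDeriv, h0]
    rw [this, mul_zero]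
  simp only [h1, h2]
  rw [integral_finsetSum, integral_finsetSum, ← Finset.sum_neg_distrib]
  · refine Finset.sum_congr rfl fun i _ => ?_
    rw [integral_mul_dirDeriv ha (smooth_graphFlux hf hb i) (hfc i)]
    simp only [mul_comm]
  · exact fun i _ => ((smooth_graphFlux hf hb i).continuous.mul
      (ha.dirDeriv _).continuous).integrable_of_hasCompactSupport (hfc i).mul_right
  · exact fun i _ => (ha.continuous.mul
      ((smooth_graphFlux hf hb i).dirDeriv _).continuous).integrable_of_hasCompactSupport
      (hasCompactSupport_dirDeriv (hfc i) _).mul_left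

/-- Green's second identity for the graph metric. -/
lemma integral_slope_mul_laplacian_comm {f : (Fin n → ℝ) → (Fin m → ℝ)}
    (hf : ContDiff ℝ (⊤ : ℕ∞) f) (hmin : MinimalSystem f) {u φ : (Fin n → ℝ) → ℝ} (hu : Smooth u)
    (hφ : Smooth φ) (hc : HasCompactSupport φ) :
    ∫ x, slopeFunction f x * (u x * metricLaplacian f φ x) =
      ∫ x, slopeFunction f x * (φ x * metricLaplacian f u x) := by
  rw [integral_slope_mul_laplacian' hf hmin hu hφ hc, integral_slope_mul_laplacian hf hmin hφ hu hc]
  simp only [gradInner_comm f u φ]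

end DivergenceForm

section Cutoff

/-- A smooth convex function on the line which is positive and decreasing exactly on `(-∞, 1)`. -/
def convexCutoff (t : ℝ) : ℝ := (1 - t) * expNegInvGlue (1 - t)

/-- Minus the derivative of `convexCutoff`. -/
def convexCutoffSlope (t : ℝ) : ℝ := (1 + (1 - t)⁻¹) * expNegInvGlue (1 - t)

/-- The second derivative of `convexCutoff`. -/
def convexCutoffCurv (t : ℝ) : ℝ := (1 - t)⁻¹ ^ 3 * expNegInvGlue (1 - t)

lemma hasDerivAt_convexCutoff (t : ℝ) : HasDerivAt convexCutoff (-convexCutoffSlope t) t := by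
  have h1 := expNegInvGlue.hasDerivAt_polynomial_eval_inv_mul 1 (1 - t)
  simp only [Polynomial.eval_one, one_mul, Polynomial.derivative_one, sub_zero, mul_one,
    Polynomial.eval_pow, Polynomial.eval_X] at h1
  have h2 : HasDerivAt (fun s : ℝ => 1 - s) (-1) t := by
    simpa using (hasDerivAt_id t).const_sub 1
  have h3 := h2.mul (h1.comp t h2)
  refine h3.congr_deriv ?_
  simp only [convexCutoffSlope, Function.comp]
  by_cases h : 1 - t = 0
  · simp [h]
  · field_simp
    ring

lemma hasDerivAt_convexCutoffSlope (t : ℝ) :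
    HasDerivAt convexCutoffSlope (-convexCutoffCurv t) t := by
  have h1 := expNegInvGlue.hasDerivAt_polynomial_eval_inv_mul (1 + Polynomial.X) (1 - t)
  simp only [Polynomial.eval_add, Polynomial.eval_one, Polynomial.derivative_add,
    Polynomial.derivative_one, Polynomial.derivative_X, zero_add, Polynomial.eval_mul,
    Polynomial.eval_sub, Polynomial.eval_pow, Polynomial.eval_X] at h1
  have h2 : HasDerivAt (fun s : ℝ => 1 - s) (-1) t := by
    simpa using (hasDerivAt_id t).const_sub 1
  have h3 := h1.comp t h2
  refine h3.congr_deriv ?_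
  simp only [convexCutoffCurv]
  ring

lemma smooth_convexCutoff : Smooth convexCutoff :=
  (contDiff_const.sub contDiff_id).mul
    (expNegInvGlue.contDiff.comp (contDiff_const.sub contDiff_id))

lemma continuous_convexCutoffSlope : Continuous convexCutoffSlope :=
  continuous_iff_continuousAt.2 fun t => (hasDerivAt_convexCutoffSlope t).continuousAt

lemma continuous_convexCutoffCurv : Continuous convexCutoffCurv := by
  have h := expNegInvGlue.continuous_polynomial_eval_inv_mul (Polynomial.X ^ 3)
  simp only [Polynomial.eval_pow, Polynomial.eval_X] at h
  exact h.comp (continuous_const.sub continuous_id)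

lemma convexCutoff_nonneg (t : ℝ) : 0 ≤ convexCutoff t := by
  rcases le_total 1 t with h | h
  · simp [convexCutoff, expNegInvGlue.zero_of_nonpos (sub_nonpos.2 h)]
  · exact mul_nonneg (sub_nonneg.2 h) (expNegInvGlue.nonneg _)

lemma convexCutoffSlope_nonneg (t : ℝ) : 0 ≤ convexCutoffSlope t := by
  rcases le_total 1 t with h | h
  · simp [convexCutoffSlope, expNegInvGlue.zero_of_nonpos (sub_nonpos.2 h)]
  · exact mul_nonneg (add_nonneg zero_le_one (inv_nonneg.2 (sub_nonneg.2 h)))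
      (expNegInvGlue.nonneg _)

lemma convexCutoffCurv_nonneg (t : ℝ) : 0 ≤ convexCutoffCurv t := by
  rcases le_total 1 t with h | h
  · simp [convexCutoffCurv, expNegInvGlue.zero_of_nonpos (sub_nonpos.2 h)]
  · exact mul_nonneg (pow_nonneg (inv_nonneg.2 (sub_nonneg.2 h)) _) (expNegInvGlue.nonneg _)

lemma convexCutoff_pos {t : ℝ} (h : t < 1) : 0 < convexCutoff t :=
  mul_pos (sub_pos.2 h) (expNegInvGlue.pos_of_pos (sub_pos.2 h))

lemma convexCutoffCurv_pos {t : ℝ} (h : t < 1) : 0 < convexCutoffCurv t :=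
  mul_pos (pow_pos (inv_pos.2 (sub_pos.2 h)) _) (expNegInvGlue.pos_of_pos (sub_pos.2 h))

lemma convexCutoff_eq_zero {t : ℝ} (h : 1 ≤ t) : convexCutoff t = 0 := by
  simp [convexCutoff, expNegInvGlue.zero_of_nonpos (sub_nonpos.2 h)]

lemma convexCutoffSlope_eq_zero {t : ℝ} (h : 1 ≤ t) : convexCutoffSlope t = 0 := by
  simp [convexCutoffSlope, expNegInvGlue.zero_of_nonpos (sub_nonpos.2 h)]

lemma convexCutoffCurv_eq_zero {t : ℝ} (h : 1 ≤ t) : convexCutoffCurv t = 0 := by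
  simp [convexCutoffCurv, expNegInvGlue.zero_of_nonpos (sub_nonpos.2 h)]

lemma antitone_convexCutoff : Antitone convexCutoff :=
  antitone_of_deriv_nonpos (fun t => (hasDerivAt_convexCutoff t).differentiableAt) fun t => by
    rw [(hasDerivAt_convexCutoff t).deriv]
    exact neg_nonpos.2 (convexCutoffSlope_nonneg t)

lemma antitone_convexCutoffSlope : Antitone convexCutoffSlope :=
  antitone_of_deriv_nonpos (fun t => (hasDerivAt_convexCutoffSlope t).differentiableAt) fun t => by
    rw [(hasDerivAt_convexCutoffSlope t).deriv]
    exact neg_nonpos.2 (convexCutoffCurv_nonneg t)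

end Cutoff

section ExtrinsicDistance

variable {n m : ℕ}

/-- The position vector of the graph, relative to the point over the origin. -/
def relPosition (f : (Fin n → ℝ) → (Fin m → ℝ)) (x : Fin n → ℝ) (k : Fin n ⊕ Fin m) : ℝ :=
  graphComp f k x - graphComp f k 0

/-- The squared extrinsic distance to the point of the graph over the origin. -/
def extDistSq (f : (Fin n → ℝ) → (Fin m → ℝ)) (x : Fin n → ℝ) : ℝ :=
  ∑ k, relPosition f x k ^ 2

/-- The squared length of the normal part of the position vector. -/
def normalDistSq (f : (Fin n → ℝ) → (Fin m → ℝ)) (x : Fin n → ℝ) : ℝ :=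
  ∑ k, (normalProjection f x *ᵥ relPosition f x) k ^ 2

lemma smooth_relPosition {f : (Fin n → ℝ) → (Fin m → ℝ)} (hf : ContDiff ℝ (⊤ : ℕ∞) f)
    (k : Fin n ⊕ Fin m) : Smooth fun x => relPosition f x k :=
  (smooth_graphComp hf k).sub contDiff_const

lemma smooth_extDistSq {f : (Fin n → ℝ) → (Fin m → ℝ)} (hf : ContDiff ℝ (⊤ : ℕ∞) f) :
    Smooth (extDistSq f) :=
  ContDiff.sum fun k _ => (smooth_relPosition hf k).pow 2

lemma smooth_normalDistSq {f : (Fin n → ℝ) → (Fin m → ℝ)} (hf : ContDiff ℝ (⊤ : ℕ∞) f) :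
    Smooth (normalDistSq f) := by
  unfold normalDistSq
  simp only [Matrix.mulVec, dotProduct]
  exact ContDiff.sum fun k _ => (ContDiff.sum fun l _ => (smooth_normalProjection hf k l).mul
    (smooth_relPosition hf l)).pow 2

lemma normalDistSq_nonneg (f : (Fin n → ℝ) → (Fin m → ℝ)) (x : Fin n → ℝ) :
    0 ≤ normalDistSq f x := Finset.sum_nonneg fun _ _ => sq_nonneg _

lemma sum_sq_le_extDistSq (f : (Fin n → ℝ) → (Fin m → ℝ)) (x : Fin n → ℝ) :
    ∑ i, x i ^ 2 ≤ extDistSq f x := by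
  rw [extDistSq, Fintype.sum_sum_type]
  have h : ∀ i, relPosition f x (Sum.inl i) = x i := fun i => by
    simp [relPosition, graphComp_inl]
  simp only [h]
  linarith [Finset.sum_nonneg fun (α : Fin m) (_ : α ∈ Finset.univ) =>
    sq_nonneg (relPosition f x (Sum.inr α))]

lemma norm_sq_le_extDistSq (f : (Fin n → ℝ) → (Fin m → ℝ)) (x : Fin n → ℝ) :
    ‖x‖ ^ 2 ≤ extDistSq f x := by
  refine le_trans ?_ (sum_sq_le_extDistSq f x)
  have h0 : 0 ≤ ∑ i, x i ^ 2 := Finset.sum_nonneg fun _ _ => sq_nonneg _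
  rw [← Real.sqrt_le_sqrt_iff h0, Real.sqrt_sq (norm_nonneg _)]
  refine (pi_norm_le_iff_of_nonneg (Real.sqrt_nonneg _)).2 fun i => ?_
  refine Real.abs_le_sqrt ?_
  exact Finset.single_le_sum (f := fun i => x i ^ 2) (fun _ _ => sq_nonneg _) (Finset.mem_univ i)

lemma extDistSq_nonneg (f : (Fin n → ℝ) → (Fin m → ℝ)) (x : Fin n → ℝ) : 0 ≤ extDistSq f x :=
  Finset.sum_nonneg fun _ _ => sq_nonneg _

lemma dirDeriv_extDistSq {f : (Fin n → ℝ) → (Fin m → ℝ)} (hf : ContDiff ℝ (⊤ : ℕ∞) f)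
    (v x : Fin n → ℝ) : dirDeriv v (extDistSq f) x =
      2 * ∑ k, relPosition f x k * dirDeriv v (graphComp f k) x := by
  have h : ∀ k, dirDeriv v (fun x => relPosition f x k) x = dirDeriv v (graphComp f k) x := by
    intro k
    have := dirDeriv_sub v (smooth_graphComp hf k).differentiableAt
      (differentiableAt_const (graphComp f k 0) (x := x))
    rw [dirDeriv_const, sub_zero] at this
    exact this
  have h2 : extDistSq f = fun x => ∑ k, relPosition f x k * relPosition f x k := by
    funext x; simp only [extDistSq, sq]
  rw [h2, dirDeriv_sum _ fun k _ => (smooth_relPosition hf k).differentiableAt.fun_mul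
    (smooth_relPosition hf k).differentiableAt, Finset.mul_sum]
  refine Finset.sum_congr rfl fun k _ => ?_
  rw [dirDeriv_mul _ (smooth_relPosition hf k).differentiableAt
    (smooth_relPosition hf k).differentiableAt, h]
  ring

lemma dirDeriv_dirDeriv_extDistSq {f : (Fin n → ℝ) → (Fin m → ℝ)} (hf : ContDiff ℝ (⊤ : ℕ∞) f)
    (v w x : Fin n → ℝ) : dirDeriv v (dirDeriv w (extDistSq f)) x =
      2 * ∑ k, (dirDeriv v (graphComp f k) x * dirDeriv w (graphComp f k) x +
        relPosition f x k * dirDeriv v (dirDeriv w (graphComp f k)) x) := by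
  have h : ∀ k, dirDeriv v (fun x => relPosition f x k) x = dirDeriv v (graphComp f k) x := by
    intro k
    have := dirDeriv_sub v (smooth_graphComp hf k).differentiableAt
      (differentiableAt_const (graphComp f k 0) (x := x))
    rw [dirDeriv_const, sub_zero] at this
    exact this
  have h1 : dirDeriv w (extDistSq f) = fun x =>
      2 * ∑ k, relPosition f x k * dirDeriv w (graphComp f k) x :=
    funext fun x => dirDeriv_extDistSq hf w x
  have hs : ∀ k, Smooth fun x => relPosition f x k * dirDeriv w (graphComp f k) x := fun k =>
    (smooth_relPosition hf k).mul ((smooth_graphComp hf k).dirDeriv w)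
  rw [h1, dirDeriv_const_mul _ (Smooth.differentiableAt (ContDiff.sum fun k _ => hs k)),
    dirDeriv_sum _ fun k _ => (hs k).differentiableAt]
  congr 1
  refine Finset.sum_congr rfl fun k _ => ?_
  rw [dirDeriv_mul _ (smooth_relPosition hf k).differentiableAt
    ((smooth_graphComp hf k).dirDeriv w).differentiableAt, h]

lemma metricLaplacian_extDistSq {f : (Fin n → ℝ) → (Fin m → ℝ)} (hf : ContDiff ℝ (⊤ : ℕ∞) f)
    (hmin : MinimalSystem f) (x : Fin n → ℝ) : metricLaplacian f (extDistSq f) x = 2 * n := by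
  have h1 : metricLaplacian f (extDistSq f) x =
      2 * (∑ i, ∑ j, (graphMetric f x)⁻¹ i j * graphMetric f x j i) +
      2 * ∑ k, relPosition f x k * metricLaplacian f (graphComp f k) x := by
    have h2 : ∑ k, relPosition f x k * metricLaplacian f (graphComp f k) x =
        ∑ i, ∑ j, ∑ k, (graphMetric f x)⁻¹ i j * (relPosition f x k *
          dirDeriv (basisVec i) (dirDeriv (basisVec j) (graphComp f k)) x) := by
      simp only [metricLaplacian, Finset.mul_sum]
      rw [Finset.sum_comm]
      refine Finset.sum_congr rfl fun i _ => ?_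
      rw [Finset.sum_comm]
      exact Finset.sum_congr rfl fun j _ => Finset.sum_congr rfl fun k _ => by ring
    rw [h2, ← mul_add, ← Finset.sum_add_distrib, metricLaplacian, Finset.mul_sum]
    refine Finset.sum_congr rfl fun i _ => ?_
    rw [← Finset.sum_add_distrib, Finset.mul_sum]
    refine Finset.sum_congr rfl fun j _ => ?_
    rw [dirDeriv_dirDeriv_extDistSq hf, Finset.sum_add_distrib, graphMetric_eq, ← Finset.mul_sum]
    simp only [mul_comm (dirDeriv (basisVec j) _ _)]
    ring
  rw [h1]
  simp only [sum_inverse_mul_metric, hmin.graphComp, mul_zero, Finset.sum_const_zero]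
  simp

lemma gradInner_extDistSq {f : (Fin n → ℝ) → (Fin m → ℝ)} (hf : ContDiff ℝ (⊤ : ℕ∞) f)
    (x : Fin n → ℝ) : gradInner f (extDistSq f) (extDistSq f) x =
      4 * (extDistSq f x - normalDistSq f x) := by
  obtain ⟨X, hX⟩ : ∃ X, X = relPosition f x := ⟨_, rfl⟩
  obtain ⟨w, hw⟩ : ∃ w, w = (graphJacobian f x)ᵀ *ᵥ X := ⟨_, rfl⟩
  have h1 : ∀ i, dirDeriv (basisVec i) (extDistSq f) x = 2 * w i := by
    intro i
    rw [dirDeriv_extDistSq hf, hw, hX]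
    simp [Matrix.mulVec, dotProduct, graphJacobian, mul_comm]
  have h2 : gradInner f (extDistSq f) (extDistSq f) x = 4 * (w ⬝ᵥ ((graphMetric f x)⁻¹ *ᵥ w)) := by
    simp only [gradInner, h1, dotProduct, Matrix.mulVec, Finset.mul_sum]
    exact Finset.sum_congr rfl fun i _ => Finset.sum_congr rfl fun j _ => by ring
  have h3 : normalProjection f x *ᵥ X =
      X - graphJacobian f x *ᵥ ((graphMetric f x)⁻¹ *ᵥ w) := by
    rw [normalProjection_eq, Matrix.sub_mulVec, Matrix.one_mulVec, hw, Matrix.mulVec_mulVec,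
      Matrix.mulVec_mulVec]
  have h4 : (normalProjection f x *ᵥ X) ⬝ᵥ
      (graphJacobian f x *ᵥ ((graphMetric f x)⁻¹ *ᵥ w)) = 0 := by
    rw [Matrix.dotProduct_mulVec, ← Matrix.mulVec_transpose, Matrix.mulVec_mulVec,
      transpose_mul_normalProjection, Matrix.zero_mulVec, zero_dotProduct]
  have h5 : X ⬝ᵥ (graphJacobian f x *ᵥ ((graphMetric f x)⁻¹ *ᵥ w)) =
      w ⬝ᵥ ((graphMetric f x)⁻¹ *ᵥ w) := by
    rw [Matrix.dotProduct_mulVec, ← Matrix.mulVec_transpose, ← hw]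
  have h6 : normalDistSq f x = (normalProjection f x *ᵥ X) ⬝ᵥ (normalProjection f x *ᵥ X) := by
    simp only [normalDistSq, dotProduct, sq, hX]
  have h7 : extDistSq f x = X ⬝ᵥ X := by
    simp only [extDistSq, dotProduct, sq, hX]
  have h8 : normalDistSq f x = X ⬝ᵥ X - w ⬝ᵥ ((graphMetric f x)⁻¹ *ᵥ w) := by
    rw [h6]
    conv_lhs => enter [2]; rw [h3]
    rw [dotProduct_sub, h4, sub_zero, h3, sub_dotProduct, ← h5,
      dotProduct_comm (graphJacobian f x *ᵥ _) X]
  rw [h2, h7, h8]; ring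

lemma metricLaplacian_comp {f : (Fin n → ℝ) → (Fin m → ℝ)} {ϱ : (Fin n → ℝ) → ℝ} (hϱ : Smooth ϱ)
    {h h' h'' : ℝ → ℝ} (hh : ∀ t, HasDerivAt h (h' t) t) (hh' : ∀ t, HasDerivAt h' (h'' t) t)
    (x : Fin n → ℝ) : metricLaplacian f (fun y => h (ϱ y)) x =
      h' (ϱ x) * metricLaplacian f ϱ x + h'' (ϱ x) * gradInner f ϱ ϱ x := by
  have h1 : ∀ v, dirDeriv v (fun y => h (ϱ y)) = fun y => h' (ϱ y) * dirDeriv v ϱ y := fun v =>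
    funext fun y => dirDeriv_comp v (hh _) hϱ.differentiableAt
  simp only [metricLaplacian, gradInner, Finset.mul_sum, ← Finset.sum_add_distrib]
  refine Finset.sum_congr rfl fun i _ => Finset.sum_congr rfl fun j _ => ?_
  have h2 : DifferentiableAt ℝ (fun y => h' (ϱ y)) x :=
    (hh' _).differentiableAt.comp x hϱ.differentiableAt
  rw [h1, dirDeriv_mul _ h2
    (hϱ.dirDeriv _).differentiableAt, dirDeriv_comp _ (hh' _) hϱ.differentiableAt]
  ring

end ExtrinsicDistance

section MonotonicityFormula

variable {n m : ℕ}

lemma integral_sub_of_combination {E : Type*} [MeasurableSpace E] {μ : Measure E} {A B C : E → ℝ}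
    (hA : Integrable A μ) (hB : Integrable B μ) (hC : Integrable C μ) {a b c : ℝ} :
    ∫ x, a * A x + b * B x - c * C x ∂μ = a * ∫ x, A x ∂μ + b * ∫ x, B x ∂μ - c * ∫ x, C x ∂μ := by
  have h := integral_sub ((hA.const_mul a).add (hB.const_mul b)) (hC.const_mul c)
  have h' := integral_add (hA.const_mul a) (hB.const_mul b)
  simp only [Pi.add_apply] at h
  rw [h, h', integral_const_mul, integral_const_mul, integral_const_mul]

lemma one_le_div_sq {ϱ r b : ℝ} (hr : 0 < r) (hb : r ≤ b) (h : b ^ 2 ≤ ϱ) : 1 ≤ ϱ / r ^ 2 := by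
  rw [le_div_iff₀ (by positivity), one_mul]
  exact (pow_le_pow_left₀ hr.le hb 2).trans h

lemma cutoff_comp_eq_zero {ϱ : (Fin n → ℝ) → ℝ} (hϱn : ∀ x, ‖x‖ ^ 2 ≤ ϱ x) {r b : ℝ}
    (hr : 0 < r) (hb : r ≤ b) {x : Fin n → ℝ} (hx : x ∉ Metric.closedBall 0 b) {h : ℝ → ℝ}
    (hh : ∀ t, 1 ≤ t → h t = 0) : h (ϱ x / r ^ 2) = 0 := by
  apply hh
  rw [mem_closedBall_zero_iff, not_le] at hx
  exact one_le_div_sq hr hb ((pow_le_pow_left₀ (hr.le.trans hb) hx.le 2).trans (hϱn x))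

lemma hasCompactSupport_cutoff_comp {ϱ : (Fin n → ℝ) → ℝ} (hϱn : ∀ x, ‖x‖ ^ 2 ≤ ϱ x) {r : ℝ}
    (hr : 0 < r) {h : ℝ → ℝ} (hh : ∀ t, 1 ≤ t → h t = 0) :
    HasCompactSupport fun x => h (ϱ x / r ^ 2) :=
  HasCompactSupport.intro (isCompact_closedBall 0 r) fun _ hx =>
    cutoff_comp_eq_zero hϱn hr le_rfl hx hh

lemma integrable_mul_cutoff_comp {w ϱ : (Fin n → ℝ) → ℝ} (hw : Continuous w) (hϱ : Continuous ϱ)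
    (hϱn : ∀ x, ‖x‖ ^ 2 ≤ ϱ x) {r : ℝ} (hr : 0 < r) {h : ℝ → ℝ} (hc : Continuous h)
    (hh : ∀ t, 1 ≤ t → h t = 0) : Integrable fun x => w x * h (ϱ x / r ^ 2) :=
  (hw.mul (hc.comp (hϱ.div_const _))).integrable_of_hasCompactSupport
    (hasCompactSupport_cutoff_comp hϱn hr hh).mul_left

lemma hasDerivAt_integral_cutoff {w ϱ : (Fin n → ℝ) → ℝ} (hw : Continuous w) (hϱ : Continuous ϱ)
    (hϱn : ∀ x, ‖x‖ ^ 2 ≤ ϱ x) {R : ℝ} (hR : 0 < R) :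
    HasDerivAt (fun r => ∫ x, w x * convexCutoffSlope (ϱ x / r ^ 2))
      (∫ x, w x * (convexCutoffCurv (ϱ x / R ^ 2) * (2 * ϱ x / R ^ 3))) R := by
  have hball : ∀ r ∈ Metric.ball R (R / 2), 0 < r ∧ R / 2 ≤ r ∧ r ≤ 2 * R := by
    intro r hr
    rw [Metric.mem_ball, Real.dist_eq, abs_lt] at hr
    refine ⟨?_, ?_, ?_⟩ <;> linarith
  have hcont : ContinuousOn (fun p : ℝ × (Fin n → ℝ) =>
      w p.2 * (convexCutoffCurv (ϱ p.2 / p.1 ^ 2) * (2 * ϱ p.2 / p.1 ^ 3)))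
      (Set.Icc (R / 2) (2 * R) ×ˢ Metric.closedBall 0 (2 * R)) := by
    have hne : ∀ p ∈ Set.Icc (R / 2) (2 * R) ×ˢ Metric.closedBall (0 : Fin n → ℝ) (2 * R),
        p.1 ≠ 0 := fun p hp => by
      have := hp.1.1
      linarith [half_pos hR] |> fun h : 0 < p.1 => h.ne'
    have hϱ2 : ContinuousOn (fun p : ℝ × (Fin n → ℝ) => ϱ p.2)
        (Set.Icc (R / 2) (2 * R) ×ˢ Metric.closedBall 0 (2 * R)) :=
      (hϱ.comp continuous_snd).continuousOn
    refine (hw.comp continuous_snd).continuousOn.mul (ContinuousOn.mul ?_ ?_)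
    · exact continuous_convexCutoffCurv.comp_continuousOn
        (hϱ2.div (continuous_fst.pow 2).continuousOn fun p hp => pow_ne_zero _ (hne p hp))
    · exact (continuousOn_const.mul hϱ2).div (continuous_fst.pow 3).continuousOn
        fun p hp => pow_ne_zero _ (hne p hp)
  obtain ⟨C, hC⟩ := (isCompact_Icc.prod (isCompact_closedBall (0 : Fin n → ℝ)
    (2 * R))).exists_bound_of_continuousOn hcont
  refine (hasDerivAt_integral_of_dominated_loc_of_deriv_le
    (F := fun r x => w x * convexCutoffSlope (ϱ x / r ^ 2))
    (F' := fun r x => w x * (convexCutoffCurv (ϱ x / r ^ 2) * (2 * ϱ x / r ^ 3)))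
    (bound := Set.indicator (Metric.closedBall 0 (2 * R)) fun _ => C)
    (Metric.ball_mem_nhds R (half_pos hR)) ?_ ?_ ?_ ?_ ?_ ?_).2
  · exact Filter.Eventually.of_forall fun r => (hw.mul
      (continuous_convexCutoffSlope.comp (hϱ.div_const _))).aestronglyMeasurable
  · exact integrable_mul_cutoff_comp hw hϱ hϱn hR continuous_convexCutoffSlope
      fun t => convexCutoffSlope_eq_zero
  · exact (hw.mul ((continuous_convexCutoffCurv.comp (hϱ.div_const _)).mul
      ((continuous_const.mul hϱ).div_const _))).aestronglyMeasurable
  · refine Filter.Eventually.of_forall fun x r hr => ?_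
    obtain ⟨h0, h1, h2⟩ := hball r hr
    by_cases hx : x ∈ Metric.closedBall (0 : Fin n → ℝ) (2 * R)
    · rw [Set.indicator_of_mem hx]
      exact hC (r, x) ⟨⟨h1, h2⟩, hx⟩
    · rw [Set.indicator_of_notMem hx, cutoff_comp_eq_zero hϱn h0 h2 hx
        fun t => convexCutoffCurv_eq_zero]
      simp
  · exact (integrable_indicator_iff Metric.isClosed_closedBall.measurableSet).2
      (integrableOn_const (isCompact_closedBall _ _).measure_lt_top.ne)
  · refine Filter.Eventually.of_forall fun x r hr => ?_
    obtain ⟨h0, -, -⟩ := hball r hr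
    have h1 : HasDerivAt (fun r : ℝ => ϱ x / r ^ 2) (-(2 * ϱ x / r ^ 3)) r := by
      have := ((hasDerivAt_pow 2 r).inv (pow_ne_zero 2 h0.ne')).const_mul (ϱ x)
      refine this.congr_deriv ?_
      field_simp
      norm_num
      ring
    refine (((hasDerivAt_convexCutoffSlope _).comp r h1).const_mul (w x)).congr_deriv ?_
    ring

/-- The weighted area ratio of the graph in the extrinsic ball of radius `R`. -/
def areaRatio (f : (Fin n → ℝ) → (Fin m → ℝ)) (u : (Fin n → ℝ) → ℝ) (R : ℝ) : ℝ :=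
  (∫ x, slopeFunction f x * u x * convexCutoffSlope (extDistSq f x / R ^ 2)) / R ^ n

lemma integral_cutoff_identity {f : (Fin n → ℝ) → (Fin m → ℝ)} (hf : ContDiff ℝ (⊤ : ℕ∞) f)
    (hmin : MinimalSystem f) {u : (Fin n → ℝ) → ℝ} (hu : Smooth u) {R : ℝ} (hR : 0 < R) :
    R * (∫ x, slopeFunction f x * u x *
        (convexCutoffCurv (extDistSq f x / R ^ 2) * (2 * extDistSq f x / R ^ 3))) -
      n * (∫ x, slopeFunction f x * u x * convexCutoffSlope (extDistSq f x / R ^ 2)) =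
    R ^ 2 / 2 * (∫ x, slopeFunction f x * (convexCutoff (extDistSq f x / R ^ 2) *
        metricLaplacian f u x)) +
      2 / R ^ 2 * ∫ x, slopeFunction f x * u x * normalDistSq f x *
        convexCutoffCurv (extDistSq f x / R ^ 2) := by
  have hR2 : R ^ 2 ≠ 0 := pow_ne_zero _ hR.ne'
  have hη : ∀ t, HasDerivAt (fun t => convexCutoff (t / R ^ 2))
      (-convexCutoffSlope (t / R ^ 2) / R ^ 2) t := fun t =>
    ((hasDerivAt_convexCutoff _).comp t ((hasDerivAt_id' t).div_const (R ^ 2))).congr_deriv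
      (by ring)
  have hη' : ∀ t, HasDerivAt (fun t => -convexCutoffSlope (t / R ^ 2) / R ^ 2)
      (convexCutoffCurv (t / R ^ 2) / R ^ 4) t := fun t =>
    ((((hasDerivAt_convexCutoffSlope _).comp t
      ((hasDerivAt_id' t).div_const (R ^ 2))).neg).div_const (R ^ 2)).congr_deriv (by
        field_simp)
  have hL := metricLaplacian_comp (f := f) (smooth_extDistSq hf) hη hη'
  have hφ : Smooth fun x => convexCutoff (extDistSq f x / R ^ 2) :=
    ContDiff.comp smooth_convexCutoff ((smooth_extDistSq hf).div_const _)
  have hgreen := integral_slope_mul_laplacian_comm hf hmin hu hφ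
    (hasCompactSupport_cutoff_comp (norm_sq_le_extDistSq f) hR fun t => convexCutoff_eq_zero)
  have hsu : Continuous fun x => slopeFunction f x * u x :=
    (smooth_slope hf).continuous.mul hu.continuous
  have hϱ := (smooth_extDistSq hf).continuous
  have hϱn := norm_sq_le_extDistSq f
  have hi1 := integrable_mul_cutoff_comp hsu hϱ hϱn hR continuous_convexCutoffSlope
    fun t => convexCutoffSlope_eq_zero
  have hi2 : Integrable fun x => slopeFunction f x * u x * extDistSq f x *
      convexCutoffCurv (extDistSq f x / R ^ 2) :=
    integrable_mul_cutoff_comp (hsu.mul hϱ) hϱ hϱn hR continuous_convexCutoffCurv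
    fun t => convexCutoffCurv_eq_zero
  have hi3 : Integrable fun x => slopeFunction f x * u x * normalDistSq f x *
      convexCutoffCurv (extDistSq f x / R ^ 2) :=
    integrable_mul_cutoff_comp (hsu.mul (smooth_normalDistSq hf).continuous) hϱ hϱn hR
    continuous_convexCutoffCurv fun t => convexCutoffCurv_eq_zero
  have h1 : ∀ x, slopeFunction f x * (u x * metricLaplacian f
      (fun x => convexCutoff (extDistSq f x / R ^ 2)) x) =
      - (2 * n / R ^ 2) * (slopeFunction f x * u x * convexCutoffSlope (extDistSq f x / R ^ 2)) +
      4 / R ^ 4 * (slopeFunction f x * u x * extDistSq f x *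
        convexCutoffCurv (extDistSq f x / R ^ 2)) -
      4 / R ^ 4 * (slopeFunction f x * u x * normalDistSq f x *
        convexCutoffCurv (extDistSq f x / R ^ 2)) := by
    intro x
    rw [hL, metricLaplacian_extDistSq hf hmin, gradInner_extDistSq hf]
    field_simp
    ring
  simp only [h1] at hgreen
  rw [integral_sub_of_combination hi1 hi2 hi3] at hgreen
  have h2 : ∫ x, slopeFunction f x * u x *
        (convexCutoffCurv (extDistSq f x / R ^ 2) * (2 * extDistSq f x / R ^ 3)) =
      2 / R ^ 3 * ∫ x, slopeFunction f x * u x * extDistSq f x *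
        convexCutoffCurv (extDistSq f x / R ^ 2) := by
    rw [← integral_const_mul]
    exact integral_congr_ae (Filter.Eventually.of_forall fun x => by simp only; ring)
  rw [← hgreen, h2]
  field_simp
  ring

lemma quotient_rule_pow {R : ℝ} (hR : R ≠ 0) (a b : ℝ) (n : ℕ) :
    (a * R ^ n - b * (n * R ^ (n - 1))) / (R ^ n) ^ 2 = (R * a - n * b) / R ^ (n + 1) := by
  rcases n with _ | k
  · simp
    field_simp
  · simp only [Nat.add_sub_cancel]
    field_simp
    ring

lemma hasDerivAt_areaRatio {f : (Fin n → ℝ) → (Fin m → ℝ)} (hf : ContDiff ℝ (⊤ : ℕ∞) f)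
    (hmin : MinimalSystem f) {u : (Fin n → ℝ) → ℝ} (hu : Smooth u) {R : ℝ} (hR : 0 < R) :
    HasDerivAt (areaRatio f u) ((R ^ 2 / 2 * (∫ x, slopeFunction f x *
        (convexCutoff (extDistSq f x / R ^ 2) * metricLaplacian f u x)) +
      2 / R ^ 2 * ∫ x, slopeFunction f x * u x * normalDistSq f x *
        convexCutoffCurv (extDistSq f x / R ^ 2)) / R ^ (n + 1)) R := by
  rw [← integral_cutoff_identity hf hmin hu hR]
  have h1 : HasDerivAt (fun r => ∫ x, slopeFunction f x * u x *
      convexCutoffSlope (extDistSq f x / r ^ 2)) (∫ x, slopeFunction f x * u x *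
      (convexCutoffCurv (extDistSq f x / R ^ 2) * (2 * extDistSq f x / R ^ 3))) R :=
    hasDerivAt_integral_cutoff ((smooth_slope hf).continuous.mul hu.continuous)
      (smooth_extDistSq hf).continuous (norm_sq_le_extDistSq f) hR
  refine (h1.div (hasDerivAt_pow n R) (pow_ne_zero _ hR.ne')).congr_deriv ?_
  rw [quotient_rule_pow hR.ne']

end MonotonicityFormula

section EnergyDecay

variable {n m : ℕ}

lemma abs_le_norm_of_slope {f : (Fin n → ℝ) → (Fin m → ℝ)} {β : ℝ} {x : Fin n → ℝ}
    (h : slopeFunction f x ≤ β) (i : Fin n) (α : Fin m) :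
    |dirDeriv (basisVec i) (graphComp f (Sum.inr α)) x| ≤ β := by
  have hβ : 0 ≤ β := by linarith [one_le_slopeFunction f x]
  refine abs_le_of_sq_le_sq ?_ hβ
  refine le_trans ?_ (sum_sq_le_of_slope h)
  refine le_trans ?_ (Finset.single_le_sum (f := fun i => ∑ α,
    dirDeriv (basisVec i) (graphComp f (Sum.inr α)) x ^ 2)
    (fun i _ => Finset.sum_nonneg fun _ _ => sq_nonneg _) (Finset.mem_univ i))
  exact Finset.single_le_sum (f := fun α => dirDeriv (basisVec i) (graphComp f (Sum.inr α)) x ^ 2)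
    (fun _ _ => sq_nonneg _) (Finset.mem_univ α)

lemma abs_sub_le_of_slope {f : (Fin n → ℝ) → (Fin m → ℝ)} (hf : ContDiff ℝ (⊤ : ℕ∞) f) {β : ℝ}
    (h : ∀ x, slopeFunction f x ≤ β) (x : Fin n → ℝ) (α : Fin m) :
    |f x α - f 0 α| ≤ n * β * ‖x‖ := by
  have hβ : 0 ≤ β := by linarith [one_le_slopeFunction f 0, h 0]
  have h1 : ∀ y, ‖fderiv ℝ (graphComp f (Sum.inr α)) y‖ ≤ n * β := by
    intro y
    refine ContinuousLinearMap.opNorm_le_bound _ (by positivity) fun v => ?_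
    change ‖dirDeriv v (graphComp f (Sum.inr α)) y‖ ≤ _
    rw [dirDeriv_eq_sum]
    refine (norm_sum_le _ _).trans ?_
    calc ∑ i, ‖v i * dirDeriv (basisVec i) (graphComp f (Sum.inr α)) y‖
        ≤ ∑ _i : Fin n, ‖v‖ * β := Finset.sum_le_sum fun i _ => by
          rw [norm_mul]
          exact mul_le_mul (norm_le_pi_norm v i) (abs_le_norm_of_slope (h y) i α) (norm_nonneg _)
            (norm_nonneg _)
      _ = n * β * ‖v‖ := by simp; ring
  have := Convex.norm_image_sub_le_of_norm_fderiv_le (𝕜 := ℝ)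
    (fun y _ => (smooth_graphComp hf (Sum.inr α)).differentiableAt) (fun y _ => h1 y)
    convex_univ (Set.mem_univ 0) (Set.mem_univ x)
  simpa [graphComp_inr] using this

lemma exists_extDistSq_le {f : (Fin n → ℝ) → (Fin m → ℝ)} (hf : ContDiff ℝ (⊤ : ℕ∞) f) {β : ℝ}
    (h : ∀ x, slopeFunction f x ≤ β) :
    ∃ C : ℝ, 0 < C ∧ ∀ x, extDistSq f x ≤ C ^ 2 * ‖x‖ ^ 2 := by
  refine ⟨1 + n + m * (n * β) ^ 2, by positivity, fun x => ?_⟩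
  have h1 : extDistSq f x ≤ (n + m * (n * β) ^ 2) * ‖x‖ ^ 2 := by
    rw [extDistSq, Fintype.sum_sum_type, add_mul]
    refine add_le_add ?_ ?_
    · calc ∑ i, relPosition f x (Sum.inl i) ^ 2 ≤ ∑ _i : Fin n, ‖x‖ ^ 2 :=
          Finset.sum_le_sum fun i _ => by
            simp only [relPosition, graphComp_inl, Pi.zero_apply, sub_zero]
            exact sq_le_sq.2 ((norm_le_pi_norm x i).trans (le_abs_self _))
        _ = _ := by simp
    · calc ∑ α, relPosition f x (Sum.inr α) ^ 2 ≤ ∑ _α : Fin m, (n * β * ‖x‖) ^ 2 :=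
          Finset.sum_le_sum fun α _ => by
            simp only [relPosition, graphComp_inr]
            exact sq_le_sq.2 ((abs_sub_le_of_slope hf h x α).trans (le_abs_self _))
        _ = _ := by simp; ring
  refine h1.trans (mul_le_mul_of_nonneg_right ?_ (sq_nonneg _))
  have : (0 : ℝ) ≤ n + m * (n * β) ^ 2 := by positivity
  nlinarith

lemma areaRatio_nonneg (f : (Fin n → ℝ) → (Fin m → ℝ)) {u : (Fin n → ℝ) → ℝ}
    (hu : ∀ x, 0 ≤ u x) {R : ℝ} (hR : 0 < R) : 0 ≤ areaRatio f u R :=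
  div_nonneg (integral_nonneg fun x => mul_nonneg (mul_nonneg
    (zero_le_one.trans (one_le_slopeFunction f x)) (hu x)) (convexCutoffSlope_nonneg _))
    (pow_nonneg hR.le _)

lemma areaRatio_le {f : (Fin n → ℝ) → (Fin m → ℝ)} {u : (Fin n → ℝ) → ℝ} {β B : ℝ}
    (h : ∀ x, slopeFunction f x ≤ β) (hu : ∀ x, 0 ≤ u x ∧ u x ≤ B) {R : ℝ} (hR : 0 < R) :
    areaRatio f u R ≤ β * B * convexCutoffSlope 0 * 2 ^ n := by
  have hβ : 0 ≤ β := by linarith [one_le_slopeFunction f 0, h 0]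
  have hB : 0 ≤ B := (hu 0).1.trans (hu 0).2
  have hK : 0 ≤ β * B * convexCutoffSlope 0 :=
    mul_nonneg (mul_nonneg hβ hB) (convexCutoffSlope_nonneg _)
  rw [areaRatio, div_le_iff₀ (pow_pos hR n)]
  have h1 : ∫ x, slopeFunction f x * u x * convexCutoffSlope (extDistSq f x / R ^ 2) ≤
      ∫ x, Set.indicator (Metric.closedBall (0 : Fin n → ℝ) R)
        (fun _ => β * B * convexCutoffSlope 0) x := by
    refine integral_mono_of_nonneg (Filter.Eventually.of_forall fun x => mul_nonneg (mul_nonneg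
      (zero_le_one.trans (one_le_slopeFunction f x)) (hu x).1) (convexCutoffSlope_nonneg _)) ?_
      (Filter.Eventually.of_forall fun x => ?_)
    · exact (integrable_indicator_iff Metric.isClosed_closedBall.measurableSet).2
        (integrableOn_const (isCompact_closedBall _ _).measure_lt_top.ne)
    · by_cases hx : x ∈ Metric.closedBall (0 : Fin n → ℝ) R
      · simp only [Set.indicator_of_mem hx]
        exact mul_le_mul (mul_le_mul (h x) (hu x).2 (hu x).1 hβ)
          (antitone_convexCutoffSlope (div_nonneg (extDistSq_nonneg f x) (sq_nonneg R)))
          (convexCutoffSlope_nonneg _) (mul_nonneg hβ hB)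
      · simp only [Set.indicator_of_notMem hx]
        rw [cutoff_comp_eq_zero (norm_sq_le_extDistSq f) hR le_rfl hx
          fun t => convexCutoffSlope_eq_zero, mul_zero]
  refine h1.trans (le_of_eq ?_)
  rw [integral_indicator Metric.isClosed_closedBall.measurableSet, setIntegral_const,
    measureReal_def, Real.volume_pi_closedBall _ hR.le, ENNReal.toReal_ofReal (by positivity)]
  simp [mul_pow]
  ring

lemma exists_mul_deriv_lt {I I' : ℝ → ℝ} {K : ℝ} (hI : ∀ R, 0 < R → HasDerivAt I (I' R) R)
    (h0 : ∀ R, 0 < R → 0 ≤ I R ∧ I R ≤ K) {δ : ℝ} (hδ : 0 < δ) {R₀ : ℝ} (hR₀ : 0 < R₀) :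
    ∃ R, R₀ ≤ R ∧ R * I' R < δ := by
  by_contra! hcon
  have hmono : MonotoneOn (fun R => I R - δ * Real.log R) (Set.Ici R₀) := by
    have hd : ∀ R, R₀ ≤ R → HasDerivAt (fun R => I R - δ * Real.log R) (I' R - δ * R⁻¹) R :=
      fun R hR => (hI R (hR₀.trans_le hR)).sub
        ((Real.hasDerivAt_log (hR₀.trans_le hR).ne').const_mul δ)
    refine monotoneOn_of_deriv_nonneg (convex_Ici R₀)
      (fun R hR => (hd R hR).continuousAt.continuousWithinAt)
      (fun R hR => (hd R (interior_subset hR)).differentiableAt.differentiableWithinAt) ?_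
    intro R hR
    have hR' : R₀ ≤ R := interior_subset hR
    have hpos : 0 < R := hR₀.trans_le hR'
    rw [(hd R hR').deriv, sub_nonneg, ← div_eq_mul_inv, div_le_iff₀ hpos, mul_comm]
    exact hcon R hR'
  obtain ⟨T, hT⟩ : ∃ T, T = R₀ * Real.exp ((K + 1) / δ) := ⟨_, rfl⟩
  have hK : 0 ≤ K := (h0 R₀ hR₀).1.trans (h0 R₀ hR₀).2
  have hTle : R₀ ≤ T := by
    rw [hT]
    exact le_mul_of_one_le_right hR₀.le (Real.one_le_exp (by positivity))
  have h1 := hmono (Set.self_mem_Ici) hTle hTle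
  have h2 : Real.log T = Real.log R₀ + (K + 1) / δ := by
    rw [hT, Real.log_mul hR₀.ne' (Real.exp_pos _).ne', Real.log_exp]
  simp only [h2, mul_add, mul_div_cancel₀ _ hδ.ne'] at h1
  linarith [(h0 R₀ hR₀).1, (h0 T (hR₀.trans_le hTle)).2]

lemma smooth_hessSq {f : (Fin n → ℝ) → (Fin m → ℝ)} (hf : ContDiff ℝ (⊤ : ℕ∞) f) :
    Smooth (hessSq f) :=
  ContDiff.sum fun _ _ => ContDiff.sum fun _ _ => ContDiff.sum fun k _ =>
    (((smooth_graphComp hf k).dirDeriv _).dirDeriv _).pow 2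

lemma hessSq_nonneg (f : (Fin n → ℝ) → (Fin m → ℝ)) (x : Fin n → ℝ) : 0 ≤ hessSq f x :=
  Finset.sum_nonneg fun _ _ => Finset.sum_nonneg fun _ _ => Finset.sum_nonneg fun _ _ =>
    sq_nonneg _

lemma setIntegral_closedBall_smul (h : (Fin n → ℝ) → ℝ) {r : ℝ} (hr : 0 < r) :
    r ^ n * ∫ y in Metric.closedBall (0 : Fin n → ℝ) 1, h (r • y) =
      ∫ x in Metric.closedBall (0 : Fin n → ℝ) r, h x := by
  rw [Measure.setIntegral_comp_smul_of_pos _ _ _ hr, smul_closedBall _ _ zero_le_one]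
  simp [abs_of_pos hr, hr.ne']

lemma energy_le_areaRatio_deriv {f : (Fin n → ℝ) → (Fin m → ℝ)} (hf : ContDiff ℝ (⊤ : ℕ∞) f)
    {u : (Fin n → ℝ) → ℝ} (hu : Smooth u) {ε : ℝ} (hε : 0 < ε)
    (hL : ∀ x, ε * hessSq f x ≤ metricLaplacian f u x) {C : ℝ} (hC : 0 < C)
    (hϱ : ∀ x, extDistSq f x ≤ C ^ 2 * ‖x‖ ^ 2) {r : ℝ} (hr : 0 < r) :
    convexCutoff (1 / 2) * ε * (∫ x in Metric.closedBall (0 : Fin n → ℝ) r, hessSq f x) ≤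
      ∫ x, slopeFunction f x *
        (convexCutoff (extDistSq f x / (2 * C * r) ^ 2) * metricLaplacian f u x) := by
  have hR : 0 < 2 * C * r := by positivity
  have hLn : ∀ x, 0 ≤ metricLaplacian f u x := fun x =>
    (mul_nonneg hε.le (hessSq_nonneg f x)).trans (hL x)
  have hnn : ∀ x, 0 ≤ slopeFunction f x *
      (convexCutoff (extDistSq f x / (2 * C * r) ^ 2) * metricLaplacian f u x) := fun x =>
    mul_nonneg (zero_le_one.trans (one_le_slopeFunction f x))
      (mul_nonneg (convexCutoff_nonneg _) (hLn x))
  have hInt : Integrable fun x => slopeFunction f x *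
      (convexCutoff (extDistSq f x / (2 * C * r) ^ 2) * metricLaplacian f u x) := by
    have := integrable_mul_cutoff_comp ((smooth_slope hf).continuous.mul
      (smooth_metricLaplacian hf hu).continuous) (smooth_extDistSq hf).continuous
      (norm_sq_le_extDistSq f) hR smooth_convexCutoff.continuous fun t => convexCutoff_eq_zero
    refine this.congr (Filter.Eventually.of_forall fun x => ?_)
    simp only [Pi.mul_apply]
    ring
  refine le_trans ?_ (setIntegral_le_integral (s := Metric.closedBall (0 : Fin n → ℝ) r) hInt
    (Filter.Eventually.of_forall hnn))
  rw [← integral_const_mul]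
  refine setIntegral_mono_on ?_ hInt.integrableOn Metric.isClosed_closedBall.measurableSet ?_
  · exact ((smooth_hessSq hf).continuous.const_mul _).continuousOn.integrableOn_compact
      (isCompact_closedBall _ _)
  intro x hx
  rw [mem_closedBall_zero_iff] at hx
  have h1 : convexCutoff (1 / 2) ≤ convexCutoff (extDistSq f x / (2 * C * r) ^ 2) := by
    refine antitone_convexCutoff ?_
    rw [div_le_iff₀ (by positivity)]
    refine (hϱ x).trans ?_
    have : ‖x‖ ^ 2 ≤ r ^ 2 := pow_le_pow_left₀ (norm_nonneg _) hx 2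
    nlinarith [mul_le_mul_of_nonneg_left this (sq_nonneg C), sq_nonneg (C * r)]
  calc convexCutoff (1 / 2) * ε * hessSq f x
      = convexCutoff (1 / 2) * (ε * hessSq f x) := by ring
    _ ≤ convexCutoff (extDistSq f x / (2 * C * r) ^ 2) * metricLaplacian f u x :=
      mul_le_mul h1 (hL x) (mul_nonneg hε.le (hessSq_nonneg f x)) (convexCutoff_nonneg _)
    _ ≤ _ := le_mul_of_one_le_left (mul_nonneg (convexCutoff_nonneg _) (hLn x))
      (one_le_slopeFunction f x)

lemma exists_scaled_energy_lt {f : (Fin n → ℝ) → (Fin m → ℝ)} (hf : ContDiff ℝ (⊤ : ℕ∞) f)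
    (hmin : MinimalSystem f) {β B : ℝ} (hβ : ∀ x, slopeFunction f x ≤ β)
    {u : (Fin n → ℝ) → ℝ} (hu : Smooth u) (hub : ∀ x, 0 ≤ u x ∧ u x ≤ B) {ε : ℝ} (hε : 0 < ε)
    (hL : ∀ x, ε * hessSq f x ≤ metricLaplacian f u x) {δ : ℝ} (hδ : 0 < δ) {r₀ : ℝ}
    (hr₀ : 0 < r₀) :
    ∃ r, r₀ ≤ r ∧ r ^ 2 * ∫ y in Metric.closedBall (0 : Fin n → ℝ) 1, hessSq f (r • y) < δ := by
  obtain ⟨C, hC, hϱ⟩ := exists_extDistSq_le hf hβ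
  have hη : 0 < convexCutoff (1 / 2) := convexCutoff_pos (by norm_num)
  obtain ⟨κ, hκ⟩ : ∃ κ, κ = (2 * C) ^ 2 / 2 * (convexCutoff (1 / 2) * ε) / (2 * C) ^ n :=
    ⟨_, rfl⟩
  have hκ0 : 0 < κ := by rw [hκ]; positivity
  obtain ⟨R, hR, hlt⟩ := exists_mul_deriv_lt (fun R hR => hasDerivAt_areaRatio hf hmin hu hR)
    (fun R hR => ⟨areaRatio_nonneg f (fun x => (hub x).1) hR, areaRatio_le hβ hub hR⟩)
    (mul_pos hκ0 hδ) (R₀ := 2 * C * r₀) (by positivity)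
  obtain ⟨r, hr⟩ : ∃ r, r = R / (2 * C) := ⟨_, rfl⟩
  have hRr : R = 2 * C * r := by rw [hr]; field_simp
  have hr0 : r₀ ≤ r := by
    rw [hr, le_div_iff₀ (by positivity)]
    linarith
  have hrpos : 0 < r := hr₀.trans_le hr0
  refine ⟨r, hr0, ?_⟩
  have h1 := energy_le_areaRatio_deriv hf hu hε hL hC hϱ hrpos
  rw [← setIntegral_closedBall_smul _ hrpos] at h1
  have h2 : 0 ≤ ∫ x, slopeFunction f x * u x * normalDistSq f x *
      convexCutoffCurv (extDistSq f x / R ^ 2) := integral_nonneg fun x =>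
    mul_nonneg (mul_nonneg (mul_nonneg (zero_le_one.trans (one_le_slopeFunction f x)) (hub x).1)
      (normalDistSq_nonneg f x)) (convexCutoffCurv_nonneg _)
  rw [hRr] at h2 hlt
  refine lt_of_mul_lt_mul_left (lt_of_le_of_lt ?_ hlt) hκ0.le
  generalize (∫ x, slopeFunction f x * u x * normalDistSq f x *
      convexCutoffCurv (extDistSq f x / (2 * C * r) ^ 2)) = a at h2 ⊢
  generalize (∫ x, slopeFunction f x *
        (convexCutoff (extDistSq f x / (2 * C * r) ^ 2) * metricLaplacian f u x)) = b at h1 ⊢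
  generalize (∫ y in Metric.closedBall (0 : Fin n → ℝ) 1, hessSq f (r • y)) = e at h1 ⊢
  have h3 : 2 * C * r * (((2 * C * r) ^ 2 / 2 * b + 2 / (2 * C * r) ^ 2 * a) /
      (2 * C * r) ^ (n + 1)) = ((2 * C * r) ^ 2 / 2 * b + 2 / (2 * C * r) ^ 2 * a) /
      (2 * C * r) ^ n := by
    field_simp
    ring
  rw [h3, le_div_iff₀ (by positivity)]
  have h4 : κ * (r ^ 2 * e) * (2 * C * r) ^ n =
      (2 * C * r) ^ 2 / 2 * (convexCutoff (1 / 2) * ε * (r ^ n * e)) := by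
    rw [hκ, mul_pow (2 * C) r n]
    field_simp
  rw [h4]
  have h5 : 0 ≤ 2 / (2 * C * r) ^ 2 * a := mul_nonneg (by positivity) h2
  linarith [mul_le_mul_of_nonneg_left h1 (show 0 ≤ (2 * C * r) ^ 2 / 2 by positivity)]

end EnergyDecay

section Poincare

variable {n : ℕ}

lemma volume_unit_closedBall :
    (volume.real (Metric.closedBall (0 : Fin n → ℝ) 1)) = 2 ^ n := by
  rw [measureReal_def, Real.volume_pi_closedBall _ zero_le_one,
    ENNReal.toReal_ofReal (by positivity)]
  simp

lemma segment_mem_closedBall {y z : Fin n → ℝ} (hy : y ∈ Metric.closedBall (0 : Fin n → ℝ) 1)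
    (hz : z ∈ Metric.closedBall (0 : Fin n → ℝ) 1) {t : ℝ} (h0 : 0 ≤ t) (h1 : t ≤ 1) :
    z + t • (y - z) ∈ Metric.closedBall (0 : Fin n → ℝ) 1 :=
  (convex_closedBall (0 : Fin n → ℝ) 1).add_smul_sub_mem hz hy ⟨h0, h1⟩

lemma abs_sub_midpoint_le {h : (Fin n → ℝ) → ℝ} (hh : Smooth h) {y z : Fin n → ℝ}
    (hy : y ∈ Metric.closedBall (0 : Fin n → ℝ) 1) (hz : z ∈ Metric.closedBall (0 : Fin n → ℝ) 1) :
    |h y - h (z + (1 / 2 : ℝ) • (y - z))| ≤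
      2 * ∫ t in Set.Icc (1 / 2 : ℝ) 1, ‖fderiv ℝ h (z + t • (y - z))‖ := by
  have hK : Continuous fun x => fderiv ℝ h x := hh.continuous_fderiv (by simp)
  have hline : Continuous fun t : ℝ => z + t • (y - z) := by fun_prop
  have hd : ∀ t : ℝ, HasDerivAt (fun t : ℝ => h (z + t • (y - z)))
      (fderiv ℝ h (z + t • (y - z)) (y - z)) t := by
    intro t
    have h1 : HasDerivAt (fun t : ℝ => z + t • (y - z)) (y - z) t := by
      simpa using ((hasDerivAt_id' t).smul_const (y - z)).const_add z
    exact (hh.differentiableAt (x := z + t • (y - z))).hasFDerivAt.comp_hasDerivAt t h1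
  have hcont : Continuous fun t : ℝ => fderiv ℝ h (z + t • (y - z)) (y - z) :=
    (hK.comp hline).clm_apply continuous_const
  have hftc := intervalIntegral.integral_eq_sub_of_hasDerivAt (a := 1 / 2) (b := 1)
    (fun t _ => hd t) (hcont.intervalIntegrable _ _)
  rw [one_smul, add_sub_cancel] at hftc
  rw [← hftc, ← Real.norm_eq_abs, integral_Icc_eq_integral_Ioc,
    ← intervalIntegral.integral_of_le (by norm_num), ← intervalIntegral.integral_const_mul]
  refine (intervalIntegral.norm_integral_le_integral_norm (by norm_num)).trans ?_
  refine intervalIntegral.integral_mono_on (by norm_num) (hcont.norm.intervalIntegrable _ _)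
    ((continuous_const.mul (hK.comp hline).norm).intervalIntegrable _ _) fun t _ => ?_
  have hyz : ‖y - z‖ ≤ 2 := by
    rw [mem_closedBall_zero_iff] at hy hz
    exact (norm_sub_le y z).trans (by linarith)
  refine (ContinuousLinearMap.le_opNorm _ _).trans ?_
  rw [mul_comm]
  exact mul_le_mul_of_nonneg_right hyz (norm_nonneg _)

lemma integral_contraction_le {K : (Fin n → ℝ) → ℝ} (hK : Continuous K) (h0 : ∀ x, 0 ≤ K x)
    {z : Fin n → ℝ} (hz : z ∈ Metric.closedBall (0 : Fin n → ℝ) 1) {t : ℝ}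
    (ht : t ∈ Set.Icc (1 / 2 : ℝ) 1) :
    ∫ y in Metric.closedBall (0 : Fin n → ℝ) 1, K (z + t • (y - z)) ≤
      2 ^ n * ∫ y in Metric.closedBall (0 : Fin n → ℝ) 1, K y := by
  have ht0 : 0 < t := by linarith [ht.1]
  have hm : MeasurableSet (Metric.closedBall (0 : Fin n → ℝ) 1) :=
    Metric.isClosed_closedBall.measurableSet
  obtain ⟨g, hg⟩ : ∃ g, g = (Metric.closedBall (0 : Fin n → ℝ) 1).indicator K := ⟨_, rfl⟩
  have hgi : Integrable g := by
    rw [hg, integrable_indicator_iff hm]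
    exact hK.continuousOn.integrableOn_compact (isCompact_closedBall _ _)
  have hg0 : ∀ x, 0 ≤ g x := fun x => by
    rw [hg]
    exact Set.indicator_nonneg (fun x _ => h0 x) x
  obtain ⟨a, ha⟩ : ∃ a, a = z - t • z := ⟨_, rfl⟩
  have hza : ∀ y, z + t • (y - z) = a + t • y := fun y => by rw [ha, smul_sub]; abel
  have hgt : Integrable fun y => g (a + t • y) :=
    (integrable_comp_smul_iff volume (fun y => g (a + y)) ht0.ne').2 (hgi.comp_add_left a)
  have h1 : ∫ y in Metric.closedBall (0 : Fin n → ℝ) 1, K (z + t • (y - z)) ≤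
      ∫ y, g (a + t • y) := by
    refine le_trans (le_of_eq ?_) (setIntegral_le_integral
      (s := Metric.closedBall (0 : Fin n → ℝ) 1) hgt
      (Filter.Eventually.of_forall fun y => hg0 _))
    refine setIntegral_congr_fun hm fun y hy => ?_
    rw [← hza, hg, Set.indicator_of_mem (segment_mem_closedBall hy hz ht0.le ht.2)]
  have h2 : ∫ y, g (a + t • y) = (t ^ n)⁻¹ * ∫ y in Metric.closedBall (0 : Fin n → ℝ) 1, K y := by
    rw [Measure.integral_comp_smul volume (fun y => g (a + y)) t, integral_add_left_eq_self, hg,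
      integral_indicator hm]
    simp [abs_of_pos ht0]
  rw [h2] at h1
  refine h1.trans (mul_le_mul_of_nonneg_right ?_ (setIntegral_nonneg hm fun x _ => h0 x))
  rw [← inv_pow]
  refine pow_le_pow_left₀ (by positivity) ?_ n
  rw [inv_le_comm₀ ht0 two_pos]
  linarith [ht.1]

lemma integral_sub_midpoint_le {h : (Fin n → ℝ) → ℝ} (hh : Smooth h) {z : Fin n → ℝ}
    (hz : z ∈ Metric.closedBall (0 : Fin n → ℝ) 1) :
    ∫ y in Metric.closedBall (0 : Fin n → ℝ) 1, |h y - h (z + (1 / 2 : ℝ) • (y - z))| ≤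
      2 ^ n * ∫ y in Metric.closedBall (0 : Fin n → ℝ) 1, ‖fderiv ℝ h y‖ := by
  have hm : MeasurableSet (Metric.closedBall (0 : Fin n → ℝ) 1) :=
    Metric.isClosed_closedBall.measurableSet
  have hK : Continuous fun x => ‖fderiv ℝ h x‖ := (hh.continuous_fderiv (by simp)).norm
  have hInt : Integrable (Function.uncurry fun (t : ℝ) (y : Fin n → ℝ) =>
      ‖fderiv ℝ h (z + t • (y - z))‖) ((volume.restrict (Set.Icc (1 / 2 : ℝ) 1)).prod
        (volume.restrict (Metric.closedBall (0 : Fin n → ℝ) 1))) := by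
    rw [Measure.prod_restrict]
    refine ContinuousOn.integrableOn_compact (isCompact_Icc.prod (isCompact_closedBall _ _)) ?_
    refine Continuous.continuousOn ?_
    exact hK.comp (by fun_prop : Continuous fun p : ℝ × (Fin n → ℝ) => z + p.1 • (p.2 - z))
  calc ∫ y in Metric.closedBall (0 : Fin n → ℝ) 1, |h y - h (z + (1 / 2 : ℝ) • (y - z))|
      ≤ ∫ y in Metric.closedBall (0 : Fin n → ℝ) 1,
          2 * ∫ t in Set.Icc (1 / 2 : ℝ) 1, ‖fderiv ℝ h (z + t • (y - z))‖ := by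
        refine setIntegral_mono_on ?_ (hInt.integral_prod_right.const_mul 2) hm fun y hy =>
          abs_sub_midpoint_le hh hy hz
        refine ContinuousOn.integrableOn_compact (isCompact_closedBall _ _)
          (Continuous.continuousOn ?_)
        have := hh.continuous
        fun_prop
    _ = 2 * ∫ t in Set.Icc (1 / 2 : ℝ) 1, ∫ y in Metric.closedBall (0 : Fin n → ℝ) 1,
          ‖fderiv ℝ h (z + t • (y - z))‖ := by
        rw [integral_const_mul, integral_integral_swap hInt]
    _ ≤ 2 * ∫ _t in Set.Icc (1 / 2 : ℝ) 1,
          2 ^ n * ∫ y in Metric.closedBall (0 : Fin n → ℝ) 1, ‖fderiv ℝ h y‖ := by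
        refine mul_le_mul_of_nonneg_left ?_ zero_le_two
        exact setIntegral_mono_on hInt.integral_prod_left
          (integrableOn_const (by simp)) measurableSet_Icc fun t ht =>
            integral_contraction_le hK (fun _ => norm_nonneg _) hz ht
    _ = _ := by
        rw [setIntegral_const, measureReal_def, Real.volume_Icc]
        norm_num
        ring

/-- An `L¹` Poincaré inequality on the unit cube. -/
lemma integral_sub_average_le {h : (Fin n → ℝ) → ℝ} (hh : Smooth h) :
    ∫ y in Metric.closedBall (0 : Fin n → ℝ) 1,
        |h y - (2 ^ n)⁻¹ * ∫ z in Metric.closedBall (0 : Fin n → ℝ) 1, h z| ≤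
      2 * 2 ^ n * ∫ y in Metric.closedBall (0 : Fin n → ℝ) 1, ‖fderiv ℝ h y‖ := by
  obtain ⟨μ, hμ⟩ : ∃ μ : Measure (Fin n → ℝ),
    μ = volume.restrict (Metric.closedBall (0 : Fin n → ℝ) 1) := ⟨_, rfl⟩
  have hm : MeasurableSet (Metric.closedBall (0 : Fin n → ℝ) 1) :=
    Metric.isClosed_closedBall.measurableSet
  have hfin : IsFiniteMeasure μ := by
    rw [hμ]
    exact ⟨by simp⟩
  have hc := hh.continuous
  have hcont1 : ∀ {k : (Fin n → ℝ) → ℝ}, Continuous k → Integrable k μ := fun hk => by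
    rw [hμ]
    exact hk.continuousOn.integrableOn_compact (isCompact_closedBall _ _)
  have hcont2 : ∀ {k : (Fin n → ℝ) × (Fin n → ℝ) → ℝ}, Continuous k → Integrable k (μ.prod μ) :=
    fun hk => by
      rw [hμ, Measure.prod_restrict]
      exact hk.continuousOn.integrableOn_compact
        ((isCompact_closedBall _ _).prod (isCompact_closedBall _ _))
  have hvol : μ.real Set.univ = 2 ^ n := by
    rw [hμ, measureReal_restrict_apply_univ, volume_unit_closedBall]
  rw [← hμ]
  obtain ⟨D, hD⟩ : ∃ D, D = ∫ y, ‖fderiv ℝ h y‖ ∂μ := ⟨_, rfl⟩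
  rw [← hD]
  have hG : Integrable (fun p : (Fin n → ℝ) × (Fin n → ℝ) =>
      |h p.1 - h (p.2 + (1 / 2 : ℝ) • (p.1 - p.2))|) (μ.prod μ) := hcont2 (by fun_prop)
  have hG' : Integrable (fun p : (Fin n → ℝ) × (Fin n → ℝ) =>
      |h p.2 - h (p.1 + (1 / 2 : ℝ) • (p.2 - p.1))|) (μ.prod μ) := hcont2 (by fun_prop)
  have hbound : ∫ z, ∫ y, |h y - h (z + (1 / 2 : ℝ) • (y - z))| ∂μ ∂μ ≤ 2 ^ n * (2 ^ n * D) := by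
    have : ∫ z, ∫ y, |h y - h (z + (1 / 2 : ℝ) • (y - z))| ∂μ ∂μ ≤ ∫ _z, 2 ^ n * D ∂μ := by
      refine integral_mono_ae hG'.integral_prod_left (integrable_const _) ?_
      rw [hμ]
      refine (ae_restrict_iff' hm).2 (Filter.Eventually.of_forall fun z hz => ?_)
      simp only
      rw [hD, hμ]
      exact integral_sub_midpoint_le hh hz
    refine this.trans (le_of_eq ?_)
    rw [integral_const, hvol, smul_eq_mul]
  have hbound' : ∫ y, ∫ z, |h y - h (z + (1 / 2 : ℝ) • (y - z))| ∂μ ∂μ ≤ 2 ^ n * (2 ^ n * D) := by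
    rwa [integral_integral_swap hG]
  have hdiff : ∀ y, |h y - (2 ^ n)⁻¹ * ∫ z, h z ∂μ| ≤ (2 ^ n)⁻¹ * ∫ z,
      (|h y - h (z + (1 / 2 : ℝ) • (y - z))| + |h z - h (y + (1 / 2 : ℝ) • (z - y))|) ∂μ := by
    intro y
    have h1 : h y - (2 ^ n)⁻¹ * ∫ z, h z ∂μ = (2 ^ n)⁻¹ * ∫ z, (h y - h z) ∂μ := by
      rw [integral_sub (integrable_const _) (hcont1 hc), integral_const, hvol, smul_eq_mul]
      field_simp
    rw [h1, abs_mul, abs_of_pos (by positivity : (0 : ℝ) < (2 ^ n)⁻¹)]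
    refine mul_le_mul_of_nonneg_left ?_ (by positivity)
    refine (abs_integral_le_integral_abs).trans (integral_mono (hcont1 (by fun_prop))
      (hcont1 (by fun_prop)) fun z => ?_)
    have h2 : z + (1 / 2 : ℝ) • (y - z) = y + (1 / 2 : ℝ) • (z - y) := by module
    rw [h2, abs_sub_comm (h z)]
    exact abs_sub_le _ _ _
  calc ∫ y, |h y - (2 ^ n)⁻¹ * ∫ z, h z ∂μ| ∂μ
      ≤ ∫ y, (2 ^ n)⁻¹ * ∫ z, (|h y - h (z + (1 / 2 : ℝ) • (y - z))| +
          |h z - h (y + (1 / 2 : ℝ) • (z - y))|) ∂μ ∂μ :=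
        integral_mono (hcont1 (by fun_prop)) ((hG.add hG').integral_prod_left.const_mul _) hdiff
    _ = (2 ^ n)⁻¹ * (∫ y, ∫ z, |h y - h (z + (1 / 2 : ℝ) • (y - z))| ∂μ ∂μ +
          ∫ y, ∫ z, |h z - h (y + (1 / 2 : ℝ) • (z - y))| ∂μ ∂μ) := by
        rw [integral_const_mul]
        congr 1
        rw [← integral_add hG.integral_prod_left hG'.integral_prod_left]
        refine integral_congr_ae (Filter.Eventually.of_forall fun y => ?_)
        exact integral_add (hcont1 (by fun_prop)) (hcont1 (by fun_prop))
    _ ≤ (2 ^ n)⁻¹ * (2 ^ n * (2 ^ n * D) + 2 ^ n * (2 ^ n * D)) :=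
        mul_le_mul_of_nonneg_left (add_le_add hbound' hbound) (by positivity)
    _ = _ := by field_simp; ring

end Poincare

section BlowDown

lemma exists_subseq_ae_tendsto_zero {E : Type*} [MeasurableSpace E] {μ : Measure E}
    {S : ℕ → E → ℝ} (hS : ∀ k, Integrable (S k) μ) (h0 : ∀ k x, 0 ≤ S k x)
    (hlim : Filter.Tendsto (fun k => ∫ x, S k x ∂μ) Filter.atTop (nhds 0)) :
    ∃ ns : ℕ → ℕ, StrictMono ns ∧
      ∀ᵐ x ∂μ, Filter.Tendsto (fun i => S (ns i) x) Filter.atTop (nhds 0) := by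
  refine TendstoInMeasure.exists_seq_tendsto_ae (g := fun _ => (0 : ℝ))
    (tendstoInMeasure_of_tendsto_eLpNorm one_ne_zero (fun k => (hS k).aestronglyMeasurable)
      aestronglyMeasurable_const ?_)
  have h1 : ∀ k, eLpNorm (S k - fun _ => (0 : ℝ)) 1 μ = ENNReal.ofReal (∫ x, S k x ∂μ) := by
    intro k
    rw [eLpNorm_one_eq_lintegral_enorm, ← ofReal_integral_norm_eq_lintegral_enorm
      (by simpa using (hS k).sub (integrable_const_iff.2 (Or.inl rfl)))]
    congr 1
    refine integral_congr_ae (Filter.Eventually.of_forall fun x => ?_)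
    simp [abs_of_nonneg (h0 k x)]
  simp only [h1]
  simpa using ENNReal.tendsto_ofReal hlim

variable {n m : ℕ}

/-- The matrix of first derivatives of a map, as a family of functions. -/
def slopes (f : (Fin n → ℝ) → (Fin m → ℝ)) (x : Fin n → ℝ) (i : Fin n) (α : Fin m) : ℝ :=
  dirDeriv (basisVec i) (graphComp f (Sum.inr α)) x

lemma smooth_slopes {f : (Fin n → ℝ) → (Fin m → ℝ)} (hf : ContDiff ℝ (⊤ : ℕ∞) f) (i : Fin n)
    (α : Fin m) : Smooth fun x => slopes f x i α :=
  (smooth_graphComp hf (Sum.inr α)).dirDeriv _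

lemma norm_fderiv_slopes_le {f : (Fin n → ℝ) → (Fin m → ℝ)} (x : Fin n → ℝ) (i : Fin n)
    (α : Fin m) : ‖fderiv ℝ (fun x => slopes f x i α) x‖ ≤ n * √(hessSq f x) := by
  refine ContinuousLinearMap.opNorm_le_bound _ (by positivity) fun v => ?_
  change ‖dirDeriv v (dirDeriv (basisVec i) (graphComp f (Sum.inr α))) x‖ ≤ _
  rw [dirDeriv_eq_sum]
  refine (norm_sum_le _ _).trans ?_
  calc ∑ j, ‖v j * dirDeriv (basisVec j) (dirDeriv (basisVec i) (graphComp f (Sum.inr α))) x‖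
      ≤ ∑ _j : Fin n, ‖v‖ * √(hessSq f x) := Finset.sum_le_sum fun j _ => by
        rw [norm_mul]
        refine mul_le_mul (norm_le_pi_norm v j) (Real.abs_le_sqrt ?_) (norm_nonneg _)
          (norm_nonneg _)
        refine le_trans ?_ (Finset.single_le_sum (f := fun j => ∑ i, ∑ k,
          dirDeriv (basisVec j) (dirDeriv (basisVec i) (graphComp f k)) x ^ 2)
          (fun j _ => Finset.sum_nonneg fun _ _ => Finset.sum_nonneg fun _ _ => sq_nonneg _)
          (Finset.mem_univ j))
        refine le_trans ?_ (Finset.single_le_sum (f := fun i => ∑ k,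
          dirDeriv (basisVec j) (dirDeriv (basisVec i) (graphComp f k)) x ^ 2)
          (fun j _ => Finset.sum_nonneg fun _ _ => sq_nonneg _) (Finset.mem_univ i))
        exact Finset.single_le_sum (f := fun k =>
          dirDeriv (basisVec j) (dirDeriv (basisVec i) (graphComp f k)) x ^ 2)
          (fun j _ => sq_nonneg _) (Finset.mem_univ (Sum.inr α))
    _ = n * √(hessSq f x) * ‖v‖ := by simp; ring

lemma integral_scaled_slopes_sub_average_le {f : (Fin n → ℝ) → (Fin m → ℝ)}
    (hf : ContDiff ℝ (⊤ : ℕ∞) f) {r τ : ℝ} (hr : 0 < r) (hτ : 0 < τ)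
    (h : r ^ 2 * ∫ y in Metric.closedBall (0 : Fin n → ℝ) 1, hessSq f (r • y) < τ ^ 2)
    (i : Fin n) (α : Fin m) :
    ∫ y in Metric.closedBall (0 : Fin n → ℝ) 1, |slopes f (r • y) i α -
        (2 ^ n)⁻¹ * ∫ z in Metric.closedBall (0 : Fin n → ℝ) 1, slopes f (r • z) i α| ≤
      2 * 2 ^ n * (n * (2 ^ n + 1)) * τ := by
  have hsm : Smooth fun y => slopes f (r • y) i α :=
    (smooth_slopes hf i α).comp (contDiff_const_smul r)
  have hH : Continuous fun y => hessSq f (r • y) :=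
    (smooth_hessSq hf).continuous.comp (continuous_const_smul r)
  refine (integral_sub_average_le hsm).trans ?_
  rw [mul_assoc (2 * 2 ^ n)]
  refine mul_le_mul_of_nonneg_left ?_ (by positivity)
  have h1 : ∀ y, ‖fderiv ℝ (fun y => slopes f (r • y) i α) y‖ ≤
      n * (τ + τ⁻¹ * (r ^ 2 * hessSq f (r • y))) := by
    intro y
    have h2 : ‖fderiv ℝ (fun y => slopes f (r • y) i α) y‖ ≤ r * (n * √(hessSq f (r • y))) := by
      have h3 : fderiv ℝ (fun y => slopes f (r • y) i α) y =
          r • fderiv ℝ (fun x => slopes f x i α) (r • y) :=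
        fderiv_comp_smul (f := fun x => slopes f x i α) r
      rw [h3, norm_smul, Real.norm_of_nonneg hr.le]
      exact mul_le_mul_of_nonneg_left (norm_fderiv_slopes_le _ i α) hr.le
    refine h2.trans ?_
    have h4 : r * √(hessSq f (r • y)) ≤ τ + τ⁻¹ * (r ^ 2 * hessSq f (r • y)) := by
      obtain ⟨b, hb⟩ : ∃ b, b = √(hessSq f (r • y)) := ⟨_, rfl⟩
      have hb2 : b ^ 2 = hessSq f (r • y) := by rw [hb, Real.sq_sqrt (hessSq_nonneg f _)]
      rw [← hb, ← hb2, ← sub_nonneg]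
      have : τ + τ⁻¹ * (r ^ 2 * b ^ 2) - r * b = τ⁻¹ * (τ ^ 2 + (r * b) ^ 2 - τ * (r * b)) := by
        field_simp
      rw [this]
      refine mul_nonneg (by positivity) ?_
      nlinarith [sq_nonneg (τ - r * b), sq_nonneg τ, sq_nonneg (r * b)]
    calc r * (n * √(hessSq f (r • y))) = n * (r * √(hessSq f (r • y))) := by ring
      _ ≤ _ := mul_le_mul_of_nonneg_left h4 (by positivity)
  have hInt : ∀ {k : (Fin n → ℝ) → ℝ}, Continuous k →
      IntegrableOn k (Metric.closedBall (0 : Fin n → ℝ) 1) := fun hk =>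
    hk.continuousOn.integrableOn_compact (isCompact_closedBall _ _)
  refine (setIntegral_mono (hInt (hsm.continuous_fderiv (by simp)).norm)
    (hInt (by fun_prop)) h1).trans ?_
  rw [integral_const_mul, integral_add (hInt continuous_const) (hInt (by fun_prop)),
    integral_const_mul, integral_const_mul, setIntegral_const, volume_unit_closedBall, smul_eq_mul,
    mul_assoc]
  refine mul_le_mul_of_nonneg_left ?_ (by positivity)
  have : τ⁻¹ * (r ^ 2 * ∫ y in Metric.closedBall (0 : Fin n → ℝ) 1, hessSq f (r • y)) ≤ τ := by
    rw [inv_mul_le_iff₀ hτ]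
    nlinarith
  linarith

/-- Along some sequence of scales the slopes of the rescaled graph converge to a constant. -/
lemma exists_blowDown {f : (Fin n → ℝ) → (Fin m → ℝ)} (hf : ContDiff ℝ (⊤ : ℕ∞) f) {β : ℝ}
    (hβ : ∀ x, slopeFunction f x ≤ β)
    (hsmall : ∀ δ : ℝ, 0 < δ → ∀ r₀ : ℝ, 0 < r₀ → ∃ r, r₀ ≤ r ∧
      r ^ 2 * ∫ y in Metric.closedBall (0 : Fin n → ℝ) 1, hessSq f (r • y) < δ) :
    ∃ (r : ℕ → ℝ) (L : Fin n → Fin m → ℝ), (∀ k, 0 < r k) ∧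
      Filter.Tendsto r Filter.atTop Filter.atTop ∧
      ∀ᵐ y ∂(volume.restrict (Metric.closedBall (0 : Fin n → ℝ) 1)), ∀ i α,
        Filter.Tendsto (fun k => slopes f (r k • y) i α) Filter.atTop (nhds (L i α)) := by
  have hτ : ∀ k : ℕ, (0 : ℝ) < 1 / ((k : ℝ) + 1) := fun k => by positivity
  choose r hr hE using fun k : ℕ => hsmall ((1 / ((k : ℝ) + 1)) ^ 2) (pow_pos (hτ k) 2)
    ((k : ℝ) + 1) (by positivity)
  have hrpos : ∀ k, 0 < r k := fun k => lt_of_lt_of_le (by positivity) (hr k)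
  have hrtop : Filter.Tendsto r Filter.atTop Filter.atTop :=
    Filter.tendsto_atTop_mono (fun k => (by linarith [hr k] : (k : ℝ) ≤ r k))
      tendsto_natCast_atTop_atTop
  obtain ⟨c, hc⟩ : ∃ c : ℕ → Fin n → Fin m → ℝ, c = fun k i α =>
    (2 ^ n)⁻¹ * ∫ z in Metric.closedBall (0 : Fin n → ℝ) 1, slopes f (r k • z) i α := ⟨_, rfl⟩
  have hsc : ∀ (k : ℕ) (i : Fin n) (α : Fin m), Continuous fun y => slopes f (r k • y) i α :=
    fun k i α => (smooth_slopes hf i α).continuous.comp (continuous_const_smul _)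
  have hInt : ∀ {k : (Fin n → ℝ) → ℝ}, Continuous k →
      IntegrableOn k (Metric.closedBall (0 : Fin n → ℝ) 1) := fun hk =>
    hk.continuousOn.integrableOn_compact (isCompact_closedBall _ _)
  have habs : ∀ (k : ℕ) (i : Fin n) (α : Fin m), Integrable
      (fun y => |slopes f (r k • y) i α - c k i α|)
      (volume.restrict (Metric.closedBall (0 : Fin n → ℝ) 1)) :=
    fun k i α => hInt ((hsc k i α).sub continuous_const).abs
  have hcont : ∀ (k : ℕ), Continuous fun y => ∑ i, ∑ α, |slopes f (r k • y) i α - c k i α| :=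
    fun k => continuous_finsetSum _ fun i _ => continuous_finsetSum _ fun α _ =>
      ((hsc k i α).sub continuous_const).abs
  have hβ0 : 0 ≤ β := by linarith [one_le_slopeFunction f 0, hβ 0]
  have hcb : ∀ k, c k ∈ Metric.closedBall (0 : Fin n → Fin m → ℝ) β := by
    intro k
    rw [mem_closedBall_zero_iff, pi_norm_le_iff_of_nonneg hβ0]
    intro i
    rw [pi_norm_le_iff_of_nonneg hβ0]
    intro α
    rw [hc]
    simp only
    rw [norm_mul, Real.norm_of_nonneg (by positivity : (0 : ℝ) ≤ (2 ^ n)⁻¹),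
      inv_mul_le_iff₀ (by positivity)]
    have := norm_setIntegral_le_of_norm_le_const (f := fun z => slopes f (r k • z) i α)
      (μ := volume) (isCompact_closedBall (0 : Fin n → ℝ) 1).measure_lt_top
      fun z _ => abs_le_norm_of_slope (hβ (r k • z)) i α
    rwa [volume_unit_closedBall, mul_comm] at this
  have hlim : Filter.Tendsto (fun k => ∫ y in Metric.closedBall (0 : Fin n → ℝ) 1,
      ∑ i, ∑ α, |slopes f (r k • y) i α - c k i α|) Filter.atTop (nhds 0) := by
    have hz : Filter.Tendsto (fun k : ℕ => (n * (m * (2 * 2 ^ n * (n * (2 ^ n + 1))))) *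
        (1 / ((k : ℝ) + 1))) Filter.atTop (nhds 0) := by
      simpa using tendsto_one_div_add_atTop_nhds_zero_nat.const_mul
        ((n * (m * (2 * 2 ^ n * (n * (2 ^ n + 1)))) : ℝ))
    refine squeeze_zero (fun k => integral_nonneg fun y => Finset.sum_nonneg fun i _ =>
      Finset.sum_nonneg fun α _ => abs_nonneg _) (fun k => ?_) hz
    rw [integral_finsetSum _ fun i _ => integrable_finsetSum _ fun α _ => habs k i α]
    calc ∑ i, ∫ y in Metric.closedBall (0 : Fin n → ℝ) 1, ∑ α, |slopes f (r k • y) i α - c k i α|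
        ≤ ∑ _i : Fin n, ∑ _α : Fin m, 2 * 2 ^ n * (n * (2 ^ n + 1)) * (1 / ((k : ℝ) + 1)) := by
          refine Finset.sum_le_sum fun i _ => ?_
          rw [integral_finsetSum _ fun α _ => habs k i α]
          refine Finset.sum_le_sum fun α _ => ?_
          rw [hc]
          exact integral_scaled_slopes_sub_average_le hf (hrpos k) (hτ k) (hE k) i α
      _ = _ := by simp; ring
  obtain ⟨φ, hφ, hae⟩ := exists_subseq_ae_tendsto_zero (fun k => hInt (hcont k))
    (fun k y => Finset.sum_nonneg fun i _ => Finset.sum_nonneg fun α _ => abs_nonneg _) hlim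
  obtain ⟨L, -, ψ, hψ, hL⟩ := tendsto_subseq_of_bounded
    (Metric.isBounded_closedBall (x := (0 : Fin n → Fin m → ℝ)) (r := β)) fun k => hcb (φ k)
  refine ⟨fun k => r (φ (ψ k)), L, fun k => hrpos _,
    hrtop.comp (hφ.tendsto_atTop.comp hψ.tendsto_atTop), ?_⟩
  filter_upwards [hae] with y hy i α
  have h1 : Filter.Tendsto (fun k => slopes f (r (φ (ψ k)) • y) i α - c (φ (ψ k)) i α)
      Filter.atTop (nhds 0) := by
    refine squeeze_zero_norm (fun k => ?_) (hy.comp hψ.tendsto_atTop)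
    refine le_trans ?_ (Finset.single_le_sum (f := fun i => ∑ α,
      |slopes f (r (φ (ψ k)) • y) i α - c (φ (ψ k)) i α|)
      (fun i _ => Finset.sum_nonneg fun _ _ => abs_nonneg _) (Finset.mem_univ i))
    exact Finset.single_le_sum (f := fun α => |slopes f (r (φ (ψ k)) • y) i α - c (φ (ψ k)) i α|)
      (fun α _ => abs_nonneg _) (Finset.mem_univ α)
  have h2 : Filter.Tendsto (fun k => c (φ (ψ k)) i α) Filter.atTop (nhds (L i α)) :=
    tendsto_pi_nhds.1 (tendsto_pi_nhds.1 hL i) α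
  simpa using h1.add h2

end BlowDown

section LimitOfAreaRatio

variable {n m : ℕ}

lemma integral_comp_quadForm (G : Matrix (Fin n) (Fin n) ℝ) (hG : Gᵀ = G)
    (hpos : ∀ v, v ⬝ᵥ v ≤ v ⬝ᵥ (G *ᵥ v)) {ψ : ℝ → ℝ} (hψ : Continuous ψ) :
    ∫ y : Fin n → ℝ, √G.det * ψ (y ⬝ᵥ (G *ᵥ y)) = ∫ z : Fin n → ℝ, ψ (z ⬝ᵥ z) := by
  obtain ⟨S, d, hS, -⟩ := exists_simultaneous_diagonalization G 0 hG hpos (fun v => by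
    simp only [Matrix.zero_mulVec, dotProduct_zero]
    refine le_trans ?_ (hpos v)
    exact Finset.sum_nonneg fun i _ => mul_self_nonneg _)
  have hdet : S.det ^ 2 * G.det = 1 := by
    have := congrArg Matrix.det hS
    rw [Matrix.det_mul, Matrix.det_mul, Matrix.det_transpose, Matrix.det_one] at this
    linarith
  have hS0 : S.det ≠ 0 := by
    intro h
    simp [h] at hdet
  have hsqrt : √G.det = |(S.det)⁻¹| := by
    rw [← Real.sqrt_sq_eq_abs]
    congr 1
    field_simp
    linarith
  have hq : ∀ z, z ⬝ᵥ z = (S *ᵥ z) ⬝ᵥ (G *ᵥ (S *ᵥ z)) := fun z => by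
    rw [← quadForm_conj, hS, Matrix.one_mulVec]
  have hcont : Continuous fun y : Fin n → ℝ => ψ (y ⬝ᵥ (G *ᵥ y)) := by
    refine hψ.comp ?_
    simp only [dotProduct, Matrix.mulVec]
    fun_prop
  have h1 := integral_map (μ := volume) (φ := Matrix.toLin' S)
    (LinearMap.continuous_of_finiteDimensional _).measurable.aemeasurable
    hcont.aestronglyMeasurable
  rw [Real.map_matrix_volume_pi_eq_smul_volume_pi hS0, integral_smul_measure] at h1
  simp only [Matrix.toLin'_apply, ← hq] at h1
  rw [← h1, integral_const_mul, hsqrt, ENNReal.toReal_ofReal (abs_nonneg _), smul_eq_mul]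

lemma graphMetric_eq_slopes (f : (Fin n → ℝ) → (Fin m → ℝ)) (x : Fin n → ℝ) :
    graphMetric f x = 1 + Matrix.of (slopes f x) * (Matrix.of (slopes f x))ᵀ := by
  ext i j
  rw [Matrix.add_apply, Matrix.mul_apply, Matrix.one_apply]
  rfl

lemma quadForm_one_add_mul_transpose (L : Matrix (Fin n) (Fin m) ℝ) (y : Fin n → ℝ) :
    y ⬝ᵥ ((1 + L * Lᵀ) *ᵥ y) = y ⬝ᵥ y + ∑ α, (∑ i, L i α * y i) ^ 2 := by
  rw [Matrix.add_mulVec, Matrix.one_mulVec, dotProduct_add, ← Matrix.mulVec_mulVec,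
    Matrix.dotProduct_mulVec, ← Matrix.mulVec_transpose]
  simp [dotProduct, Matrix.mulVec, sq]

lemma ae_ae_smul_mem {p : (Fin n → ℝ) → Prop} {s : Set (Fin n → ℝ)} (hs : MeasurableSet s)
    (h : ∀ᵐ y ∂(volume.restrict s), p y) :
    ∀ᵐ y : Fin n → ℝ, ∀ᵐ t : ℝ, t • y ∈ s → p (t • y) := by
  rw [ae_restrict_iff' hs] at h
  obtain ⟨T, hT⟩ : ∃ T, T = toMeasurable volume {y | ¬ (y ∈ s → p y)} := ⟨_, rfl⟩
  have hTm : MeasurableSet T := hT ▸ measurableSet_toMeasurable _ _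
  have hT0 : volume T = 0 := by
    rw [hT, measure_toMeasurable]
    exact h
  have hTs : ∀ y, y ∉ T → y ∈ s → p y := by
    intro y hy
    by_contra hc
    exact hy (hT ▸ subset_toMeasurable _ _ hc)
  have h1 : ∀ᵐ t : ℝ, ∀ᵐ y : Fin n → ℝ, t • y ∉ T := by
    have : ∀ᵐ t : ℝ, t ≠ 0 := by
      simp [ae_iff]
    filter_upwards [this] with t ht
    have := Measure.addHaar_preimage_smul volume ht T
    rw [hT0, mul_zero] at this
    rw [ae_iff]
    simp only [not_not]
    exact this
  have h2 := (Measure.ae_ae_comm (μ := (volume : Measure ℝ))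
    (ν := (volume : Measure (Fin n → ℝ))) (p := fun t y => t • y ∉ T)
    (measurableSet_preimage (measurable_fst.smul measurable_snd) hTm).compl).1 h1
  filter_upwards [h2] with y hy
  filter_upwards [hy] with t ht
  exact hTs _ ht

lemma difference_quotient_eq_integral {f : (Fin n → ℝ) → (Fin m → ℝ)}
    (hf : ContDiff ℝ (⊤ : ℕ∞) f) {R : ℝ} (hR : R ≠ 0) (y : Fin n → ℝ) (α : Fin m) :
    (f (R • y) α - f 0 α) / R =
      ∫ t in (0 : ℝ)..1, ∑ i, slopes f (R • t • y) i α * y i := by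
  have hd : ∀ t : ℝ, HasDerivAt (fun t : ℝ => f (R • t • y) α)
      (R * ∑ i, slopes f (R • t • y) i α * y i) t := by
    intro t
    have h1 : HasDerivAt (fun t : ℝ => R • t • y) (R • y) t := by
      have h0 : HasDerivAt (fun t : ℝ => t • y) y t := by
        simpa using (hasDerivAt_id' t).smul_const y
      exact h0.const_smul R
    have h2 := ((smooth_graphComp hf (Sum.inr α)).differentiableAt
      (x := R • t • y)).hasFDerivAt.comp_hasDerivAt t h1
    refine h2.congr_deriv ?_
    change dirDeriv (R • y) (graphComp f (Sum.inr α)) (R • t • y) = _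
    rw [dirDeriv_eq_sum, Finset.mul_sum]
    refine Finset.sum_congr rfl fun i _ => ?_
    rw [Pi.smul_apply, smul_eq_mul, slopes]
    ring
  have hc : Continuous fun t : ℝ => ∑ i, slopes f (R • t • y) i α * y i := by
    refine continuous_finsetSum _ fun i _ => Continuous.mul ?_ continuous_const
    exact (smooth_slopes hf i α).continuous.comp (by fun_prop : Continuous fun t : ℝ => R • t • y)
  have := intervalIntegral.integral_eq_sub_of_hasDerivAt (a := 0) (b := 1) (fun t _ => hd t)
    ((continuous_const.mul hc).intervalIntegrable _ _)
  rw [intervalIntegral.integral_const_mul] at this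
  simp only [one_smul, zero_smul, smul_zero] at this
  rw [← this, mul_div_cancel_left₀ _ hR]

lemma tendsto_difference_quotient {f : (Fin n → ℝ) → (Fin m → ℝ)} (hf : ContDiff ℝ (⊤ : ℕ∞) f)
    {β : ℝ} (hβ : ∀ x, slopeFunction f x ≤ β) {R : ℕ → ℝ} (hR : ∀ k, 0 < R k)
    {L : Fin n → Fin m → ℝ}
    (hL : ∀ᵐ y ∂(volume.restrict (Metric.closedBall (0 : Fin n → ℝ) 1)), ∀ i α,
        Filter.Tendsto (fun k => slopes f (R k • y) i α) Filter.atTop (nhds (L i α))) :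
    ∀ᵐ y ∂(volume.restrict (Metric.closedBall (0 : Fin n → ℝ) 1)), ∀ α,
      Filter.Tendsto (fun k => (f (R k • y) α - f 0 α) / R k) Filter.atTop
        (nhds (∑ i, L i α * y i)) := by
  have hm : MeasurableSet (Metric.closedBall (0 : Fin n → ℝ) 1) :=
    Metric.isClosed_closedBall.measurableSet
  rw [ae_restrict_iff' hm]
  filter_upwards [ae_ae_smul_mem hm hL] with y hy hyQ α
  have hβ0 : 0 ≤ β := by linarith [one_le_slopeFunction f 0, hβ 0]
  simp only [fun k => difference_quotient_eq_integral hf (hR k).ne' y α]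
  have hconst : ∑ i, L i α * y i = ∫ _t in (0 : ℝ)..1, ∑ i, L i α * y i := by simp
  rw [hconst]
  refine intervalIntegral.tendsto_integral_filter_of_dominated_convergence
    (fun _ => n * (β * ‖y‖)) (Filter.Eventually.of_forall fun k => ?_)
    (Filter.Eventually.of_forall fun k => Filter.Eventually.of_forall fun t _ => ?_)
    intervalIntegrable_const ?_
  · refine (continuous_finsetSum _ fun i _ => Continuous.mul ?_ continuous_const
      ).aestronglyMeasurable
    exact (smooth_slopes hf i α).continuous.comp
      (by fun_prop : Continuous fun t : ℝ => R k • t • y)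
  · refine (norm_sum_le _ _).trans ?_
    calc ∑ i, ‖slopes f (R k • t • y) i α * y i‖ ≤ ∑ _i : Fin n, β * ‖y‖ :=
          Finset.sum_le_sum fun i _ => by
            rw [norm_mul]
            exact mul_le_mul (abs_le_norm_of_slope (hβ _) i α) (norm_le_pi_norm y i)
              (norm_nonneg _) hβ0
      _ = _ := by simp
  · filter_upwards [hy] with t ht htI
    rw [Set.uIoc_of_le zero_le_one] at htI
    have hmem : t • y ∈ Metric.closedBall (0 : Fin n → ℝ) 1 := by
      rw [mem_closedBall_zero_iff] at hyQ ⊢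
      rw [norm_smul, Real.norm_of_nonneg htI.1.le]
      exact mul_le_one₀ htI.2 (norm_nonneg _) hyQ
    exact tendsto_finsetSum _ fun i _ => (ht hmem i α).mul_const _

lemma areaRatio_one_eq {f : (Fin n → ℝ) → (Fin m → ℝ)} {R : ℝ} (hR : 0 < R) :
    areaRatio f (fun _ => 1) R = ∫ y in Metric.closedBall (0 : Fin n → ℝ) 1,
      slopeFunction f (R • y) * convexCutoffSlope (extDistSq f (R • y) / R ^ 2) := by
  have h1 := setIntegral_closedBall_smul
    (fun x => slopeFunction f x * convexCutoffSlope (extDistSq f x / R ^ 2)) hR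
  rw [areaRatio, div_eq_iff (pow_pos hR n).ne', mul_comm, h1]
  simp only [mul_one]
  symm
  refine setIntegral_eq_integral_of_forall_compl_eq_zero fun x hx => ?_
  rw [cutoff_comp_eq_zero (norm_sq_le_extDistSq f) hR le_rfl hx
    fun t => convexCutoffSlope_eq_zero, mul_zero]

lemma extDistSq_smul_div (f : (Fin n → ℝ) → (Fin m → ℝ)) {R : ℝ} (hR : 0 < R) (y : Fin n → ℝ) :
    extDistSq f (R • y) / R ^ 2 = y ⬝ᵥ y + ∑ α, ((f (R • y) α - f 0 α) / R) ^ 2 := by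
  rw [extDistSq, Fintype.sum_sum_type, add_div, Finset.sum_div, Finset.sum_div]
  congr 1
  · refine Finset.sum_congr rfl fun i _ => ?_
    simp only [relPosition, graphComp_inl, Pi.smul_apply, Pi.zero_apply, smul_eq_mul]
    field_simp
    ring
  · refine Finset.sum_congr rfl fun α _ => ?_
    rw [div_pow]
    rfl

/-- If the slopes converge along a sequence of scales, the area ratios converge to that of a
plane. -/
lemma tendsto_areaRatio {f : (Fin n → ℝ) → (Fin m → ℝ)} (hf : ContDiff ℝ (⊤ : ℕ∞) f)
    {β : ℝ} (hβ : ∀ x, slopeFunction f x ≤ β) {R : ℕ → ℝ} (hR : ∀ k, 0 < R k)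
    {L : Fin n → Fin m → ℝ}
    (hL : ∀ᵐ y ∂(volume.restrict (Metric.closedBall (0 : Fin n → ℝ) 1)), ∀ i α,
        Filter.Tendsto (fun k => slopes f (R k • y) i α) Filter.atTop (nhds (L i α))) :
    Filter.Tendsto (fun k => areaRatio f (fun _ => 1) (R k)) Filter.atTop
      (nhds (∫ z : Fin n → ℝ, convexCutoffSlope (z ⬝ᵥ z))) := by
  have hβ0 : 0 ≤ β := by linarith [one_le_slopeFunction f 0, hβ 0]
  obtain ⟨G, hG⟩ : ∃ G : Matrix (Fin n) (Fin n) ℝ, G = 1 + Matrix.of L * (Matrix.of L)ᵀ :=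
    ⟨_, rfl⟩
  have hquad : ∀ y, y ⬝ᵥ (G *ᵥ y) = y ⬝ᵥ y + ∑ α, (∑ i, L i α * y i) ^ 2 := fun y => by
    rw [hG, quadForm_one_add_mul_transpose]
    rfl
  have hpos : ∀ y, y ⬝ᵥ y ≤ y ⬝ᵥ (G *ᵥ y) := fun y => by
    rw [hquad]
    exact le_add_of_nonneg_right (Finset.sum_nonneg fun _ _ => sq_nonneg _)
  have hGt : Gᵀ = G := by
    rw [hG, Matrix.transpose_add, Matrix.transpose_one, Matrix.transpose_mul,
      Matrix.transpose_transpose]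
  rw [← integral_comp_quadForm G hGt hpos continuous_convexCutoffSlope]
  have hcompl : ∫ y in Metric.closedBall (0 : Fin n → ℝ) 1,
      √G.det * convexCutoffSlope (y ⬝ᵥ (G *ᵥ y)) =
      ∫ y : Fin n → ℝ, √G.det * convexCutoffSlope (y ⬝ᵥ (G *ᵥ y)) := by
    refine setIntegral_eq_integral_of_forall_compl_eq_zero fun y hy => ?_
    rw [convexCutoffSlope_eq_zero, mul_zero]
    refine le_trans ?_ (hpos y)
    rw [mem_closedBall_zero_iff, not_le] at hy
    by_contra! hlt
    refine absurd ((pi_norm_le_iff_of_nonneg zero_le_one).2 fun i => ?_) (not_le.2 hy)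
    refine abs_le_one_iff_mul_self_le_one.2 (le_trans ?_ hlt.le)
    exact Finset.single_le_sum (f := fun i => y i * y i) (fun _ _ => mul_self_nonneg _)
      (Finset.mem_univ i)
  rw [← hcompl]
  simp only [fun k => areaRatio_one_eq (f := f) (hR k)]
  refine tendsto_integral_of_dominated_convergence (fun _ => β * convexCutoffSlope 0)
    (fun k => ?_) ?_ (fun k => Filter.Eventually.of_forall fun y => ?_) ?_
  · have h1 := (smooth_slope hf).continuous.comp (continuous_const_smul (R k))
    have h2 := (smooth_extDistSq hf).continuous.comp (continuous_const_smul (R k))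
    exact (h1.mul (continuous_convexCutoffSlope.comp (h2.div_const _))).aestronglyMeasurable
  · exact integrableOn_const (isCompact_closedBall _ _).measure_lt_top.ne
  · rw [norm_mul, Real.norm_of_nonneg (zero_le_one.trans (one_le_slopeFunction f _)),
      Real.norm_of_nonneg (convexCutoffSlope_nonneg _)]
    exact mul_le_mul (hβ _) (antitone_convexCutoffSlope
      (div_nonneg (extDistSq_nonneg f _) (sq_nonneg _))) (convexCutoffSlope_nonneg _) hβ0
  · filter_upwards [hL, tendsto_difference_quotient hf hβ hR hL] with y h1 h2
    simp only [fun k => extDistSq_smul_div f (hR k) y, hquad]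
    refine Filter.Tendsto.mul ?_ (continuous_convexCutoffSlope.continuousAt.tendsto.comp
      (tendsto_const_nhds.add (tendsto_finsetSum _ fun α _ => (h2 α).pow 2)))
    have h3 : Filter.Tendsto (fun k => slopes f (R k • y)) Filter.atTop (nhds L) :=
      tendsto_pi_nhds.2 fun i => tendsto_pi_nhds.2 fun α => h1 i α
    have hdet : Continuous fun A : Fin n → Fin m → ℝ =>
        √(1 + Matrix.of A * (Matrix.of A)ᵀ).det := by
      refine Real.continuous_sqrt.comp (Continuous.matrix_det ?_)
      have : Continuous fun A : Fin n → Fin m → ℝ => Matrix.of A := continuous_id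
      exact continuous_const.add (this.matrix_mul this.matrix_transpose)
    rw [hG]
    simp only [slopeFunction, graphMetric_eq_slopes]
    exact hdet.continuousAt.tendsto.comp h3

end LimitOfAreaRatio

section Rigidity

variable {n m : ℕ}

lemma hasDerivAt_areaRatio_one {f : (Fin n → ℝ) → (Fin m → ℝ)} (hf : ContDiff ℝ (⊤ : ℕ∞) f)
    (hmin : MinimalSystem f) {R : ℝ} (hR : 0 < R) :
    HasDerivAt (areaRatio f fun _ => 1) ((2 / R ^ 2 * ∫ x, slopeFunction f x * normalDistSq f x *
      convexCutoffCurv (extDistSq f x / R ^ 2)) / R ^ (n + 1)) R := by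
  have hu : Smooth fun _ : Fin n → ℝ => (1 : ℝ) := contDiff_const
  have hL : ∀ x, metricLaplacian f (fun _ => 1) x = 0 := fun x => by
    have h : ∀ j, dirDeriv (basisVec j) (fun _ : Fin n → ℝ => (1 : ℝ)) = fun _ => 0 := fun j =>
      funext fun y => dirDeriv_const _ _ _
    simp [metricLaplacian, h]
  refine (hasDerivAt_areaRatio hf hmin hu hR).congr_deriv ?_
  simp only [hL, mul_zero, integral_zero, zero_add, mul_one]

/-- If the area ratio is bounded above and below by its limits at zero and infinity, it is
constant. -/
lemma areaRatio_one_eq_of_slopes_tendsto {f : (Fin n → ℝ) → (Fin m → ℝ)}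
    (hf : ContDiff ℝ (⊤ : ℕ∞) f) (hmin : MinimalSystem f) {β : ℝ}
    (hβ : ∀ x, slopeFunction f x ≤ β) {r : ℕ → ℝ} (hr : ∀ k, 0 < r k)
    (hrt : Filter.Tendsto r Filter.atTop Filter.atTop) {L : Fin n → Fin m → ℝ}
    (hL : ∀ᵐ y ∂(volume.restrict (Metric.closedBall (0 : Fin n → ℝ) 1)), ∀ i α,
        Filter.Tendsto (fun k => slopes f (r k • y) i α) Filter.atTop (nhds (L i α)))
    {R : ℝ} (hR : 0 < R) :
    areaRatio f (fun _ => 1) R = ∫ z : Fin n → ℝ, convexCutoffSlope (z ⬝ᵥ z) := by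
  have hmono : MonotoneOn (areaRatio f fun _ => 1) (Set.Ioi 0) := by
    refine monotoneOn_of_deriv_nonneg (convex_Ioi 0) (fun t ht =>
      (hasDerivAt_areaRatio_one hf hmin ht).continuousAt.continuousWithinAt) (fun t ht => ?_)
      fun t ht => ?_
    · rw [interior_Ioi] at ht
      exact (hasDerivAt_areaRatio_one hf hmin ht).differentiableAt.differentiableWithinAt
    · rw [interior_Ioi] at ht
      rw [(hasDerivAt_areaRatio_one hf hmin ht).deriv]
      have ht' : (0 : ℝ) < t := ht
      refine div_nonneg (mul_nonneg (by positivity) (integral_nonneg fun x => ?_)) (by positivity)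
      exact mul_nonneg (mul_nonneg (zero_le_one.trans (one_le_slopeFunction f x))
        (normalDistSq_nonneg f x)) (convexCutoffCurv_nonneg _)
  have hs : Filter.Tendsto (fun k : ℕ => 1 / ((k : ℝ) + 1)) Filter.atTop (nhds 0) :=
    tendsto_one_div_add_atTop_nhds_zero_nat
  have hspos : ∀ k : ℕ, 0 < 1 / ((k : ℝ) + 1) := fun k => by positivity
  have h0 := tendsto_areaRatio hf hβ hspos (L := slopes f 0)
    (Filter.Eventually.of_forall fun y i α => by
      have h1 : Filter.Tendsto (fun k : ℕ => (1 / ((k : ℝ) + 1)) • y) Filter.atTop (nhds 0) := by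
        simpa using hs.smul_const y
      exact ((smooth_slopes hf i α).continuous.tendsto 0).comp h1)
  have h1 := tendsto_areaRatio hf hβ hr hL
  refine le_antisymm (ge_of_tendsto h1 ?_) (le_of_tendsto h0 ?_)
  · filter_upwards [hrt.eventually_ge_atTop R] with k hk
    exact hmono hR (hr k) hk
  · filter_upwards [hs.eventually (eventually_le_nhds hR)] with k hk
    exact hmono (hspos k) hR hk

/-- A minimal graph with constant area ratio is a cone: its position vector is tangent. -/
lemma normalDistSq_eq_zero_of_areaRatio {f : (Fin n → ℝ) → (Fin m → ℝ)}
    (hf : ContDiff ℝ (⊤ : ℕ∞) f) (hmin : MinimalSystem f) {κ : ℝ}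
    (h : ∀ R, 0 < R → areaRatio f (fun _ => 1) R = κ) (x : Fin n → ℝ) :
    normalDistSq f x = 0 := by
  obtain ⟨R, hR, hxR⟩ : ∃ R : ℝ, 0 < R ∧ extDistSq f x < R ^ 2 := by
    refine ⟨extDistSq f x + 1, by linarith [extDistSq_nonneg f x], ?_⟩
    nlinarith [extDistSq_nonneg f x]
  have hd : HasDerivAt (areaRatio f fun _ => 1) 0 R :=
    (hasDerivAt_const R κ).congr_of_eventuallyEq (by
      filter_upwards [eventually_gt_nhds hR] with t ht using h t ht)
  have hI := (hasDerivAt_areaRatio_one hf hmin hR).unique hd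
  have hI0 : ∫ x, slopeFunction f x * normalDistSq f x *
      convexCutoffCurv (extDistSq f x / R ^ 2) = 0 := by
    rw [div_eq_zero_iff, or_iff_left (by positivity), mul_eq_zero,
      or_iff_right (by positivity)] at hI
    exact hI
  have hsN : Continuous fun x => slopeFunction f x * normalDistSq f x :=
    (smooth_slope hf).continuous.mul (smooth_normalDistSq hf).continuous
  have hϱ : Continuous (extDistSq f) := (smooth_extDistSq hf).continuous
  have hc : Continuous fun x => slopeFunction f x * normalDistSq f x *
      convexCutoffCurv (extDistSq f x / R ^ 2) :=
    hsN.mul (continuous_convexCutoffCurv.comp (hϱ.div_const _))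
  rw [integral_eq_zero_iff_of_nonneg (fun x =>
    mul_nonneg (mul_nonneg (zero_le_one.trans (one_le_slopeFunction f x))
      (normalDistSq_nonneg f x)) (convexCutoffCurv_nonneg _))
    (integrable_mul_cutoff_comp hsN hϱ (norm_sq_le_extDistSq f) hR continuous_convexCutoffCurv
      fun t => convexCutoffCurv_eq_zero)] at hI0
  have hx := congrFun ((Continuous.ae_eq_iff_eq volume hc continuous_zero).1 hI0) x
  have hpos : 0 < convexCutoffCurv (extDistSq f x / R ^ 2) :=
    convexCutoffCurv_pos ((div_lt_one (by positivity)).2 hxR)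
  have hs := one_le_slopeFunction f x
  simp only [Pi.zero_apply, mul_eq_zero] at hx
  rcases hx with (h1 | h1) | h1
  · linarith
  · exact h1
  · exact absurd h1 hpos.ne'

lemma sub_eq_sum_slopes_of_normalDistSq {f : (Fin n → ℝ) → (Fin m → ℝ)} {x : Fin n → ℝ}
    (h : normalDistSq f x = 0) (α : Fin m) : f x α - f 0 α = ∑ i, slopes f x i α * x i := by
  have hP : normalProjection f x *ᵥ relPosition f x = 0 := by
    funext k
    rw [normalDistSq, Finset.sum_eq_zero_iff_of_nonneg fun _ _ => sq_nonneg _] at h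
    exact pow_eq_zero_iff two_ne_zero |>.1 (h k (Finset.mem_univ k))
  have hW := eq_of_normalProjection_eq_zero hP
  generalize (graphMetric f x)⁻¹ *ᵥ ((graphJacobian f x)ᵀ *ᵥ relPosition f x) = w at hW
  have hw : w = x := by
    funext a
    rw [← jacobian_mulVec_inl f x w a, ← hW]
    simp [relPosition, graphComp_inl]
  have := congrFun hW (Sum.inr α)
  rw [hw] at this
  exact this

lemma hasDerivAt_along_ray {f : (Fin n → ℝ) → (Fin m → ℝ)} (hf : ContDiff ℝ (⊤ : ℕ∞) f)
    (x : Fin n → ℝ) (α : Fin m) (t : ℝ) :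
    HasDerivAt (fun t : ℝ => f (t • x) α) (∑ i, slopes f (t • x) i α * x i) t := by
  have h1 : HasDerivAt (fun t : ℝ => t • x) x t := by
    simpa using (hasDerivAt_id' t).smul_const x
  refine (((smooth_graphComp hf (Sum.inr α)).differentiableAt
    (x := t • x)).hasFDerivAt.comp_hasDerivAt t h1).congr_deriv ?_
  change dirDeriv x (graphComp f (Sum.inr α)) (t • x) = _
  rw [dirDeriv_eq_sum]
  exact Finset.sum_congr rfl fun i _ => mul_comm _ _

/-- A smooth map that is homogeneous of degree one about the origin is affine. -/
lemma sub_eq_sum_slopes_zero {f : (Fin n → ℝ) → (Fin m → ℝ)} (hf : ContDiff ℝ (⊤ : ℕ∞) f)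
    {α : Fin m} (h : ∀ x, f x α - f 0 α = ∑ i, slopes f x i α * x i) (x : Fin n → ℝ) :
    f x α - f 0 α = ∑ i, slopes f 0 i α * x i := by
  have hq : ∀ t ∈ Set.Ioi (0 : ℝ), HasDerivAt (fun t : ℝ => (f (t • x) α - f 0 α) / t) 0 t := by
    intro t ht
    refine (((hasDerivAt_along_ray hf x α t).sub_const (f 0 α)).fun_div (hasDerivAt_id' t)
      (ne_of_gt ht)).congr_deriv ?_
    have h1 := h (t • x)
    simp only [Pi.smul_apply, smul_eq_mul] at h1
    rw [h1, Finset.sum_mul, mul_one, ← Finset.sum_sub_distrib, Finset.sum_eq_zero, zero_div]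
    intro i _
    ring
  have hconst : ∀ t ∈ Set.Ioi (0 : ℝ), (f (t • x) α - f 0 α) / t = f x α - f 0 α := by
    intro t ht
    have := isOpen_Ioi.is_const_of_deriv_eq_zero isPreconnected_Ioi
      (fun s hs => (hq s hs).differentiableAt.differentiableWithinAt)
      (fun s hs => (hq s hs).deriv) ht (Set.mem_Ioi.2 one_pos)
    simpa using this
  have h0 := hasDerivAt_iff_tendsto_slope_zero.1 (hasDerivAt_along_ray hf x α 0)
  have h1 := h0.mono_left (nhdsGT_le_nhdsNE (0 : ℝ))
  simp only [zero_add, zero_smul] at h1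
  refine tendsto_nhds_unique (tendsto_const_nhds.congr' ?_) h1
  filter_upwards [self_mem_nhdsWithin] with t ht
  rw [← hconst t ht, smul_eq_mul, div_eq_inv_mul]

/-- An entire minimal graph with bounded slope admitting a bounded function whose Laplacian
dominates the squared Hessian is affine. -/
theorem eq_affine_of_bounded_subharmonic {f : (Fin n → ℝ) → (Fin m → ℝ)}
    (hf : ContDiff ℝ (⊤ : ℕ∞) f) (hmin : MinimalSystem f) {β B : ℝ}
    (hβ : ∀ x, slopeFunction f x ≤ β) {u : (Fin n → ℝ) → ℝ} (hu : Smooth u)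
    (hub : ∀ x, 0 ≤ u x ∧ u x ≤ B) {ε : ℝ} (hε : 0 < ε)
    (hL : ∀ x, ε * hessSq f x ≤ metricLaplacian f u x) (x : Fin n → ℝ) (α : Fin m) :
    f x α - f 0 α = ∑ i, slopes f 0 i α * x i := by
  obtain ⟨r, L, hr, hrt, hrL⟩ := exists_blowDown hf hβ fun δ hδ r₀ hr₀ =>
    exists_scaled_energy_lt hf hmin hβ hu hub hε hL hδ hr₀
  refine sub_eq_sum_slopes_zero hf (fun y => ?_) x
  exact sub_eq_sum_slopes_of_normalDistSq (normalDistSq_eq_zero_of_areaRatio hf hmin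
    (fun R hR => areaRatio_one_eq_of_slopes_tendsto hf hmin hβ hr hrt hrL hR) y) α

end Rigidity

end MinimalGraphs

/-- **Bernstein type theorem** (Theorem 1.2): an entire graph in `ℝ^{n+m}` (`n ≥ 3`, `m ≥ 2`)
with parallel mean curvature, bounded slope `Δ_f ≤ β₀ < ∞`, and
`Δ_f ≤ β₁ (1 + (∂f¹/∂x¹)²)^{1/2}` with `β₁ < 3`, is an affine `n`-plane. -/
theorem bernstein_parallel_mean_curvature_refined_slope
    {n m : ℕ} (hn : 3 ≤ n) (hm : 2 ≤ m)
    (f : (Fin n → ℝ) → (Fin m → ℝ)) (hf : ContDiff ℝ (⊤ : ℕ∞) f)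
    (hpmc : HasParallelMeanCurvature f)
    (β₀ β₁ : ℝ) (hβ₁ : β₁ < 3)
    (hslope₀ : ∀ x : Fin n → ℝ, slopeFunction f x ≤ β₀)
    (hslope₁ : ∀ x : Fin n → ℝ, slopeFunction f x ≤
      β₁ * Real.sqrt (1 + (pderiv' (⟨0, by omega⟩ : Fin n)
        (fun y => f y (⟨0, by omega⟩ : Fin m)) x) ^ 2)) :
    ∃ (A : Matrix (Fin m) (Fin n) ℝ) (b : Fin m → ℝ),
      ∀ x : Fin n → ℝ, f x = A.mulVec x + b := by
  have hH := minimalSystem_of_meanCurvature_eq_zero (f := f)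
    (hpmc.meanCurvature_eq_zero hf)
  obtain ⟨u, ε, B, hu, hε, hub, hL⟩ := exists_bounded_subharmonic hf hH _ _ hβ₁ hslope₀ hslope₁
  refine ⟨Matrix.of fun α i => slopes f 0 i α, f 0, fun x => funext fun α => ?_⟩
  rw [Pi.add_apply, ← sub_eq_iff_eq_add,
    eq_affine_of_bounded_subharmonic hf hH hslope₀ hu hub hε hL x α]
  rfl
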